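/- For every n ≥ 5, the number v_n of n-quasigroups of order 4 satisfies 3^(n+1)·2^(2^n + 1) ≤ v_n ≤ (3^(n+1) + 1)·2^(2^n + 1). -/

import Mathlib

/-- The alphabet `Σ = {0,1,2,3}`. -/
abbrev V4 := Fin 4

/-- An `n`-quasigroup of order 4: for every point, index and value there is
exactly one way to complete along the line. -/
def IsNQuasigroup {n : ℕ} (f : (Fin n → V4) → V4) : Prop :=
  ∀ (a : Fin n → V4) (i : Fin n) (b : V4),
    ∃! x : V4, f (Function.update a i x) = b

namespace QG
open Function
open Finset (mem_sdiff mem_insert piecewise_eq_of_notMem piecewise_eq_of_mem mem_singleton mem_union card_le_card mem_filter ssubset_iff_subset_ne mem_product sdiff_subset card_lt_card card_union_le card_insert_of_notMem union_subset mem_union_left mem_union_right subset_union_left card_union_of_disjoint mem_erase)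
local notation "Qd" => Fin 4
local notation "Td" => Fin 3
local notation "Sn" => Finset ℕ
abbrev P := ℕ → Qd
local notation "Pf" => (P → Qd)
def Dep {α : Type} (A : Sn) (f : P → α) : Prop :=
  ∀ x y : P, (∀ i ∈ A, x i = y i) → f x = f y
def Two (g : Qd → Bool) : Prop := (Finset.univ.filter (fun v => g v = true)).card = 2
instance (g : Qd → Bool) : Decidable (Two g) := by unfold Two; infer_instance
structure Bal (A : Sn) (c : P → Bool) : Prop where
  dep : Dep A c
  two : ∀ x : P, ∀ i ∈ A, Two (fun v => c (update x i v))
def odd (c : P → Bool) (x : P) (i : ℕ) (u : Qd) (j : ℕ) (v : Qd) : Bool :=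
  (c x ^^ c (update x i u)) ^^ (c (update x j v) ^^ c (update (update x i u) j v))
def SepC (c : P → Bool) (i j : ℕ) : Prop := ∀ x u v, odd c x i u j v = false
def ConnC (c : P → Bool) (A : Sn) : Prop :=
  ∀ X ⊆ A, X.Nonempty → X ≠ A → ∃ i ∈ X, ∃ j ∈ A \ X, ¬ SepC c i j
theorem Dep.upd {α : Type} {A : Sn} {f : P → α} (h : Dep A f) {i : ℕ} (hi : i ∉ A) (x : P) (v : Qd) : f (update x i v) = f x := by
  apply h; intro j hj; rw [update_of_ne]; rintro rfl; exact hi hj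
theorem Dep.mono {α : Type} {A B : Sn} {f : P → α} (h : Dep A f) (hAB : A ⊆ B) : Dep B f :=
  fun x y hxy => h x y fun i hi => hxy i (hAB hi)
theorem walk {α : Type} (A : Sn) (Φ : (ℕ → α) → Prop) (hs : ∀ x, ∀ k ∈ A, ∀ v, Φ x → Φ (update x k v)) (x y : ℕ → α) (hxy : ∀ i, i ∉ A → x i = y i) (hx : Φ x) : Φ y := by
  induction A using Finset.induction_on generalizing x with
  | empty => have : x = y := funext fun i => hxy i (by simp); rwa [← this]
  | insert a s ha ih =>
    apply ih (fun x k hk v => hs x k (Finset.mem_insert_of_mem hk) v) (update x a (y a))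
    · intro i hi
      by_cases h : i = a
      · subst h; simp
      · rw [update_of_ne h]; apply hxy; simp [h, hi]
    · exact hs x a (Finset.mem_insert_self _ _) _ hx
theorem odd_comm (c : P → Bool) (x : P) {i j : ℕ} (hij : i ≠ j) (u v : Qd) : odd c x i u j v = odd c x j v i u := by
  unfold odd; rw [update_comm hij]
  cases c x <;> cases c (update x i u) <;> cases c (update x j v) <;> simp
theorem SepC.symm {c : P → Bool} {i j : ℕ} (h : SepC c i j) : SepC c j i := by
  by_cases hij : i = j
  · subst hij; exact h
  · intro x u v; rw [odd_comm c x (Ne.symm hij)]; exact h x v u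
theorem odd_dep {c : P → Bool} {A : Sn} (h : Dep A c) (x y : P) (hxy : ∀ i ∈ A, x i = y i) (i : ℕ) (u : Qd) (j : ℕ) (v : Qd) : odd c x i u j v = odd c y i u j v := by
  unfold odd
  have h1 : ∀ i u, (∀ k ∈ A, update x i u k = update y i u k) := by
    intro i u k hk
    by_cases h : k = i
    · subst h; simp
    · rw [update_of_ne h, update_of_ne h]; exact hxy k hk
  have h2 : ∀ k ∈ A, update (update x i u) j v k = update (update y i u) j v k := by
    intro k hk
    by_cases h : k = j
    · subst h; simp
    · rw [update_of_ne h, update_of_ne h]; exact h1 i u k hk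
  rw [h x y hxy, h _ _ (h1 i u), h _ _ (h1 j v), h _ _ h2]
section D1
variable {A : Sn} {c : P → Bool}
def Tg (A : Sn) (c : P → Bool) (x y : P) : Prop := ∃ i ∈ A, ∃ v, y = update x i v ∧ c y = c x
def Cls (A : Sn) (c : P → Bool) : P → P → Prop := Relation.ReflTransGen (Tg A c)
def Cr (c : P → Bool) (i : ℕ) (x y : P) : Prop := ∃ v, y = update x i v ∧ c y ≠ c x
theorem Tg.symm {x y : P} (h : Tg A c x y) : Tg A c y x := by
  obtain ⟨i, hi, v, rfl, hc⟩ := h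
  exact ⟨i, hi, x i, by simp, hc.symm⟩
theorem Cls.symm {x y : P} (h : Cls A c x y) : Cls A c y x := by
  induction h with
  | refl => exact .refl
  | tail _ h2 ih => exact .head h2.symm ih
theorem Cr.symm {i : ℕ} {x y : P} (h : Cr c i x y) : Cr c i y x := by
  obtain ⟨v, rfl, hc⟩ := h
  exact ⟨x i, by simp, hc.symm⟩
theorem two1 : ∀ g g' : Qd → Bool, Two g → Two g' → ∀ a, g a = g' a → ∃ r, g r ≠ g a ∧ g' r ≠ g a := by decide
theorem two2 : ∀ g g' : Qd → Bool, Two g → Two g' → ∀ a, g a ≠ g' a → ∃ r, g r ≠ g a ∧ g' r = g a := by decide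
theorem two3 : ∀ g : Qd → Bool, Two g → ∀ a, ∃ r, g r ≠ g a := by decide
theorem Cr.ex (hb : Bal A c) {i : ℕ} (hi : i ∈ A) (x : P) : ∃ y, Cr c i x y := by
  obtain ⟨r, hr⟩ := two3 _ (hb.two x i hi) (x i); refine ⟨_, r, rfl, ?_⟩
  simpa using hr
theorem wd1 {i : ℕ} (hi : i ∈ A) {x y y' : P} (h : Cr c i x y) (h' : Cr c i x y') : Cls A c y y' := by
  obtain ⟨v, rfl, hv⟩ := h; obtain ⟨w, rfl, hw⟩ := h'; apply Relation.ReflTransGen.single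
  refine ⟨i, hi, w, by simp, ?_⟩
  cases h1 : c (update x i w) <;> cases h2 : c (update x i v) <;> cases h3 : c x <;> simp_all
theorem wd2 (hb : Bal A c) {i : ℕ} (hi : i ∈ A) {x x' : P} (h : Tg A c x x') {y y' : P} (hy : Cr c i x y) (hy' : Cr c i x' y') : Cls A c y y' := by
  obtain ⟨j, hj, v, rfl, hc⟩ := h
  by_cases hij : i = j
  · subst hij
    have : Cr c i x y' := by
      obtain ⟨w, rfl, hw⟩ := hy'
      exact ⟨w, by simp, by rw [← hc]; exact hw⟩
    exact wd1 hi hy this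
  · have e : update x j v i = x i := update_of_ne hij _ _
    obtain ⟨r, h1, h2⟩ := two1 _ _ (hb.two x i hi) (hb.two (update x j v) i hi) (x i) (by
      have : update (update x j v) i (x i) = update x j v := by rw [← e]; simp
      simp only [this, hc, update_eq_self])
    have h3 : Cr c i x (update x i r) := ⟨r, rfl, by simpa using h1⟩
    have h4 : Cr c i (update x j v) (update (update x j v) i r) :=
      ⟨r, rfl, by rw [hc]; simpa using h2⟩
    refine (wd1 hi hy h3).trans (.trans (.single ?_) (wd1 hi h4 hy'))
    refine ⟨j, hj, v, by rw [update_comm hij], ?_⟩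
    obtain ⟨_, _, h5⟩ := h3; obtain ⟨_, _, h6⟩ := h4; rw [hc] at h6
    cases h1 : c (update x i r) <;> cases h2 : c (update (update x j v) i r) <;>
      cases h3 : c x <;> simp_all
theorem wd (hb : Bal A c) {i : ℕ} (hi : i ∈ A) {x x' : P} (h : Cls A c x x') {y y' : P} (hy : Cr c i x y) (hy' : Cr c i x' y') : Cls A c y y' := by
  induction h generalizing y' with
  | refl => exact wd1 hi hy hy'
  | tail _ h2 ih =>
    rename_i b d _
    obtain ⟨w, hw⟩ := Cr.ex hb hi b; exact (ih hw).trans (wd2 hb hi h2 hw hy')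
theorem comm (hb : Bal A c) {i k : ℕ} (hi : i ∈ A) {x x' : P} (h : Cr c k x x') : ∃ w y, Cr c i x w ∧ Cr c k w y ∧ Cr c i x' y := by
  by_cases hik : i = k
  · subst hik; exact ⟨x', x, h, h.symm, h.symm⟩
  · obtain ⟨v, rfl, hv⟩ := h; have e : update x k v i = x i := update_of_ne hik _ _
    have e2 : update (update x k v) i (x i) = update x k v := by rw [← e]; simp
    obtain ⟨s, h1, h2⟩ := two2 _ _ (hb.two x i hi) (hb.two (update x k v) i hi) (x i) (by
      simp only [e2, update_eq_self]; exact hv.symm)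
    simp only [update_eq_self] at h1 h2
    refine ⟨update x i s, update (update x k v) i s, ⟨s, rfl, h1⟩, ⟨v, by rw [update_comm hik], ?_⟩, ⟨s, rfl, ?_⟩⟩
    · rw [h2]; exact h1.symm
    · rw [h2]; exact hv.symm
def SS (A : Sn) (c : P → Bool) (i j : ℕ) (x : P) : Prop :=
  ∀ y y', Cr c i x y → Cr c j x y' → Cls A c y y'
theorem SS.step (hb : Bal A c) {i j k : ℕ} (hi : i ∈ A) (hj : j ∈ A) (hk : k ∈ A) {x : P} (h : SS A c i j x) (v : Qd) : SS A c i j (update x k v) := by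
  intro y y' hy hy'
  by_cases hc : c (update x k v) = c x
  · have ht : Tg A c x (update x k v) := ⟨k, hk, v, rfl, hc⟩; obtain ⟨w, hw⟩ := Cr.ex hb hi x; obtain ⟨w', hw'⟩ := Cr.ex hb hj x; exact (wd2 hb hi ht hw hy).symm.trans ((h _ _ hw hw').trans (wd2 hb hj ht hw' hy'))
  · have hx : Cr c k x (update x k v) := ⟨v, rfl, hc⟩; obtain ⟨w, y1, a1, a2, a3⟩ := comm hb hi hx; obtain ⟨w', y1', b1, b2, b3⟩ := comm hb hj hx; have := wd hb hk (h _ _ a1 b1) a2 b2; exact (wd1 hi hy a3).trans (this.trans (wd1 hj b3 hy'))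
theorem SS.of_odd (hb : Bal A c) {i j : ℕ} (hi : i ∈ A) (hj : j ∈ A) (hij : i ≠ j) (h : ¬ SepC c i j) (z : P) : SS A c i j z := by
  unfold SepC at h
  push Not at h
  obtain ⟨x0, u, v, h⟩ := h
  set x : P := A.piecewise x0 z with hx
  have ho : odd c x i u j v = true := by
    rw [odd_dep hb.dep x x0 (fun k hk => by simp [hx, hk])]; simpa using h
  suffices hs : ∃ o, SS A c i j o ∧ ∀ k, k ∉ A → o k = z k by
    obtain ⟨o, h1, h2⟩ := hs
    exact walk A (SS A c i j) (fun x k hk v h => h.step hb hi hj hk v) o z h2 h1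
  have hz : ∀ k, k ∉ A → x k = z k := fun k hk => by simp [hx, hk]
  have key : ∀ o : P, (∀ k, k ∉ A → o k = z k) → ∀ a b, c (update o i a) ≠ c o → c (update o j b) ≠ c o → c (update (update o i a) j b) ≠ c o →
      ∃ o, SS A c i j o ∧ ∀ k, k ∉ A → o k = z k := by
    intro o ho a b h1 h2 h3; refine ⟨o, ?_, ho⟩; intro y y' hy hy'; refine (wd1 hi hy ⟨a, rfl, h1⟩).trans (.trans ?_ (wd1 hj ⟨b, rfl, h2⟩ hy'))
    have e1 : Tg A c (update o i a) (update (update o i a) j b) := by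
      refine ⟨j, hj, b, rfl, ?_⟩
      cases h1' : c (update o i a) <;> cases h2' : c (update (update o i a) j b) <;>
        cases h3' : c o <;> simp_all
    have e2 : Tg A c (update o j b) (update (update o i a) j b) := by
      refine ⟨i, hi, a, by rw [update_comm hij], ?_⟩
      cases h1' : c (update o j b) <;> cases h2' : c (update (update o i a) j b) <;>
        cases h3' : c o <;> simp_all
    exact .trans (.single e1) (.single e2.symm)
  have ni : ∀ k, k ∉ A → k ≠ i := fun k hk h => hk (h ▸ hi)
  have nj : ∀ k, k ∉ A → k ≠ j := fun k hk h => hk (h ▸ hj)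
  have r1 : update (update (update x i u) j v) i (x i) = update x j v := by
    funext k; by_cases hk : k = i
    · subst hk; simp [update_of_ne hij]
    · simp [hk, update_apply]
  have r2 : update (update x j v) i u = update (update x i u) j v := by rw [update_comm hij]
  have r3 : update (update x j v) j (x j) = x := by simp
  have r4 : update (update x i u) i (x i) = x := by simp
  have r5 : update (update (update x i u) j v) j (x j) = update x i u := by
    funext k; by_cases hk : k = j
    · subst hk; simp [update_of_ne hij.symm]
    · simp [hk]
  have r6 : update (update (update x j v) i u) j (x j) = update x i u := by rw [r2, r5]
  have r7 : update x i u = update (update x i u) j (x j) := by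
    funext k; by_cases hk : k = j
    · subst hk; simp [update_of_ne hij.symm]
    · simp [hk]
  have r8 : update (update (update (update x i u) j v) i (x i)) j (x j) = x := by rw [r1, r3]
  unfold odd at ho; have k0 := key x hz u v
  have k1 := key (update x i u) (fun k hk => by rw [update_of_ne (ni k hk)]; exact hz k hk) (x i) v
  have k2 := key (update x j v) (fun k hk => by rw [update_of_ne (nj k hk)]; exact hz k hk) u (x j)
  have k3 := key (update (update x i u) j v) (fun k hk => by
    rw [update_of_ne (nj k hk), update_of_ne (ni k hk)]; exact hz k hk) (x i) (x j)
  rw [r4] at k1; rw [r2, r3, r5] at k2; rw [r8, r1, r5] at k3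
  clear_value x
  generalize c x = a0 at ho k0 k1 k2 k3; generalize c (update x i u) = a1 at ho k0 k1 k2 k3; generalize c (update x j v) = a2 at ho k0 k1 k2 k3; generalize c (update (update x i u) j v) = a3 at ho k0 k1 k2 k3
  cases a0 <;> cases a1 <;> cases a2 <;> cases a3 <;>
    first
    | exact absurd ho (by decide)
    | exact k0 (by decide) (by decide) (by decide)
    | exact k1 (by decide) (by decide) (by decide)
    | exact k2 (by decide) (by decide) (by decide)
    | exact k3 (by decide) (by decide) (by decide)
theorem SS.all (hb : Bal A c) (hc : ConnC c A) {i : ℕ} (hi : i ∈ A) : ∀ j ∈ A, ∀ x, SS A c i j x := by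
  classical
  set T := A.filter (fun j => ∀ x, SS A c i j x) with hT
  by_cases h : T = A
  · intro j hj; rw [← h] at hj; exact (Finset.mem_filter.1 hj).2
  · obtain ⟨i', hi', j', hj', hn⟩ := hc T (Finset.filter_subset _ _)
      ⟨i, Finset.mem_filter.2 ⟨hi, fun x y y' h h' => wd1 hi h h'⟩⟩ h
    exfalso
    rw [mem_sdiff] at hj'; apply hj'.2; have hi'' := Finset.mem_filter.1 hi'
    have hne : i' ≠ j' := by rintro rfl; exact hj'.2 hi'
    refine Finset.mem_filter.2 ⟨hj'.1, fun x y y' h1 h2 => ?_⟩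
    obtain ⟨w, hw⟩ := Cr.ex hb hi''.1 x; exact (hi''.2 x y w h1 hw).trans (SS.of_odd hb hi''.1 hj'.1 hne hn x w y' hw h2)
theorem D1 (hb : Bal A c) (hc : ConnC c A) (U : P → Prop) (hU : Dep A U) (hcl : ∀ x, ∀ i ∈ A, ∀ v, c (update x i v) = c x → U x → U (update x i v)) (x y : P) (hxy : c y = c x) (hx : U x) : U y := by
  classical
  have hcls : ∀ a b, Cls A c a b → U a → U b := by
    intro a b h
    induction h with
    | refl => exact id
    | tail _ h2 ih =>
      intro ha; obtain ⟨i, hi, v, rfl, hv⟩ := h2; exact hcl _ i hi v hv (ih ha)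
  set y' : P := A.piecewise y x with hy'
  have e : ∀ i ∈ A, y' i = y i := fun i hi => by simp [hy', hi]
  rw [← hU y' y e]
  have hc' : c y' = c x := by rw [← hxy]; exact hb.dep _ _ e
  have := walk A (fun w => (c w = c x ∧ Cls A c x w) ∨
      (c w ≠ c x ∧ ∀ i ∈ A, ∀ y, Cr c i x y → Cls A c y w)) ?_ x y'
      (fun i hi => by simp [hy', hi]) (Or.inl ⟨rfl, .refl⟩)
  · rcases this with h | h
    · exact hcls _ _ h.2 hx
    · exact absurd hc' h.1
  · intro w k hk v hw
    by_cases hv : c (update w k v) = c w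
    · have ht : Cls A c w (update w k v) := .single ⟨k, hk, v, rfl, hv⟩; rw [hv]; rcases hw with h | h
      · exact Or.inl ⟨h.1, h.2.trans ht⟩
      · exact Or.inr ⟨h.1, fun i hi y hy => (h.2 i hi y hy).trans ht⟩
    · have hcr : Cr c k w (update w k v) := ⟨v, rfl, hv⟩; rcases hw with h | h
      · right
        refine ⟨by rw [← h.1]; exact hv, fun i hi y hy => ?_⟩
        obtain ⟨y2, hy2⟩ := Cr.ex hb hk x; exact (SS.all hb hc hi k hk x y y2 hy hy2).trans (wd hb hk h.2 hy2 hcr)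
      · left
        obtain ⟨y2, hy2⟩ := Cr.ex hb hk x; refine ⟨?_, wd hb hk (h.2 k hk y2 hy2) hy2.symm hcr⟩; have := h.1
        cases h1 : c (update w k v) <;> cases h2 : c w <;> cases h3 : c x <;> simp_all
end D1
def chi (p : Td) (v : Qd) : Bool :=
  match p with
  | 0 => decide (2 ≤ v.val)
  | 1 => decide (v.val % 2 = 1)
  | 2 => (decide (2 ≤ v.val)) ^^ (decide (v.val % 2 = 1))
def mate (p : Td) (v : Qd) : Qd :=
  match p with
  | 0 => ![1, 0, 3, 2] v
  | 1 => ![2, 3, 0, 1] v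
  | 2 => ![3, 2, 1, 0] v
theorem chi_mate : ∀ p v, chi p (mate p v) = chi p v := by decide
theorem mate_ne : ∀ p v, mate p v ≠ v := by decide
theorem mate_mate : ∀ p v, mate p (mate p v) = v := by decide
theorem chi_eq : ∀ p u v, chi p u = chi p v → u = v ∨ u = mate p v := by decide
theorem chi_sep : ∀ p q u v, p ≠ q → chi p u = chi p v → chi q u = chi q v → u = v := by decide
theorem chi_third : ∀ p q r v, p ≠ q → p ≠ r → q ≠ r → chi r v = (chi p v ^^ chi q v) := by decide
theorem chi_two (p : Td) (g : Qd → Qd) (hg : Injective g) : Two (fun v => chi p (g v)) := by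
  have h0 : ∀ p, Two (chi p) := by decide
  have := h0 p; unfold Two at this ⊢; rw [← this]
  exact Finset.card_bijective g (Finite.injective_iff_bijective.1 hg) (by simp)
def cc (p : Td) (f : Pf) : P → Bool := fun x => chi p (f x)
structure Q (A : Sn) (f : Pf) : Prop where
  dep : Dep A f
  inj : ∀ x : P, ∀ i ∈ A, Injective (fun v => f (update x i v))
theorem Q.bal {A : Sn} {f : Pf} (h : Q A f) (p : Td) : Bal A (cc p f) where
  dep := fun x y hxy => by unfold cc; rw [h.dep x y hxy]
  two := fun x i hi => chi_two p _ (h.inj x i hi)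
theorem Q.ex {A : Sn} {f : Pf} (h : Q A f) (x : P) {i : ℕ} (hi : i ∈ A) (y : Qd) : ∃ v, f (update x i v) = y :=
  (Finite.injective_iff_surjective.1 (h.inj x i hi)) y
theorem Q.eq {A : Sn} {f : Pf} (h : Q A f) (x : P) {i : ℕ} (hi : i ∈ A) {u v : Qd} (e : f (update x i u) = f (update x i v)) : u = v := h.inj x i hi e
theorem Q.eq' {A : Sn} {f : Pf} (h : Q A f) (x : P) {i : ℕ} (hi : i ∈ A) {u : Qd} (e : f (update x i u) = f x) : u = x i := h.inj x i hi (by simpa using e)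
def Red (X : Sn) (f : Pf) : Prop :=
  ∀ x y w w', f (X.piecewise x w) = f (X.piecewise y w) → f (X.piecewise x w') = f (X.piecewise y w')
theorem pw_upd_in {X : Sn} {i : ℕ} (hi : i ∈ X) (x w : P) (v : Qd) : X.piecewise (update x i v) w = update (X.piecewise x w) i v := by
  funext k; by_cases hk : k = i
  · subst hk; simp [hi]
  · by_cases hX : k ∈ X <;> simp [hX, hk]
theorem pw_upd_out {X : Sn} {i : ℕ} (hi : i ∉ X) (x w : P) (v : Qd) : X.piecewise x (update w i v) = update (X.piecewise x w) i v := by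
  funext k; by_cases hk : k = i
  · subst hk; simp [hi]
  · by_cases hX : k ∈ X <;> simp [hX, hk]
theorem sep_split {A X : Sn} {c : P → Bool} (hd : Dep A c) (hs : ∀ i ∈ X, ∀ j ∈ A \ X, SepC c i j) (x x' z z' : P) : (c (X.piecewise x z) ^^ c (X.piecewise x' z)) = (c (X.piecewise x z') ^^ c (X.piecewise x' z')) := by
  have h1 : ∀ x z z' : P, ∀ i ∈ X, ∀ v, (c (X.piecewise x z) ^^ c (X.piecewise (update x i v) z)) =
      (c (X.piecewise x z') ^^ c (X.piecewise (update x i v) z')) := by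
    intro x z z' i hi v
    set z'' : P := (A \ X).piecewise z' z with hz''
    have e : ∀ y, c (X.piecewise y z') = c (X.piecewise y z'') := by
      intro y; apply hd; intro k hk
      by_cases hX : k ∈ X <;> simp [hX, hz'', hk]
    rw [e, e]
    refine (walk (A \ X) (fun w => (c (X.piecewise x z) ^^ c (X.piecewise (update x i v) z)) =
      (c (X.piecewise x w) ^^ c (X.piecewise (update x i v) w))) ?_ z z''
      (fun k hk => by simp [hz'', hk]) rfl)
    intro w k hk u hw; rw [hw]; have := hs i hi k hk (X.piecewise x w) v u; unfold odd at this; have hkX : k ∉ X := (Finset.mem_sdiff.1 hk).2; rw [pw_upd_out hkX, pw_upd_out hkX, pw_upd_in hi]; generalize c (X.piecewise x w) = a at *; generalize c (update (X.piecewise x w) i v) = a1 at *; generalize c (update (X.piecewise x w) k u) = a2 at *; generalize c (update (update (X.piecewise x w) i v) k u) = a3 at *; revert this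
    cases a <;> cases a1 <;> cases a2 <;> cases a3 <;> decide
  set x'' : P := X.piecewise x' x with hx''
  have e : ∀ z, X.piecewise x' z = X.piecewise x'' z := by
    intro z; funext k; by_cases hX : k ∈ X <;> simp [hX, hx'']
  rw [e, e]
  refine (walk X (fun y => (c (X.piecewise x z) ^^ c (X.piecewise y z)) =
      (c (X.piecewise x z') ^^ c (X.piecewise y z'))) ?_ x x''
      (fun k hk => by simp [hx'', hk]) (by simp))
  intro y i hi v hy; have := h1 y z z' i hi v; generalize c (X.piecewise x z) = a at *; generalize c (X.piecewise x z') = a1 at *; generalize c (X.piecewise y z) = a2 at *; generalize c (X.piecewise y z') = a3 at *; generalize c (X.piecewise (update y i v) z) = a4 at *; generalize c (X.piecewise (update y i v) z') = a5 at *; revert this hy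
  cases a <;> cases a1 <;> cases a2 <;> cases a3 <;> cases a4 <;> cases a5 <;> decide
theorem Q.frz {A X : Sn} {f : Pf} (h : Q A f) (hX : X ⊆ A) (w : P) : Q X (fun x => f (X.piecewise x w)) where
  dep := fun x y hxy => by
    apply h.dep; intro k _
    by_cases hk : k ∈ X
    · simp [hk, hxy k hk]
    · simp [hk]
  inj := fun x i hi u v e => by
    simp only [pw_upd_in hi] at e; exact h.inj _ i (hX hi) e
theorem ConnC.mono {X : Sn} {c c' : P → Bool} (h : ConnC c X) (hm : ∀ i ∈ X, ∀ j ∈ X, i ≠ j → SepC c' i j → SepC c i j) : ConnC c' X := by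
  intro Y hY hne hY'; obtain ⟨i, hi, j, hj, hn⟩ := h Y hY hne hY'; have := Finset.mem_sdiff.1 hj
  refine ⟨i, hi, j, hj, fun hs => hn (hm i (hY hi) j this.1 ?_ hs)⟩
  rintro rfl; exact this.2 hi
theorem D2 {A X : Sn} {f : Pf} (h : Q A f) (hX : X ⊆ A) (p : Td) (hs : ∀ i ∈ X, ∀ j ∈ A \ X, SepC (cc p f) i j) (hc : ConnC (cc p f) X) : Red X f := by
  intro x y w w' he; have hsp := sep_split (h.bal p).dep hs; have hq := h.frz hX w; have hq' := h.frz hX w'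
  have hc' : ConnC (cc p (fun x => f (X.piecewise x w))) X := by
    apply hc.mono; intro i hi j hj hij hsep x u v; have := hsep x u v; have e1 := hsp x (update x i u) x w; have e2 := hsp (update x j v) (update (update x i u) j v) x w
    have r : ∀ y, (∀ k, k ∉ X → y k = x k) → X.piecewise y x = y := by
      intro y hy; funext k; by_cases hk : k ∈ X
      · simp [hk]
      · simp [hk, hy k hk]
    have hni : ∀ k, k ∉ X → k ≠ i := fun k hk e => hk (e ▸ hi)
    have hnj : ∀ k, k ∉ X → k ≠ j := fun k hk e => hk (e ▸ hj)
    rw [r x (fun _ _ => rfl), r _ (fun k hk => by simp [hni k hk])] at e1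
    rw [r _ (fun k hk => by simp [hnj k hk]),
      r _ (fun k hk => by simp [hni k hk, hnj k hk])] at e2
    have hh : odd (cc p fun x => f (X.piecewise x w)) x i u j v = odd (cc p f) x i u j v := by
      unfold odd; rw [e1, e2]
      rfl
    rw [← hh]; exact this
  have key := D1 (hq.bal p) hc'
    (fun a => (f (X.piecewise a w) = f (X.piecewise x w) ∧ f (X.piecewise a w') = f (X.piecewise x w')) ∨ (f (X.piecewise a w) = mate p (f (X.piecewise x w)) ∧ f (X.piecewise a w') = mate p (f (X.piecewise x w')))) ?_ ?_ x y ?_ (Or.inl ⟨rfl, rfl⟩)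
  · rcases key with k | k
    · exact k.2.symm
    · rw [← he] at k; exact absurd k.1.symm (mate_ne _ _)
  · intro a b hab; have e1 := hq.dep a b hab; have e2 := hq'.dep a b hab
    beta_reduce at e1 e2
    simp only [e1, e2]
  · intro a i hi v hv hU
    by_cases hva : v = a i
    · subst hva; simpa using hU
    · have n1 : f (X.piecewise (update a i v) w) ≠ f (X.piecewise a w) := fun e => hva (hq.eq' a hi e)
      have n2 : f (X.piecewise (update a i v) w') ≠ f (X.piecewise a w') := fun e => hva (hq'.eq' a hi e)
      have hv' := hsp (update a i v) a w w'; unfold cc at hv hv'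
      beta_reduce at hv hv'
      rw [hv] at hv'; have m1 := (chi_eq _ _ _ hv).resolve_left n1
      have m2 := (chi_eq p (f (X.piecewise (update a i v) w')) (f (X.piecewise a w')) (by
        revert hv'; generalize chi p (f (X.piecewise a w)) = t1; generalize chi p (f (X.piecewise (update a i v) w')) = t2; generalize chi p (f (X.piecewise a w')) = t3
        cases t1 <;> cases t2 <;> cases t3 <;> decide)).resolve_left n2
      rcases hU with hU | hU
      · right; rw [m1, m2, hU.1, hU.2]; exact ⟨rfl, rfl⟩
      · left; rw [m1, m2, hU.1, hU.2, mate_mate, mate_mate]; exact ⟨rfl, rfl⟩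
  · show chi p (f _) = chi p (f _)
    rw [he]
theorem RC {A X : Sn} {f : Pf} (h : Q A f) (hX : X ⊆ A) {i : ℕ} (hi : i ∈ X) (hr : Red X f) (w : P) (p : Td) (hc : ConnC (cc p f) A) : ConnC (cc p (fun x => f ((A \ X.erase i).piecewise x w))) (A \ X.erase i) := by
  classical
  set A' := A \ X.erase i with hA'
  set f' : Pf := fun x => f (A'.piecewise x w) with hf'
  have hiA' : i ∈ A' := by simp [hA', hX hi]
  have hq' : Q A' f' := h.frz (sdiff_subset) w
  have hcomp : ∀ x : P, ∃ a, ∀ y : P, (∀ k ∈ X, y k = x k) → f' (update y i a) = f y := by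
    intro x; obtain ⟨a, ha⟩ := hq'.ex x hiA' (f x)
    refine ⟨a, fun y hy => ?_⟩
    have e0 : f (A'.piecewise (update x i a) w) =
        f (X.piecewise (update w i a) x) := by
      apply h.dep; intro k hk
      by_cases hki : k = i
      · subst hki; simp [hiA', hi]
      · by_cases hkX : k ∈ X
        · simp [hA', hkX, hki]
        · simp [hA', hkX, hki, hk]
    have e1 : f' (update y i a) = f (X.piecewise (update w i a) y) := by
      apply h.dep; intro k hk
      by_cases hki : k = i
      · subst hki; simp [hiA', hi]
      · by_cases hkX : k ∈ X
        · simp [hA', hkX, hki]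
        · simp [hA', hkX, hki, hk]
    have e2 : X.piecewise x x = x := by funext k; by_cases hk : k ∈ X <;> simp [hk]
    have e3 : X.piecewise x y = y := by
      funext k; by_cases hk : k ∈ X
      · simp [hk, hy k hk]
      · simp [hk]
    rw [e1]
    have := hr (update w i a) x x y (by rw [← e0, e2]; exact ha)
    rw [this, e3]
  choose φ hφ using hcomp
  intro Y hY hne hYA; by_contra hcon
  push Not at hcon
  have s1 : ∀ j ∈ X, ∀ k, k ∉ X → SepC (cc p f') i k → SepC (cc p f) j k := by
    intro j hj k hk hs x u v
    have hik : i ≠ k := fun e => hk (e ▸ hi)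
    have hne : ∀ l ∈ X, l ≠ k := fun l hl e => hk (e ▸ hl)
    have := hs (update x i (φ x)) (φ (update x j u)) v; unfold odd cc at *
    rw [hφ x x (fun _ _ => rfl), update_idem, update_comm hik,
      hφ x (update x k v) (fun l hl => by simp [hne l hl])] at this
    have hjk : j ≠ k := hne j hj
    have q1 : f' (update x i (φ (update x j u))) = f (update x j u) := by
      have := hφ (update x j u) (update x j u) (fun _ _ => rfl)
      rw [← this]; apply h.dep; intro l hl
      by_cases hli : l = i
      · subst hli; simp [hiA']
      · by_cases hlX : l ∈ X
        · simp [hA', hlX, hli]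
        · have : l ≠ j := fun e => hlX (e ▸ hj)
          simp [hA', hlX, hli, hl, this]
    have q2 : f' (update (update x k v) i (φ (update x j u))) = f (update (update x j u) k v) := by
      have := hφ (update x j u) (update (update x j u) k v) (fun l hl => by simp [hne l hl])
      rw [← this]; apply h.dep; intro l hl
      by_cases hli : l = i
      · subst hli; simp [hiA']
      · by_cases hlX : l ∈ X
        · simp [hA', hlX, hli]
        · have : l ≠ j := fun e => hlX (e ▸ hj)
          by_cases hlk : l = k
          · subst hlk; simp [hA', hlX, hli, hl, this]
          · simp [hA', hlX, hli, hl, this, hlk]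
    rw [q1, update_comm hik, q2] at this; exact this
  have s2 : ∀ j, j ∉ X → ∀ k, k ∉ X → SepC (cc p f') j k → SepC (cc p f) j k := by
    intro j hj k hk hs x u v
    have hne : ∀ l ∈ X, l ≠ k := fun l hl e => hk (e ▸ hl)
    have hnj : ∀ l ∈ X, l ≠ j := fun l hl e => hj (e ▸ hl)
    have hij := hnj i hi; have hik := hne i hi; have := hs (update x i (φ x)) u v; unfold odd cc at *
    rw [hφ x x (fun _ _ => rfl), update_comm hik, update_comm hij, update_comm hik,
      hφ x (update x k v) (fun l hl => by simp [hne l hl]),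
      hφ x (update x j u) (fun l hl => by simp [hnj l hl]),
      hφ x (update (update x j u) k v) (fun l hl => by simp [hnj l hl, hne l hl])] at this
    exact this
  have hmem : ∀ k ∈ A', k ≠ i → k ∉ X := by
    intro k hk hki hkX; simp [hA', hkX, hki] at hk
  have hAX : ∀ k ∈ A, k ∉ X → k ∈ A' := by
    intro k hk hkX; simp [hA', hk, hkX]
  by_cases hiY : i ∈ Y
  · obtain ⟨j, hj, k, hk, hn⟩ := hc (Y ∪ X) (union_subset
      (hY.trans sdiff_subset) hX) (hne.mono subset_union_left) (by
        intro e; apply hYA; apply Finset.Subset.antisymm hY; intro k hk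
        by_cases hki : k = i
        · rwa [hki]
        · have : k ∈ Y ∪ X := by rw [e]; exact (Finset.mem_sdiff.1 hk).1
          rcases Finset.mem_union.1 this with h | h
          · exact h
          · exact absurd h (hmem k hk hki))
    simp only [mem_sdiff, mem_union, not_or] at hk hj; have hkA' := hAX k hk.1 hk.2.2; apply hn
    by_cases hjX : j ∈ X
    · exact s1 j hjX k hk.2.2 (hcon i hiY k (by simp [hkA', hk.2.1]))
    · exact s2 j hjX k hk.2.2 (hcon j (hj.resolve_right hjX) k (by simp [hkA', hk.2.1]))
  · obtain ⟨j, hj, k, hk, hn⟩ := hc Y (hY.trans sdiff_subset) hne (by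
      rintro rfl; exact hiY (hX hi))
    apply hn; rw [mem_sdiff] at hk
    have hjX : j ∉ X := hmem j (hY hj) (fun e => hiY (e ▸ hj))
    by_cases hkX : k ∈ X
    · exact (s1 k hkX j hjX (hcon j hj i (by simp [hiA', hiY])).symm).symm
    · exact s2 j hjX k hkX (hcon j hj k (by simp [hAX k hk.1 hkX, hk.2]))
structure MDS (A : Sn) (T : P → Prop) : Prop where
  dep : Dep A T
  ex : ∀ x, ∀ i ∈ A, ∃ v, T (update x i v)
  un : ∀ x, ∀ i ∈ A, ∀ u v, T (update x i u) → T (update x i v) → u = v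
def Ag (J : Sn) (x y : P) : Prop := ∀ k, k ∉ J → x k = y k
theorem exists_comp (S : Sn) (R : ℕ → ℕ → Prop) {i : ℕ} (hi : i ∈ S) (hsym : ∀ a b, R a b → R b a) : ∃ C ⊆ S, i ∈ C ∧ (∀ a ∈ C, ∀ b ∈ S \ C, ¬ R a b) ∧ ∀ X ⊆ C, X.Nonempty → X ≠ C → ∃ a ∈ X, ∃ b ∈ C \ X, R a b := by
  classical
  have hex : ∃ n, ∃ C ⊆ S, C.card = n ∧ i ∈ C ∧ (∀ a ∈ C, ∀ b ∈ S \ C, ¬ R a b) :=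
    ⟨_, S, le_refl _, rfl, hi, fun a _ b hb => by simp at hb⟩
  obtain ⟨C, hCS, hcard, hiC, hcl⟩ := Nat.find_spec hex; refine ⟨C, hCS, hiC, hcl, ?_⟩; intro X hX hne hXC; by_contra hcon
  push Not at hcon
  have hlt : X.card < C.card := card_lt_card (Finset.ssubset_iff_subset_ne.2 ⟨hX, hXC⟩)
  by_cases hiX : i ∈ X
  · refine Nat.find_min hex (hcard ▸ hlt) ⟨X, hX.trans hCS, rfl, hiX, fun a ha b hb => ?_⟩
    rw [mem_sdiff] at hb
    by_cases hbC : b ∈ C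
    · exact hcon a ha b (Finset.mem_sdiff.2 ⟨hbC, hb.2⟩)
    · exact hcl a (hX ha) b (Finset.mem_sdiff.2 ⟨hb.1, hbC⟩)
  · have hlt' : (C \ X).card < C.card := by
      apply card_lt_card
      refine Finset.ssubset_iff_subset_ne.2 ⟨sdiff_subset, fun e => ?_⟩
      obtain ⟨z, hz⟩ := hne
      have : z ∈ C \ X := by rw [e]; exact hX hz
      exact (Finset.mem_sdiff.1 this).2 hz
    refine Nat.find_min hex (hcard ▸ hlt') ⟨C \ X, Finset.sdiff_subset.trans hCS, rfl, Finset.mem_sdiff.2 ⟨hiC, hiX⟩, fun a ha b hb hR => ?_⟩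
    simp only [mem_sdiff, not_and, not_not] at ha hb
    by_cases hbC : b ∈ C
    · exact hcon b (hb.2 hbC) a (Finset.mem_sdiff.2 ha) (hsym _ _ hR)
    · exact hcl a ha.1 b (Finset.mem_sdiff.2 ⟨hb.1, hbC⟩) hR
def fl (i : ℕ) (k : ℕ → Bool) : ℕ → Bool := update k i (!k i)
theorem fl_comm (i j : ℕ) (k : ℕ → Bool) : fl i (fl j k) = fl j (fl i k) := by
  by_cases h : i = j
  · subst h; rfl
  · unfold fl; rw [update_comm h, update_of_ne h, update_of_ne (Ne.symm h)]
def E (Λ : (ℕ → Bool) → Bool) (i j : ℕ) (k : ℕ → Bool) : Bool :=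
  (Λ k ^^ Λ (fl i k)) ^^ (Λ (fl j k) ^^ Λ (fl i (fl j k)))
theorem E_symm (Λ : (ℕ → Bool) → Bool) (i j : ℕ) (k : ℕ → Bool) : E Λ i j k = E Λ j i k := by
  unfold E; rw [fl_comm i j]
  cases Λ k <;> cases Λ (fl i k) <;> cases Λ (fl j k) <;> cases Λ (fl j (fl i k)) <;> rfl
theorem E_third (Λ : (ℕ → Bool) → Bool) (a b c : ℕ) (k : ℕ → Bool) : (E Λ a b k ^^ E Λ a b (fl c k)) = (E Λ b c k ^^ E Λ b c (fl a k)) := by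
  unfold E; simp only [fl_comm c a, fl_comm b a, fl_comm c b]; generalize Λ k = x0; generalize Λ (fl a k) = x1; generalize Λ (fl b k) = x2; generalize Λ (fl c k) = x3; generalize Λ (fl a (fl b k)) = x4; generalize Λ (fl a (fl c k)) = x5; generalize Λ (fl b (fl c k)) = x6; generalize Λ (fl a (fl b (fl c k))) = x7; revert x0 x1 x2 x3 x4 x5 x6 x7; decide
theorem two_mem : ∀ g : Qd → Bool, Two g → ∀ x y z, x ≠ y → g x = g y → z ≠ x → z ≠ y → g z ≠ g x := by
  decide
theorem two_pair : ∀ g : Qd → Bool, Two g → ∀ b, ∃ x y, x ≠ y ∧ g x = b ∧ g y = b ∧ ∀ z, g z = b → z = x ∨ z = y := by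
  decide
section T0
variable {A : Sn} {κ : ℕ → Qd → Bool} {Λ : (ℕ → Bool) → Bool} {T : P → Prop} {par : P → Bool}
def KK (κ : ℕ → Qd → Bool) (x : P) : ℕ → Bool := fun i => κ i (x i)
theorem KK_upd (x : P) (i : ℕ) (v : Qd) : KK κ (update x i v) = update (KK κ x) i (κ i v) := by
  funext k; by_cases hk : k = i
  · subst hk; simp [KK]
  · simp [KK, hk]
theorem KK_upd' (x : P) (i : ℕ) (v : Qd) : KK κ (update x i v) = KK κ x ∨ KK κ (update x i v) = fl i (KK κ x) := by
  rw [KK_upd]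
  by_cases h : κ i v = κ i (x i)
  · left; rw [h]; exact update_eq_self i (KK κ x)
  · right; unfold fl KK
    congr 1
    cases h1 : κ i v <;> cases h2 : κ i (x i) <;> simp_all
theorem KK_fl (hκ : Two (κ i)) (x : P) : ∃ v, KK κ (update x i v) = fl i (KK κ x) := by
  obtain ⟨v, hv⟩ := two3 _ hκ (x i)
  refine ⟨v, (KK_upd' x i v).resolve_left fun e => hv ?_⟩
  have := congrFun e i
  simpa [KK] using this
def Unm (T : P → Prop) (par : P → Bool) (J : Sn) (x : P) : Prop :=
  ∀ y y', Ag J x y → Ag J x y' → T y → T y' → par y = par y'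
theorem Unm.base {J : Sn} {x x' : P} (h : Unm T par J x) (hx : Ag J x x') : Unm T par J x' :=
  fun y y' hy hy' => h y y' (fun k hk => (hx k hk).trans (hy k hk)) (fun k hk => (hx k hk).trans (hy' k hk))
theorem Unm.mono {J J' : Sn} {x : P} (h : Unm T par J x) (hx : J' ⊆ J) : Unm T par J' x :=
  fun y y' hy hy' => h y y' (fun k hk => hy k fun hh => hk (hx hh)) (fun k hk => hy' k fun hh => hk (hx hh))
structure Ctx (A : Sn) (κ : ℕ → Qd → Bool) (T : P → Prop) (par : P → Bool) : Prop where
  mds : MDS A T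
  two : ∀ i ∈ A, Two (κ i)
  par : ∀ x, ∀ i ∈ A, ∀ v, par (update x i v) = (par x ^^ (κ i (x i) ^^ κ i v))
theorem TF1 (H : Ctx A κ T par) {i j g : ℕ} (hj : j ∈ A) (hg : g ∈ A) (hij : i ≠ j) (hig : i ≠ g) (hjg : j ≠ g) (x : P) (σ : Bool) (h1 : ∀ v, κ g v = σ → Unm T par {i, j} (update x g v)) (h2 : Unm T par {j, g} x) : Unm T par {i, j, g} x := by
  obtain ⟨v0, v1, hv, hv0, hv1, hvv⟩ := two_pair _ (H.two g hg) σ; obtain ⟨w0, hw0⟩ := H.mds.ex (update x g v0) j hj; obtain ⟨w1, hw1⟩ := H.mds.ex (update x g v1) j hj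
  have ea : par (update (update x g v0) j w0) = par (update (update x g v1) j w1) := by
    apply h2 _ _ _ _ hw0 hw1 <;>
    · intro k hk; simp only [mem_insert, mem_singleton, not_or] at hk; simp [hk]
  set a := par (update (update x g v0) j w0) with ha
  have c1 : ∀ y, Ag {i, j, g} x y → T y → κ g (y g) = σ → par y = a := by
    intro y hy hT hk; rcases hvv _ hk with e | e
    · refine h1 v0 hv0 _ _ ?_ ?_ hT hw0
      · intro k hk; simp only [mem_insert, mem_singleton, not_or] at hk
        by_cases hkg : k = g
        · subst hkg; simp [e]
        · simp only [ne_eq, hkg, not_false_eq_true, update_of_ne]; apply hy; simp [hk, hkg]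
      · intro k hk; simp only [mem_insert, mem_singleton, not_or] at hk; simp [hk]
    · rw [ea]; refine h1 v1 hv1 _ _ ?_ ?_ hT hw1
      · intro k hk; simp only [mem_insert, mem_singleton, not_or] at hk
        by_cases hkg : k = g
        · subst hkg; simp [e]
        · simp only [ne_eq, hkg, not_false_eq_true, update_of_ne]; apply hy; simp [hk, hkg]
      · intro k hk; simp only [mem_insert, mem_singleton, not_or] at hk; simp [hk]
  have c2 : ∀ y, Ag {i, j, g} x y → T y → par y = a := by
    intro y hy hT
    by_cases hs : κ g (y g) = σ
    · exact c1 y hy hT hs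
    obtain ⟨w0, hw0⟩ := H.mds.ex (update y g v0) j hj; obtain ⟨w1, hw1⟩ := H.mds.ex (update y g v1) j hj
    have ag : ∀ v w, Ag {i, j, g} x (update (update y g v) j w) := by
      intro v w k hk; have := hy k hk; simp only [mem_insert, mem_singleton, not_or] at hk; simp [hk, this]
    have p0 := c1 _ (ag v0 w0) hw0 (by simp [hjg.symm, hv0])
    have p1 := c1 _ (ag v1 w1) hw1 (by simp [hjg.symm, hv1])
    rw [H.par _ j hj, H.par _ g hg, update_of_ne hjg] at p0 p1
    have hww : w0 ≠ w1 := by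
      rintro rfl; rw [update_comm hjg.symm] at hw0 hw1; exact hv (H.mds.un _ g hg _ _ hw0 hw1)
    have n0 : y j ≠ w0 := by
      rintro rfl
      have : update (update y g v0) j (y j) = update y g v0 := by
        conv_lhs => rw [← update_of_ne hjg v0 y]
        simp
      rw [this] at hw0
      have := H.mds.un y g hg v0 (y g) hw0 (by simpa using hT)
      rw [← this] at hs; exact hs hv0
    have n1 : y j ≠ w1 := by
      rintro rfl
      have : update (update y g v1) j (y j) = update y g v1 := by
        conv_lhs => rw [← update_of_ne hjg v1 y]
        simp
      rw [this] at hw1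
      have := H.mds.un y g hg v1 (y g) hw1 (by simpa using hT)
      rw [← this] at hs; exact hs hv1
    rw [hv0] at p0; rw [hv1] at p1
    have hk : κ j w0 = κ j w1 := by
      rw [← p1] at p0; revert p0; generalize par y = b1; generalize κ j w0 = b2; generalize κ j w1 = b3; generalize κ j (y j) = b4; generalize κ g (y g) = b5
      cases b1 <;> cases b2 <;> cases b3 <;> cases b4 <;> cases b5 <;> cases σ <;> decide
    have := two_mem _ (H.two j hj) w0 w1 (y j) hww hk n0 n1; rw [← p0]; revert this hs; generalize par y = b1; generalize κ j w0 = b2; generalize κ j (y j) = b4; generalize κ g (y g) = b5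
    cases b1 <;> cases b2 <;> cases b4 <;> cases b5 <;> cases σ <;> decide
  intro y y' hy hy' hT hT'; rw [c2 y hy hT, c2 y' hy' hT']
end T0
section T0
variable {A : Sn} {κ : ℕ → Qd → Bool} {Λ : (ℕ → Bool) → Bool} {T : P → Prop} {par : P → Bool}
theorem Ag.trans {J : Sn} {x y z : P} (h : Ag J x y) (h' : Ag J y z) : Ag J x z :=
  fun k hk => (h k hk).trans (h' k hk)
theorem Ag.symm {J : Sn} {x y : P} (h : Ag J x y) : Ag J y x :=
  fun k hk => (h k hk).symm
theorem Ag.mono {J J' : Sn} {x y : P} (h : Ag J x y) (hj : J ⊆ J') : Ag J' x y :=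
  fun k hk => h k fun hh => hk (hj hh)
theorem Ag.rfl' {J : Sn} {x : P} : Ag J x x := fun _ _ => rfl
theorem Ag.upd {J : Sn} {x y : P} (h : Ag J x y) {k : ℕ} (hk : k ∈ J) (v : Qd) : Ag J x (update y k v) := by
  intro l hl
  have : l ≠ k := fun e => hl (e ▸ hk)
  rw [update_of_ne this]; exact h l hl
theorem Unm.of_pairs (hm : MDS A T) {J : Sn} (hJ : J ⊆ A) (b : P) (hp : ∀ i ∈ J, ∀ j ∈ J, i ≠ j → ∀ x, Ag J b x → Unm T par {i, j} x) : Unm T par J b := by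
  classical
  have key : ∀ n, ∀ y y', Ag J b y → Ag J b y' → T y → T y' → (J.filter (fun k => y k ≠ y' k)).card ≤ n →
      par y = par y' := by
    intro n
    induction n with
    | zero =>
      intro y y' hy hy' hT hT' hc
      have : y = y' := by
        funext k
        by_cases hk : k ∈ J
        · by_contra hne
          have : k ∈ J.filter (fun k => y k ≠ y' k) := Finset.mem_filter.2 ⟨hk, hne⟩
          rw [Finset.card_eq_zero.1 (Nat.le_zero.1 hc)] at this; simp at this
        · exact (hy k hk).symm.trans (hy' k hk)
      rw [this]
    | succ n ih =>
      intro y y' hy hy' hT hT' hc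
      by_cases hyy : y = y'
      · rw [hyy]
      have : ∃ i, y i ≠ y' i := by
        by_contra h; push Not at h; exact hyy (funext h)
      obtain ⟨i, hi⟩ := this
      have hiJ : i ∈ J := by
        by_contra h; exact hi ((hy i h).symm.trans (hy' i h))
      have : ∃ j, j ≠ i ∧ y j ≠ y' j := by
        by_contra h; push Not at h
        have e : y' = update y i (y' i) := by
          funext k; by_cases hk : k = i
          · subst hk; simp
          · simp [hk, h k hk]
        rw [e] at hT'
        exact hi (hm.un y i (hJ hiJ) _ _ (by simpa using hT) hT')
      obtain ⟨j, hji, hj⟩ := this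
      have hjJ : j ∈ J := by
        by_contra h; exact hj ((hy j h).symm.trans (hy' j h))
      obtain ⟨v, hv⟩ := hm.ex (update y i (y' i)) j (hJ hjJ); have hag : Ag J b (update (update y i (y' i)) j v) := (hy.upd hiJ _).upd hjJ _
      have e1 := hp i hiJ j hjJ hji.symm y hy y (update (update y i (y' i)) j v) Ag.rfl'
        ((Ag.rfl'.upd (by simp) _).upd (by simp) _) hT hv
      rw [e1]; refine ih _ _ hag hy' hv hT' ?_
      have hss : J.filter (fun k => update (update y i (y' i)) j v k ≠ y' k) ⊂ J.filter (fun k => y k ≠ y' k) := by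
        refine Finset.ssubset_iff_subset_ne.2 ⟨?_, ?_⟩
        · intro k hk; rw [mem_filter] at hk ⊢; refine ⟨hk.1, ?_⟩
          by_cases hkj : k = j
          · subst hkj; exact hj
          · by_cases hki : k = i
            · subst hki; exact hi
            · simpa [hkj, hki] using hk.2
        · intro e
          have : i ∈ J.filter (fun k => y k ≠ y' k) := Finset.mem_filter.2 ⟨hiJ, hi⟩
          rw [← e] at this; simp [hji.symm] at this
      have := card_lt_card hss; omega
  intro y y' hy hy' hT hT'; exact key _ y y' hy hy' hT hT' le_rfl
def Econn (κ : ℕ → Qd → Bool) (Λ : (ℕ → Bool) → Bool) (J : Sn) (b : P) : Prop :=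
  ∀ X ⊆ J, X.Nonempty → X ≠ J → ∃ i ∈ X, ∃ j ∈ J \ X, ∃ x, Ag J b x ∧ E Λ i j (KK κ x) = true
theorem layer (H : Ctx A κ T par) {J : Sn} (hJ : J ⊆ A) (ih : ∀ J' ⊂ J, 2 ≤ J'.card → ∀ b, Econn κ Λ J' b → Unm T par J' b) (b : P) {i j f : ℕ} (hi : i ∈ J) (hj : j ∈ J) (hf : f ∈ J) (hij : i ≠ j) (hfi : f ≠ i) (hfj : f ≠ j) (x0 : P) (hx0 : Ag J b x0) (hE : E Λ i j (KK κ x0) = true) (x : P) (hx : Ag J b x) (hxf : κ f (x f) = κ f (x0 f)) : Unm T par {i, j} x := by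
  classical
  obtain ⟨C, hCS, hiC, hcl, hcon⟩ := exists_comp (J.erase f)
    (fun a b' => ∃ z, Ag J b z ∧ κ f (z f) = κ f (x0 f) ∧ E Λ a b' (KK κ z) = true) (i := i)
    (Finset.mem_erase.2 ⟨hfi.symm, hi⟩) (by
      rintro a b' ⟨z, h1, h2, h3⟩; exact ⟨z, h1, h2, by rw [E_symm]; exact h3⟩)
  have hCJ : C ⊆ J := hCS.trans (Finset.erase_subset _ _)
  have hfC : f ∉ C := fun h => by simpa using hCS h
  have hjC : j ∈ C := by
    by_contra h; exact hcl i hiC j (Finset.mem_sdiff.2 ⟨Finset.mem_erase.2 ⟨hfj.symm, hj⟩, h⟩) ⟨x0, hx0, rfl, hE⟩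
  have hss : C ⊂ J := Finset.ssubset_iff_subset_ne.2 ⟨hCJ, fun e => hfC (e ▸ hf)⟩
  have h2 : 2 ≤ C.card := by
    have : ({i, j} : Sn) ⊆ C := by
      intro k hk; simp at hk; rcases hk with rfl | rfl <;> assumption
    have := card_le_card this
    rwa [Finset.card_pair hij] at this
  refine Unm.mono (ih C hss h2 x ?_) (by
      intro k hk; simp at hk; rcases hk with rfl | rfl <;> assumption)
  intro X hX hne hXC; obtain ⟨a, ha, c, hc, z, hz1, hz2, hz3⟩ := hcon X hX hne hXC
  refine ⟨a, ha, c, hc, C.piecewise z x, fun k hk => by simp [hk], ?_⟩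
  have hcC := (Finset.mem_sdiff.1 hc).1; have haC := hX ha
  have hw := walk (J.erase f \ C) (fun w => Ag J b w ∧ κ f (w f) = κ f (x0 f) ∧ E Λ a c (KK κ w) = true)
    ?_ z ((J.erase f \ C).piecewise x z) (fun k hk => by rw [piecewise_eq_of_notMem _ _ _ hk]) ⟨hz1, hz2, hz3⟩
  · obtain ⟨w1, w2, w3⟩ := hw; rw [← w3]
    congr 1
    funext k; unfold KK
    by_cases hkC : k ∈ C
    · simp [hkC]
    · by_cases hkf : k = f
      · subst hkf; simp [hkC, hxf, hz2]
      · by_cases hkJ : k ∈ J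
        · simp [hkC, hkf, hkJ]
        · simp only [hkC, not_false_eq_true, piecewise_eq_of_notMem, mem_sdiff, mem_erase, hkJ, and_false, not_true_eq_false, and_true]; rw [← hx k hkJ, ← hz1 k hkJ]
  · rintro w k hk v ⟨w1, w2, w3⟩; have hkJ : k ∈ J := Finset.mem_of_mem_erase (Finset.mem_sdiff.1 hk).1
    have hkf : f ≠ k := by
      rintro rfl; simp at hk
    have hw1 : Ag J b (update w k v) := w1.upd hkJ v
    have hw2 : κ f (update w k v f) = κ f (x0 f) := by rw [update_of_ne hkf]; exact w2
    refine ⟨hw1, hw2, ?_⟩; rcases KK_upd' (κ := κ) w k v with e | e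
    · rw [e]; exact w3
    · rw [e]; have t := E_third Λ a c k (KK κ w)
      have n1 : E Λ c k (KK κ w) = false := by
        by_contra hh
        exact hcl c hcC k hk ⟨w, w1, w2, by simpa using hh⟩
      obtain ⟨u, hu⟩ := KK_fl (H.two a (hJ (hCJ haC))) w
      have n2 : E Λ c k (fl a (KK κ w)) = false := by
        by_contra hh; rw [← hu] at hh
        refine hcl c hcC k hk ⟨update w a u, w1.upd (hCJ haC) u, ?_, by simpa using hh⟩
        rw [update_of_ne (show f ≠ a from fun e => hfC (e ▸ haC))]; exact w2
      rw [n1, n2, w3] at t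
      simpa using t
def Z (T : P → Prop) (par : P → Bool) (κ : ℕ → Qd → Bool) (J : Sn) (b : P) (y : ℕ → Bool) (i j : ℕ) : Prop :=
  ∀ x, Ag J b x → (∀ k ∈ J, k ≠ i → k ≠ j → κ k (x k) = y k) → Unm T par {i, j} x
theorem Z.symm {J : Sn} {b : P} {y : ℕ → Bool} {i j : ℕ} (h : Z T par κ J b y i j) : Z T par κ J b y j i := by
  intro x hx hk
  have := h x hx (fun k h1 h2 h3 => hk k h1 h3 h2)
  rwa [Finset.pair_comm]
theorem Z.tri (H : Ctx A κ T par) {J : Sn} (hJ : J ⊆ A) {b : P} {y : ℕ → Bool} {i j g : ℕ} (hi : i ∈ J) (hj : j ∈ J) (hg : g ∈ J) (hij : i ≠ j) (hig : i ≠ g) (hjg : j ≠ g) (h1 : Z T par κ J b y i j) (h2 : Z T par κ J b y j g) (x : P) (hx : Ag J b x) (hk : ∀ k ∈ J, k ≠ i → k ≠ j → k ≠ g → κ k (x k) = y k) : Unm T par {i, j, g} x := by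
  obtain ⟨u, _, _, hu, _⟩ := two_pair _ (H.two i (hJ hi)) (y i); refine Unm.base (x := update x i u) (TF1 H (hJ hj) (hJ hg) hij hig hjg _ (y g) ?_ ?_) ?_
  · intro v hv; apply h1 _ ((hx.upd hi _).upd hg _); intro k hkJ hki hkj
    by_cases hkg : k = g
    · subst hkg; simpa using hv
    · simpa [hkg, hki] using hk k hkJ hki hkj hkg
  · apply h2 _ (hx.upd hi _); intro k hkJ hkj hkg
    by_cases hki : k = i
    · subst hki; simpa using hu
    · simpa [hki] using hk k hkJ hki hkj hkg
  · intro k hk; simp only [mem_insert, not_or] at hk; simp [hk.1]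
theorem Z.fin (H : Ctx A κ T par) {J : Sn} (hJ : J ⊆ A) (b : P) (y : ℕ → Bool) (hc : ∀ X ⊆ J, X.Nonempty → X ≠ J → ∃ i ∈ X, ∃ j ∈ J \ X, Z T par κ J b y i j) : Unm T par J b := by
  classical
  have tr : ∀ i ∈ J, ∀ j ∈ J, ∀ g ∈ J, i ≠ j → i ≠ g → j ≠ g → Z T par κ J b y i j → Z T par κ J b y j g →
      Z T par κ J b y i g := by
    intro i hi j hj g hg hij hig hjg h1 h2 x hx hk
    refine (Z.tri H hJ hi hj hg hij hig hjg h1 h2 x hx (fun k a b' _ d => hk k a b' d)).mono ?_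
    intro k hk; simp at hk ⊢; tauto
  have comp : ∀ i ∈ J, ∀ j ∈ J, i ≠ j → Z T par κ J b y i j := by
    intro i hi
    set S := J.filter (fun j => j = i ∨ Z T par κ J b y i j) with hS
    have : S = J := by
      by_contra hne
      obtain ⟨a, ha, c, hcc, hz⟩ := hc S (Finset.filter_subset _ _)
        ⟨i, Finset.mem_filter.2 ⟨hi, Or.inl rfl⟩⟩ hne
      rw [mem_sdiff] at hcc; apply hcc.2; rw [mem_filter] at ha; refine Finset.mem_filter.2 ⟨hcc.1, Or.inr ?_⟩
      have hci : c ≠ i := by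
        rintro rfl; exact hcc.2 (Finset.mem_filter.2 ⟨hcc.1, Or.inl rfl⟩)
      rcases ha.2 with rfl | h
      · exact hz
      · by_cases hai : a = i
        · subst hai; exact hz
        · have hac : a ≠ c := by
            rintro rfl; exact hcc.2 (Finset.mem_filter.2 ⟨hcc.1, Or.inr h⟩)
          exact tr i hi a ha.1 c hcc.1 (Ne.symm hai) hci.symm hac h hz
    intro j hj hij; rw [← this] at hj; rcases (Finset.mem_filter.1 hj).2 with h | h
    · exact absurd h.symm hij
    · exact h
  have all : ∀ y', (∀ k, k ∉ J → y k = y' k) → ∀ i ∈ J, ∀ j ∈ J, i ≠ j → Z T par κ J b y' i j := by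
    intro y' hy'
    refine walk J (fun y => ∀ i ∈ J, ∀ j ∈ J, i ≠ j → Z T par κ J b y i j) ?_ y y' hy' comp
    intro w g hg v hw i hi j hj hij x hx hk
    by_cases hgi : g = i
    · subst hgi
      exact hw g hi j hj hij x hx (fun k a b' c => by simpa [b'] using hk k a b' c)
    by_cases hgj : g = j
    · subst hgj
      exact hw i hi g hj hij x hx (fun k a b' c => by simpa [c] using hk k a b' c)
    refine (Z.tri H hJ hi hj hg hij (Ne.symm hgi) (Ne.symm hgj) (hw i hi j hj hij) (hw j hj g hg (Ne.symm hgj)) x hx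
      (fun k a b' c d => by simpa [d] using hk k a b' c)).mono ?_
    intro k hk; simp at hk ⊢; tauto
  apply Unm.of_pairs H.mds hJ; intro i hi j hj hij x hx
  refine all (fun k => if k ∈ J then κ k (x k) else y k) (fun k hk => by simp [hk]) i hi j hj hij x hx ?_
  intro k hk _ _; simp [hk]
theorem St (H : Ctx A κ T par) (hyp : ∀ i ∈ A, ∀ j ∈ A, i ≠ j → ∀ x, E Λ i j (KK κ x) = true → Unm T par {i, j} x) : ∀ J ⊆ A, 2 ≤ J.card → ∀ b, Econn κ Λ J b → Unm T par J b := by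
  classical
  intro J
  induction J using Finset.strongInduction with
  | H J ih =>
  intro hJ h2 b hc
  have ih' : ∀ J' ⊂ J, 2 ≤ J'.card → ∀ b, Econn κ Λ J' b → Unm T par J' b := fun J' h1 h2 b h3 => ih J' h1 (h1.1.trans hJ) h2 b h3
  have toZ : ∀ (y : ℕ → Bool) (i j f : ℕ), i ∈ J → j ∈ J → f ∈ J → i ≠ j → f ≠ i → f ≠ j → ∀ x0, Ag J b x0 →
      E Λ i j (KK κ x0) = true → κ f (x0 f) = y f → Z T par κ J b y i j := by
    intro y i j f hi hj hf hij hfi hfj x0 hx0 hE hy x hx hk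
    exact layer H hJ ih' b hi hj hf hij hfi hfj x0 hx0 hE x hx (by rw [hk f hf hfi hfj, hy])
  have edge : ∀ X ⊆ J, X.Nonempty → X ≠ J → ∃ i ∈ X, ∃ j ∈ J \ X, i ≠ j ∧ i ∈ J ∧ j ∈ J ∧
      ∃ x, Ag J b x ∧ E Λ i j (KK κ x) = true := by
    intro X hX hne hXJ; obtain ⟨i, hi, j, hj, x, hx, hE⟩ := hc X hX hne hXJ; refine ⟨i, hi, j, hj, ?_, hX hi, (Finset.mem_sdiff.1 hj).1, x, hx, hE⟩; rintro rfl; exact (Finset.mem_sdiff.1 hj).2 hi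
  rcases Nat.lt_or_ge J.card 3 with hlt | h3
  ·
    have : J.card = 2 := by omega
    obtain ⟨i, j, hij, rfl⟩ := Finset.card_eq_two.1 this
    obtain ⟨i', hi', j', hj', hne, hi'', hj'', x, hx, hE⟩ := edge {i} (by simp) (by simp) (by
      intro e
      have : j ∈ ({i} : Sn) := by rw [e]; simp
      simp at this; exact hij this.symm)
    have hh := hyp i' (hJ hi'') j' (hJ hj'') hne x hE; simp only [mem_singleton] at hi'; subst hi'
    have : j' = j := by simp at hj''; rcases hj'' with h | h; exact absurd h.symm hne; exact h
    subst this; exact hh.base hx.symm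
  rcases Nat.lt_or_ge J.card 4 with hlt | h4
  ·
    have hcard : J.card = 3 := by omega
    obtain ⟨a0, ha0⟩ : J.Nonempty := Finset.card_pos.1 (by omega)
    obtain ⟨i0, hi0, j, hj, hne, hi, hjJ, x, hx, hE⟩ := edge {a0} (by simpa using ha0) (by simp) (by
      intro e; rw [← e] at hcard; simp at hcard)
    obtain ⟨i1, hi1, g, hg, hne1, hi1J, hgJ, x1, hx1, hE1⟩ := edge {i0, j}
      (by intro k hk; simp at hk; rcases hk with rfl | rfl <;> assumption) (by simp) (by
      intro e; rw [← e, Finset.card_pair hne] at hcard; omega)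
    have hg2 := (Finset.mem_sdiff.1 hg).2; simp only [mem_insert, mem_singleton, not_or] at hg2 hi1
    have hJ3 : J = {i0, j, g} := by
      symm; apply Finset.eq_of_subset_of_card_le
      · intro k hk; simp at hk; rcases hk with rfl | rfl | rfl <;> assumption
      · rw [hcard, card_insert_of_notMem (by simp [hne, Ne.symm hg2.1]), Finset.card_pair (Ne.symm hg2.2)]
    obtain ⟨i, j, hne, hi, hjJ, hJ3, x, hx, hE, hE1, hgi, hgj⟩ : ∃ i j, i ≠ j ∧ i ∈ J ∧ j ∈ J ∧ J = {i, j, g} ∧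
        ∃ x, Ag J b x ∧ E Λ i j (KK κ x) = true ∧ E Λ j g (KK κ x1) = true ∧ g ≠ i ∧ g ≠ j := by
      rcases hi1 with rfl | rfl
      · exact ⟨j, i1, hne.symm, hjJ, hi, by rw [hJ3, Finset.insert_comm], x, hx, by rw [E_symm]; exact hE, hE1, hg2.2, hg2.1⟩
      · exact ⟨i0, i1, hne, hi, hjJ, hJ3, x, hx, hE, hE1, hg2.1, hg2.2⟩
    set y : ℕ → Bool := fun k => if k = g then κ g (x g) else κ i (x1 i) with hy
    have z1 : Z T par κ J b y i j := toZ y i j g hi hjJ hgJ hne hgi hgj x hx hE (by simp [hy])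
    have z2 : Z T par κ J b y j g := toZ y j g i hjJ hgJ hi (Ne.symm hgj) hne (Ne.symm hgi) x1 hx1 hE1 (by
      simp [hy, Ne.symm hgi])
    have := Z.tri H hJ hi hjJ hgJ hne (Ne.symm hgi) (Ne.symm hgj) z1 z2 b Ag.rfl' (by
      intro k hk h1 h2 h3; rw [hJ3] at hk; simp at hk; tauto)
    rwa [← hJ3] at this
  · by_cases hB : ∃ i ∈ J, ∃ j ∈ J, i ≠ j ∧ (∃ x, Ag J b x ∧ E Λ i j (KK κ x) = true) ∧ ∀ f ∈ J, f ≠ i → f ≠ j → ∀ x, Ag J b x → κ f (x f) = false → E Λ i j (KK κ x) = false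
    · obtain ⟨i, hi, j, hj, hij, ⟨x, hx, hE⟩, hd⟩ := hB
      have hone : ∀ f ∈ J, f ≠ i → f ≠ j → κ f (x f) = true := by
        intro f hf h1 h2; by_contra hh
        rw [hd f hf h1 h2 x hx (by simpa using hh)] at hE
        exact absurd hE (by decide)
      have third : ∀ S : Sn, S.card ≤ 3 → ∃ f ∈ J, f ∉ S := by
        intro S hS; by_contra hh; push Not at hh; have := card_le_card hh; omega
      have star : ∀ g ∈ J, g ≠ i → Z T par κ J b (fun _ => true) i g := by
        intro g hg hgi; obtain ⟨f, hf, hfn⟩ := third {i, j, g} Finset.card_le_three; simp only [mem_insert, mem_singleton, not_or] at hfn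
        by_cases hgj : g = j
        · subst hgj; exact toZ _ i g f hi hg hf hij hfn.1 hfn.2.1 x hx hE (hone f hf hfn.1 hfn.2.1)
        · have t := E_third Λ j i g (KK κ x); obtain ⟨u, hu⟩ := KK_fl (H.two g (hJ hg)) x; obtain ⟨u', hu'⟩ := KK_fl (H.two j (hJ hj)) x
          have e0 : E Λ j i (fl g (KK κ x)) = false := by
            rw [E_symm, ← hu]; apply hd g hg hgi hgj _ (hx.upd hg _); have := congrFun hu g; simp only [KK, fl, update_self] at this; rw [update_self, this, hone g hg hgi hgj]; rfl
          rw [E_symm Λ j i, hE, e0] at t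
          by_cases hc1 : E Λ i g (KK κ x) = true
          · exact toZ _ i g f hi hg hf (Ne.symm hgi) hfn.1 hfn.2.2 x hx hc1 (hone f hf hfn.1 hfn.2.1)
          · have hc2 : E Λ i g (KK κ (update x j u')) = true := by
              rw [hu']; simp only [Bool.not_eq_true] at hc1; rw [hc1] at t
              simpa using t.symm
            exact toZ _ i g f hi hg hf (Ne.symm hgi) hfn.1 hfn.2.2 _ (hx.upd hj _) hc2 (by
              rw [update_of_ne hfn.2.1]; exact hone f hf hfn.1 hfn.2.1)
      apply Z.fin H hJ b (fun _ => true)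
      intro X hX hne hXJ
      by_cases hiX : i ∈ X
      · have : ∃ g ∈ J, g ∉ X := by
          by_contra hh; push Not at hh; exact hXJ (Finset.Subset.antisymm hX hh)
        obtain ⟨g, hg, hgX⟩ := this
        exact ⟨i, hiX, g, Finset.mem_sdiff.2 ⟨hg, hgX⟩, star g hg (fun e => hgX (e ▸ hiX))⟩
      · obtain ⟨g, hg⟩ := hne
        exact ⟨g, hg, i, Finset.mem_sdiff.2 ⟨hi, hiX⟩, (star g (hX hg) (fun e => hiX (e ▸ hg))).symm⟩
    · push Not at hB
      apply Z.fin H hJ b (fun _ => false)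
      intro X hX hne hXJ; obtain ⟨i, hi, j, hj, hij, hiJ, hjJ, x, hx, hE⟩ := edge X hX hne hXJ; obtain ⟨f, hf, hfi, hfj, x', hx', hk, hE'⟩ := hB i hiJ j hjJ hij ⟨x, hx, hE⟩
      exact ⟨i, hi, j, hj, toZ _ i j f hiJ hjJ hf hij hfi hfj x' hx' (by simpa using hE') hk⟩
end T0
theorem chi_mate_ne : ∀ s q v, s ≠ q → chi q (mate s v) = !chi q v := by decide
section
variable {A : Sn} {h : Pf} {s q : Td}
def kap (s : Td) (h : Pf) (i : ℕ) (v : Qd) : Bool := cc s h (update (fun _ => 0) i v)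
theorem SL.par (hq : Q A h) (hSL : ∀ i ∈ A, ∀ j ∈ A, i ≠ j → SepC (cc s h) i j) (x : P) {i : ℕ} (hi : i ∈ A) (v : Qd) : cc s h (update x i v) = (cc s h x ^^ (kap s h i (x i) ^^ kap s h i v)) := by
  have := sep_split (X := {i}) (hq.bal s).dep (by
    intro a ha b hb; simp only [mem_sdiff, mem_singleton] at ha hb; subst ha
    exact hSL a hi b hb.1 (fun e => hb.2 e.symm)) x (update x i v) x (fun _ => 0)
  have e : ∀ y z : P, ({i} : Sn).piecewise y z = update z i (y i) := by
    intro y z; funext k; by_cases hk : k = i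
    · subst hk; simp
    · simp [hk]
  simp only [e, update_self, update_eq_self] at this; unfold kap; revert this; generalize cc s h x = a; generalize cc s h (update x i v) = b
  generalize cc s h (update (fun _ => 0) i (x i)) = c
  generalize cc s h (update (fun _ => 0) i v) = d
  cases a <;> cases b <;> cases c <;> cases d <;> decide
theorem toggle (hq : Q A h) (hsq : s ≠ q) (x : P) {i : ℕ} (hi : i ∈ A) (v : Qd) (hv : v ≠ x i) (hc : cc s h (update x i v) = cc s h x) : cc q h (update x i v) = !cc q h x := by
  unfold cc at *; rcases chi_eq _ _ _ hc with e | e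
  · exact absurd (hq.eq' x hi e) hv
  · rw [e, chi_mate_ne _ _ _ hsq]
theorem T0_SL (hq : Q A h) (hsq : s ≠ q) (hSL : ∀ i ∈ A, ∀ j ∈ A, i ≠ j → SepC (cc s h) i j) (hc : ConnC (cc q h) A) (h2 : 2 ≤ A.card) {T : P → Prop} (hT : MDS A T) (hyp : ∀ i ∈ A, ∀ j ∈ A, i ≠ j → ∀ x u v, odd (cc q h) x i u j v = true → Unm T (cc s h) {i, j} x) : ∀ x y, T x → T y → cc s h x = cc s h y := by
  classical
  set κ := kap s h with hκ
  set c := cc q h with hcdef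
  have hpar := fun x i hi v => SL.par (s := s) hq hSL x (i := i) hi v
  have two : ∀ i ∈ A, Two (κ i) := fun i hi => (hq.bal s).two _ i hi
  have hd : Dep A c := (hq.bal q).dep; have H : Ctx A κ T (cc s h) := ⟨hT, two, hpar⟩
  have tog : ∀ x, ∀ i ∈ A, ∀ v, v ≠ x i → κ i v = κ i (x i) → c (update x i v) = !c x := by
    intro x i hi v hv hk; apply toggle hq hsq x hi v hv; rw [hpar x i hi v, ← hκ, hk]; simp
  have cO : ∀ x i j, i ∈ A → j ∈ A → i ≠ j → ∀ u v, κ i u = κ i (x i) → odd c x i u j v = false := by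
    intro x i j hi hj hij u v hk; unfold odd
    by_cases hu : u = x i
    · subst hu; simp
    · rw [tog x i hi u hu hk, update_comm hij, tog (update x j v) i hi u (by rw [update_of_ne hij]; exact hu)
        (by rw [update_of_ne hij]; exact hk)]
      cases c x <;> cases c (update x j v) <;> rfl
  have oU : ∀ x i j, i ∈ A → j ∈ A → i ≠ j → ∀ u u' v, κ i u = κ i u' → odd c x i u j v = odd c x i u' j v := by
    intro x i j hi hj hij u u' v hk
    have := cO (update x i u) i j hi hj hij u' v (by simp [hk])
    unfold odd at this ⊢; rw [update_idem] at this; revert this; generalize c x = a; generalize c (update x i u) = a1; generalize c (update x i u') = a2; generalize c (update x j v) = a3; generalize c (update (update x i u) j v) = a4; generalize c (update (update x i u') j v) = a5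
    cases a <;> cases a1 <;> cases a2 <;> cases a3 <;> cases a4 <;> cases a5 <;> decide
  have oX : ∀ x i j, i ∈ A → j ∈ A → i ≠ j → ∀ a u v, κ i a = κ i (x i) → odd c (update x i a) i u j v = odd c x i u j v := by
    intro x i j hi hj hij u u' v hk; have := cO x i j hi hj hij u v hk; unfold odd at this ⊢; rw [update_idem]; revert this; generalize c x = a; generalize c (update x i u) = a1; generalize c (update x i u') = a2; generalize c (update x j v) = a3; generalize c (update (update x i u) j v) = a4; generalize c (update (update x i u') j v) = a5
    cases a <;> cases a1 <;> cases a2 <;> cases a3 <;> cases a4 <;> cases a5 <;> decide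
  have inv1 : ∀ x i j k, k ∈ A → k ≠ i → k ≠ j → ∀ u v w, κ k w = κ k (x k) →
      odd c (update x k w) i u j v = odd c x i u j v := by
    intro x i j k hk hki hkj u v w hw
    by_cases hwk : w = x k
    · subst hwk; simp
    · have t : ∀ z, z k = x k → c (update z k w) = !c z := by
        intro z hz; exact tog z k hk w (by rw [hz]; exact hwk) (by rw [hz]; exact hw)
      unfold odd
      rw [update_comm hki, update_comm hkj, update_comm hkj, t x rfl, t _ (by simp [hki]), t _ (by simp [hkj]),
        t _ (by simp [hki, hkj])]
      cases c x <;> cases c (update x i u) <;> cases c (update x j v) <;> cases c (update (update x i u) j v) <;> rfl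
  have inv : ∀ x y i j, x i = y i → x j = y j → (∀ k ∈ A, κ k (x k) = κ k (y k)) → ∀ u v,
      odd c x i u j v = odd c y i u j v := by
    intro x y i j hxi hxj hk u v
    set z : P := A.piecewise y x with hz
    have e1 : odd c z i u j v = odd c y i u j v := odd_dep hd _ _ (fun k hk => by simp [hz, hk]) _ _ _ _
    rw [← e1]
    have : ∀ S : Sn, S ⊆ A → odd c (S.piecewise y x) i u j v = odd c x i u j v := by
      intro S
      induction S using Finset.induction_on with
      | empty => intro _; simp
      | insert a S haS ihS =>
        intro hS; rw [Finset.piecewise_insert]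
        rw [← ihS (fun k hk => hS (Finset.mem_insert_of_mem hk))]
        have haA : a ∈ A := hS (Finset.mem_insert_self _ _)
        have e : (S.piecewise y x) a = x a := by simp [haS]
        by_cases hai : a = i
        · subst hai; rw [← hxi, ← e]; simp
        by_cases haj : a = j
        · subst haj; rw [← hxj, ← e]; simp
        exact inv1 _ i j a haA hai haj u v (y a) (by rw [e, hk a haA])
    exact (this A (le_refl _)).symm
  have hr : ∀ i b, ∃ v, i ∈ A → κ i v = b := by
    intro i b
    by_cases hi : i ∈ A
    · obtain ⟨v, _, _, hv, _⟩ := two_pair _ (two i hi) b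
      exact ⟨v, fun _ => hv⟩
    · exact ⟨0, fun h => absurd h hi⟩
  choose r hr using hr
  set Λ : (ℕ → Bool) → Bool := fun k => c (fun i => r i (k i)) with hΛ
  have hfl : ∀ i k, (fun l => r l (fl i k l)) = update (fun l => r l (k l)) i (r i (!k i)) := by
    intro i k; funext l; by_cases hl : l = i
    · subst hl; simp [fl]
    · simp [fl, hl]
  have hE : ∀ i j, i ≠ j → ∀ k, E Λ i j k = odd c (fun l => r l (k l)) i (r i (!k i)) j (r j (!k j)) := by
    intro i j hij k; unfold E odd; simp only [hΛ, hfl]; rw [update_comm hij]; simp [fl, hij]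
  have main := St (Λ := Λ) H ?_ A (le_refl _) h2
  · intro x y hx hy
    have := main x ?_ x (A.piecewise y x) Ag.rfl' (fun k hk => by simp [hk]) hx
      ((hT.dep _ _ (fun k hk => by simp [hk])).mpr hy)
    · rw [this]; exact (hq.bal s).dep _ _ (fun k hk => by simp [hk])
    · intro X hX hne hXA; obtain ⟨i, hi, j, hj, hn⟩ := hc X hX hne hXA; have hjA := (Finset.mem_sdiff.1 hj).1; have hiA := hX hi
      have hij : i ≠ j := by rintro rfl; exact (Finset.mem_sdiff.1 hj).2 hi
      unfold SepC at hn
      push Not at hn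
      obtain ⟨w, u, v, ho⟩ := hn
      refine ⟨i, hi, j, hj, A.piecewise w x, fun k hk => by simp [hk], ?_⟩
      rw [← odd_dep hd (A.piecewise w x) w (fun k hk => by simp [hk])] at ho
      set w' : P := A.piecewise w x with hw'
      rw [hE i j hij]
      have hu : κ i u ≠ κ i (w' i) := fun e => ho (cO w' i j hiA hjA hij u v e)
      have hv : κ j v ≠ κ j (w' j) := fun e => ho (by
        rw [odd_comm c _ hij]; exact cO w' j i hjA hiA hij.symm v u e)
      set rx : P := fun l => r l (KK κ w' l) with hrx
      have hrk : ∀ l ∈ A, κ l (rx l) = κ l (w' l) := fun l hl => hr l _ hl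
      have n : ∀ a b : Bool, a ≠ b → a = !b := by decide
      rw [oU rx i j hiA hjA hij _ u _ (by rw [hr i _ hiA]; exact (n _ _ hu).symm),
        odd_comm c _ hij, oU rx j i hjA hiA hij.symm _ v _ (by rw [hr j _ hjA]; exact (n _ _ hv).symm),
        ← oX rx j i hjA hiA hij.symm (w' j) v u (hrk j hjA).symm, odd_comm c _ hij.symm,
        ← oX _ i j hiA hjA hij (w' i) u v (by rw [update_of_ne hij]; exact (hrk i hiA).symm)]
      rw [← inv w' _ i j (by simp) (by simp [hij.symm])]
      · simpa using ho
      · intro k hk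
        by_cases hki : k = i
        · subst hki; simp
        · by_cases hkj : k = j
          · subst hkj; simp [hki]
          · simp only [ne_eq, hki, not_false_eq_true, update_of_ne, hkj]; exact (hrk k hk).symm
  · intro i hi j hj hij x hEx; rw [hE i j hij] at hEx
    set rx : P := fun l => r l (KK κ x l) with hrx
    rw [inv rx (update (update x i (rx i)) j (rx j)) i j (by simp [hij]) (by simp)] at hEx
    · refine (hyp i hi j hj hij _ _ _ hEx).base ?_; intro k hk; simp at hk; simp [hk]
    · intro k hk
      by_cases hkj : k = j
      · subst hkj; simp
      · by_cases hki : k = i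
        · subst hki; simp [hkj]
        · simp only [ne_eq, hki, not_false_eq_true, update_of_ne, hkj]; exact hr k _ hk
end
def Top (s : Td) (h : Pf) (A : Sn) : Prop :=
  ¬ ConnC (cc s h) A ∧ ∀ p, p ≠ s → ConnC (cc p h) A
def PlSep (p : Td) (h : Pf) (i j : ℕ) (x : P) : Prop :=
  ∀ y, Ag {i, j} x y → ∀ u v, odd (cc p h) y i u j v = false
def scol (s : Td) (h : Pf) (i j : ℕ) (x : P) : Prop :=
  PlSep s h i j x ∧ ∃ p, ¬ PlSep p h i j x
theorem MDS.frz {A X : Sn} {T : P → Prop} (h : MDS A T) (hX : X ⊆ A) (w : P) : MDS X (fun x => T (X.piecewise x w)) where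
  dep := fun x y hxy => by
    apply h.dep; intro k _
    by_cases hk : k ∈ X
    · simp [hk, hxy k hk]
    · simp [hk]
  ex := fun x i hi => by
    obtain ⟨v, hv⟩ := h.ex (X.piecewise x w) i (hX hi)
    exact ⟨v, by rw [pw_upd_in hi]; exact hv⟩
  un := fun x i hi u v hu hv => by
    rw [pw_upd_in hi] at hu hv; exact h.un _ i (hX hi) u v hu hv
theorem pw_self {X : Sn} (w : P) : X.piecewise w w = w := by
  funext k; by_cases hk : k ∈ X <;> simp [hk]
theorem pw_ag {X : Sn} {x w : P} (h : Ag X w x) : X.piecewise x w = x := by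
  funext k; by_cases hk : k ∈ X
  · simp [hk]
  · simp [hk, h k hk]
theorem odd_frz {X : Sn} {i j : ℕ} (hi : i ∈ X) (hj : j ∈ X) (p : Td) (h : Pf) (w y : P) (u v : Qd) : odd (cc p (fun x => h (X.piecewise x w))) y i u j v = odd (cc p h) (X.piecewise y w) i u j v := by
  unfold odd cc; simp only [pw_upd_in hi, pw_upd_in hj]
theorem SepC.frz {X : Sn} {i j : ℕ} (hi : i ∈ X) (hj : j ∈ X) {p : Td} {h : Pf} (w : P) (hs : SepC (cc p h) i j) : SepC (cc p (fun x => h (X.piecewise x w))) i j := by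
  intro x u v; rw [odd_frz hi hj]; exact hs _ _ _
theorem pl_frz {X : Sn} {i j : ℕ} (hi : i ∈ X) (hj : j ∈ X) {p : Td} {h : Pf} (w x : P) : PlSep p (fun x => h (X.piecewise x w)) i j x ↔ PlSep p h i j (X.piecewise x w) := by
  constructor
  · intro hp y hy u v
    have e : X.piecewise (({i, j} : Sn).piecewise y x) w = y := by
      funext k
      by_cases hk : k ∈ ({i, j} : Sn)
      · have : k ∈ X := by simp at hk; rcases hk with rfl | rfl <;> assumption
        simp only [this, piecewise_eq_of_mem]; rw [piecewise_eq_of_mem _ _ _ hk]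
      · rw [← hy k hk]
        by_cases hkX : k ∈ X
        · simp only [hkX, piecewise_eq_of_mem]; rw [piecewise_eq_of_notMem _ _ _ hk]
        · simp [hkX]
    have := hp (({i, j} : Sn).piecewise y x) (fun k hk => by rw [piecewise_eq_of_notMem _ _ _ hk]) u v
    rw [odd_frz hi hj, e] at this; exact this
  · intro hp y hy u v; rw [odd_frz hi hj]; apply hp; intro k hk
    by_cases hkX : k ∈ X
    · simp [hkX, hy k hk]
    · simp [hkX]
theorem scol_frz {X : Sn} {i j : ℕ} (hi : i ∈ X) (hj : j ∈ X) {p : Td} {h : Pf} (w x : P) : scol p (fun x => h (X.piecewise x w)) i j x ↔ scol p h i j (X.piecewise x w) := by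
  unfold scol; simp only [pl_frz hi hj]
theorem ex_ne : ∀ s : Td, ∃ q, s ≠ q := by decide
theorem T0gen (s : Td) : ∀ n, ∀ (A : Sn) (h : Pf) (T : P → Prop), A.card = n → Q A h → Top s h A → MDS A T → (∀ i ∈ A, ∀ j ∈ A, i ≠ j → ∀ x, scol s h i j x → Unm T (cc s h) {i, j} x) → ∀ x y, T x → T y → cc s h x = cc s h y := by
  classical
  intro n
  induction n using Nat.strong_induction_on with
  | _ n ih =>
  intro A h T hn hq htop hT hyp
  have h2 : 2 ≤ A.card := by
    by_contra hlt; apply htop.1; intro X hX hne hXA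
    exfalso
    have := card_lt_card (Finset.ssubset_iff_subset_ne.2 ⟨hX, hXA⟩); have := Finset.card_pos.2 hne; omega
  obtain ⟨q, hqs⟩ : ∃ q : Td, s ≠ q := ex_ne s
  by_cases hSL : ∀ i ∈ A, ∀ j ∈ A, i ≠ j → SepC (cc s h) i j
  · refine T0_SL hq hqs hSL (htop.2 q hqs.symm) h2 hT ?_; intro i hi j hj hij x u v ho
    refine hyp i hi j hj hij x ⟨fun y _ => hSL i hi j hj hij y, q, fun hp => ?_⟩
    rw [hp x Ag.rfl'] at ho
    exact absurd ho (by decide)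
  push Not at hSL
  obtain ⟨i, hi, i', hi', hii, hns⟩ := hSL
  obtain ⟨X, hXA, hiX, hcl, hcon⟩ := exists_comp A (fun a b => ¬ SepC (cc s h) a b) hi
    (fun a b hab hba => hab hba.symm)
  have hi'X : i' ∈ X := by
    by_contra hh; exact hcl i hiX i' (Finset.mem_sdiff.2 ⟨hi', hh⟩) hns
  have hXne : X ≠ A := by
    intro e; apply htop.1; rw [← e]; exact hcon
  have hsep : ∀ a ∈ X, ∀ b ∈ A \ X, SepC (cc s h) a b := fun a ha b hb => not_not.1 (hcl a ha b hb)
  have hred : Red X h := D2 hq hXA s hsep hcon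
  obtain ⟨j, hj⟩ : (A \ X).Nonempty := by
    rw [Finset.sdiff_nonempty]; intro e; exact hXne (Finset.Subset.antisymm hXA e)
  have hjA := (Finset.mem_sdiff.1 hj).1; have hjX := (Finset.mem_sdiff.1 hj).2
  have sl : ∀ a ∈ X, ∀ w, Unm T (cc s h) (A \ X.erase a) w := by
    intro a ha w
    set A' := A \ X.erase a with hA'
    have haA' : a ∈ A' := by simp [hA', hXA ha]
    have hjA' : j ∈ A' := by simp [hA', hjA, hjX]
    have hcard : A'.card < n := by
      rw [← hn]; apply card_lt_card
      refine Finset.ssubset_iff_subset_ne.2 ⟨sdiff_subset, fun e => ?_⟩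
      have : ∃ b ∈ X, b ≠ a := by
        by_cases hia : i = a
        · exact ⟨i', hi'X, fun e => hii (hia.trans e.symm)⟩
        · exact ⟨i, hiX, hia⟩
      obtain ⟨b, hb, hba⟩ := this
      have : b ∈ A' := by rw [e]; exact hXA hb
      simp [hA', hb, hba] at this
    have hsub : A' ⊆ A := sdiff_subset
    have hmem : ∀ k ∈ A', k ≠ a → k ∈ A \ X := by
      intro k hk hka; simp only [hA', mem_sdiff, mem_erase, not_and] at hk ⊢; exact ⟨hk.1, hk.2 hka⟩
    have := ih A'.card hcard A' (fun x => h (A'.piecewise x w)) (fun x => T (A'.piecewise x w)) rfl (hq.frz hsub w)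
      ⟨?_, fun p hp => RC hq hXA ha hred w p (htop.2 p hp)⟩ (hT.frz hsub w) ?_
    · intro y y' hy hy' hTy hTy'
      have := this y y' (by rw [pw_ag hy]; exact hTy) (by rw [pw_ag hy']; exact hTy')
      unfold cc at this ⊢
      beta_reduce at this
      rwa [pw_ag hy, pw_ag hy'] at this
    · intro hcn
      obtain ⟨b, hb, d, hd, hn⟩ := hcn {a} (by simpa using haA') (by simp) (by
        intro e; rw [← e] at hjA'; simp at hjA'; exact hjX (hjA' ▸ ha))
      rw [mem_singleton] at hb; subst hb; rw [mem_sdiff, mem_singleton] at hd; exact hn ((hsep b ha d (hmem d hd.1 hd.2)).frz haA' hd.1 w)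
    · intro k hk l hl hkl x hsc; rw [scol_frz hk hl] at hsc; have hu := hyp k (hsub hk) l (hsub hl) hkl _ hsc; intro y y' hy hy' hTy hTy'; refine hu _ _ ?_ ?_ hTy hTy'
      · intro m hm
        by_cases hmA : m ∈ A'
        · simp [hmA, hy m hm]
        · simp [hmA]
      · intro m hm
        by_cases hmA : m ∈ A'
        · simp [hmA, hy' m hm]
        · simp [hmA]
  intro x y hx hy
  have step : ∀ S : Sn, S ⊆ X → ∃ x', T x' ∧ cc s h x' = cc s h x ∧ ∀ k ∈ S, x' k = y k := by
    intro S
    induction S using Finset.induction_on with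
    | empty => intro _; exact ⟨x, hx, rfl, by simp⟩
    | insert a S haS ihS =>
      intro hS
      obtain ⟨x', h1, h2, h3⟩ := ihS (fun k hk => hS (Finset.mem_insert_of_mem hk))
      have haX : a ∈ X := hS (Finset.mem_insert_self _ _); obtain ⟨v, hv⟩ := hT.ex (update x' a (y a)) j hjA
      have haA' : a ∈ A \ X.erase a := by simp [hXA haX]
      have hjA' : j ∈ A \ X.erase a := by simp [hjA, hjX]
      have := sl a haX x' x' _ Ag.rfl' ((Ag.rfl'.upd haA' (y a)).upd hjA' v) h1 hv; refine ⟨_, hv, this.symm.trans h2, ?_⟩; intro k hk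
      have hkj : k ≠ j := fun e => hjX (e ▸ hS hk)
      rw [update_of_ne hkj]
      by_cases hka : k = a
      · subst hka; simp
      · rw [update_of_ne hka]; exact h3 k ((Finset.mem_insert.1 hk).resolve_left hka)
  obtain ⟨x', h1, h2, h3⟩ := step X (le_refl _); rw [← h2]
  have e : ∀ k ∈ A, A.piecewise y x' k = y k := fun k hk => by simp [hk]
  have := sl i hiX x' x' (A.piecewise y x') Ag.rfl' (by
    intro k hk
    by_cases hkA : k ∈ A
    · have : k ∈ X := by
        by_contra hh; apply hk; simp [hkA, hh]
      simp [hkA, h3 k this]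
    · simp [hkA]) h1 ((hT.dep _ _ e).mpr hy)
  rw [this]; exact (hq.bal s).dep _ _ e
abbrev Sq := Qd → Qd → Qd
structure LS (L : Sq) : Prop where
  r : ∀ a, Injective (L a)
  c : ∀ b, Injective (fun a => L a b)
def Sp (p : Td) (L : Sq) : Prop :=
  ∀ a a' b b', ((chi p (L a b) ^^ chi p (L a' b)) ^^ (chi p (L a b') ^^ chi p (L a' b'))) = false
instance (p : Td) (L : Sq) : Decidable (Sp p L) := by unfold Sp; infer_instance
def rg : List ℕ := [0, 1, 2, 3]
def vl (n i : ℕ) : ℕ := Nat.mod (Nat.div n (Nat.pow 4 i)) 4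
def vq (n a b : ℕ) : ℕ := Nat.mod (Nat.div n (Nat.pow 4 (Nat.add (Nat.mul 4 a) b))) 4
def rowc (r : Qd → Qd) : ℕ := r 0 + 4 * r 1 + 16 * r 2 + 64 * r 3
def codeS (L : Sq) : ℕ := rowc (L 0) + 256 * rowc (L 1) + 65536 * rowc (L 2) + 16777216 * rowc (L 3)
def permc : List ℕ := [228, 180, 216, 120, 156, 108, 225, 177, 201, 57, 141, 45, 210, 114, 198, 54, 78, 30, 147, 99, 135, 39, 75, 27]
def djN (r r' : ℕ) : Bool := rg.all fun i => !(Nat.beq (vl r i) (vl r' i))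
def chiN (p v : ℕ) : ℕ := match p with
  | 0 => Nat.div v 2
  | 1 => Nat.mod v 2
  | _ => Nat.mod (Nat.add (Nat.div v 2) (Nat.mod v 2)) 2
theorem rg_all {g : ℕ → Bool} : rg.all g = true ↔ ∀ i : Qd, g i = true := by
  rw [List.all_eq_true, Fin.forall_fin_succ, Fin.forall_fin_succ, Fin.forall_fin_succ, Fin.forall_fin_succ]; simp [rg]
theorem rg_any {g : ℕ → Bool} : rg.any g = true ↔ ∃ i : Qd, g i = true := by
  rw [List.any_eq_true, Fin.exists_fin_succ, Fin.exists_fin_succ, Fin.exists_fin_succ, Fin.exists_fin_succ]; simp [rg]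
theorem vl_row (r : Qd → Qd) (i : Qd) : vl (rowc r) i = r i := by
  show (rowc r) / 4 ^ i.val % 4 = _
  unfold rowc
  fin_cases i <;> simp <;> omega
theorem rowc_lt (r : Qd → Qd) : rowc r < 256 := by unfold rowc; omega
theorem vq_eq (L : Sq) (a b : Qd) : vq (codeS L) a b = L a b := by
  rw [← vl_row]
  show (codeS L) / 4 ^ (4 * a.val + b.val) % 4 = rowc (L a) / 4 ^ b.val % 4
  unfold codeS; have h0 := rowc_lt (L 0); have h1 := rowc_lt (L 1); have h2 := rowc_lt (L 2); have h3 := rowc_lt (L 3); rw [pow_add, pow_mul, ← Nat.div_div_eq_div_mul]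
  fin_cases a <;> fin_cases b <;> simp <;> omega
theorem chiN_eq (p : Td) (v : Qd) : chiN p v = (chi p v).toNat := by revert p v; decide
theorem beq_val {a b : Qd} : Nat.beq a b = true ↔ a = b := by
  rw [Nat.beq_eq, Fin.val_inj]
theorem mem_permc {r : Qd → Qd} (h : Injective r) : permc.elem (rowc r) = true := by
  have key : (rg.all fun a => rg.all fun b => Nat.beq a b || rg.all fun c => Nat.beq a c || Nat.beq b c ||
    rg.all fun d => Nat.beq a d || Nat.beq b d || Nat.beq c d || permc.any fun n => Nat.beq n (a + 4 * b + 16 * c + 64 * d)) = true := by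
    decide +kernel
  simp only [rg_all, Bool.or_eq_true, beq_val] at key; have := ((((key (r 0) (r 1)).resolve_left ?_) (r 2)).resolve_left ?_ (r 3)).resolve_left ?_
  · rw [List.any_eq_true] at this; obtain ⟨n, hn, e⟩ := this; rw [Nat.beq_eq] at e; rw [List.elem_eq_true_of_mem]; unfold rowc
    rwa [← e]
  all_goals (try rintro ((e | e) | e)) <;> (try rintro (e | e)) <;> (try intro e) <;> exact absurd (h e) (by decide)
def srS (D : ℕ → ℕ → Bool) (chk : ℕ → Bool) : Bool :=
  permc.all fun r0 => !(D 0 r0) || permc.all fun r1 => !(D 1 r1 && djN r0 r1) ||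
    permc.all fun r2 => !(D 2 r2 && djN r0 r2 && djN r1 r2) ||
    permc.all fun r3 => !(D 3 r3 && djN r0 r3 && djN r1 r3 && djN r2 r3) ||
      chk (Nat.add (Nat.add r0 (Nat.mul 256 r1)) (Nat.add (Nat.mul 65536 r2) (Nat.mul 16777216 r3)))
theorem LS.all {L : Sq} (h : LS L) (D : ℕ → ℕ → Bool) (chk : ℕ → Bool) (hD : ∀ i : Qd, D i (rowc (L i)) = true) (H : srS D chk = true) : chk (codeS L) = true := by
  have d : ∀ i j : Qd, i ≠ j → djN (rowc (L i)) (rowc (L j)) = true := by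
    intro i j hij; unfold djN; rw [rg_all]; intro b; rw [vl_row, vl_row, Bool.not_eq_true', ← Bool.not_eq_true, beq_val]; intro e; exact hij (h.c b e)
  have m : ∀ i, rowc (L i) ∈ permc := fun i => List.mem_of_elem_eq_true (mem_permc (h.r i))
  unfold srS at H; simp only [List.all_eq_true, Bool.or_eq_true, Bool.not_eq_true', ← Bool.not_eq_true, Bool.and_eq_true] at H
  have := (((H _ (m 0)).resolve_left (not_not.2 (hD 0)) _ (m 1)).resolve_left (not_not.2 ⟨hD 1, d 0 1 (by decide)⟩) _ (m 2)).resolve_left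
    (not_not.2 ⟨⟨hD 2, d 0 2 (by decide)⟩, d 1 2 (by decide)⟩) _ (m 3)
  have := this.resolve_left (not_not.2 ⟨⟨⟨hD 3, d 0 3 (by decide)⟩, d 1 3 (by decide)⟩, d 2 3 (by decide)⟩)
  convert this using 2
  show _ = (_ + 256 * _) + (65536 * _ + 16777216 * _)
  unfold codeS; omega
def spN (p N : ℕ) : Bool := rg.all fun a => rg.all fun a' => rg.all fun b => rg.all fun b' =>
  Nat.beq (Nat.mod (Nat.add (Nat.add (chiN p (vq N a b)) (chiN p (vq N a' b))) (Nat.add (chiN p (vq N a b')) (chiN p (vq N a' b')))) 2) 0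
theorem spN_iff {p : Td} {L : Sq} : spN p (codeS L) = true ↔ Sp p L := by
  unfold spN Sp; simp only [rg_all, vq_eq, chiN_eq, Nat.beq_eq]
  refine forall_congr' fun a => forall_congr' fun a' => forall_congr' fun b => forall_congr' fun b' => ?_
  generalize chi p (L a b) = t1; generalize chi p (L a b') = t2; generalize chi p (L a' b) = t3; generalize chi p (L a' b') = t4; revert t1 t2 t3 t4; decide
def enc : Qd → Qd := ![0, 2, 1, 3]
def h0 : Sq := fun a b => enc (a + b)
def h1 : Sq := fun a b => a + b
theorem LS.nrm {L : Sq} (h : LS L) (e : Qd → Qd) (he : Injective e) : ∃ σ τ : Qd → Qd, Injective σ ∧ Injective τ ∧ (∀ a, L (σ a) (τ 0) = e a) ∧ (∀ b, L (σ 0) (τ b) = e b) := by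
  have s1 : ∀ v, ∃ a, L a 0 = v := fun v => (Finite.injective_iff_surjective.1 (h.c 0)) v
  choose c hc using s1
  have s2 : ∀ v, ∃ b, L (c (e 0)) b = v := fun v => (Finite.injective_iff_surjective.1 (h.r (c (e 0)))) v
  choose d hd using s2
  have h00 : d (e 0) = 0 := h.r (c (e 0)) (by rw [hd, hc])
  refine ⟨c ∘ e, d ∘ e, ?_, ?_, ?_, ?_⟩
  · intro x y hxy; apply he; rw [← hc (e x), ← hc (e y)]; simp only [comp] at hxy; rw [hxy]
  · intro x y hxy; apply he; rw [← hd (e x), ← hd (e y)]; simp only [comp] at hxy; rw [hxy]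
  · intro a; simp only [comp]; rw [h00, hc]
  · intro b; simp only [comp]; rw [hd]
theorem LS.comp {L : Sq} (h : LS L) {σ τ π : Qd → Qd} (hs : Injective σ) (ht : Injective τ) (hp : Injective π) : LS (fun a b => π (L (σ a) (τ b))) where
  r := fun a x y e => ht (h.r _ (hp e))
  c := fun b x y e => hs (h.c _ (hp e))
theorem Sp.of_comp {L : Sq} {p : Td} {σ τ : Qd → Qd} (hs : Injective σ) (ht : Injective τ) (h : Sp p (fun a b => L (σ a) (τ b))) : Sp p L := by
  intro a a' b b'; obtain ⟨a, rfl⟩ := Finite.injective_iff_surjective.1 hs a; obtain ⟨a', rfl⟩ := Finite.injective_iff_surjective.1 hs a'; obtain ⟨b, rfl⟩ := Finite.injective_iff_surjective.1 ht b; obtain ⟨b', rfl⟩ := Finite.injective_iff_surjective.1 ht b'; exact h a a' b b'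
def redD (c : ℕ) (i r : ℕ) : Bool :=
  match i with
  | 0 => Nat.beq r c
  | i + 1 => Nat.beq (vl r 0) (vl c (i + 1))
theorem redD_ok {L : Sq} {e : Qd → Qd} (h1 : ∀ a, L a 0 = e a) (h2 : ∀ b, L 0 b = e b) (i : Qd) : redD (rowc e) i (rowc (L i)) = true := by
  have h3 : L 0 = e := funext h2
  have : ∀ i : Qd, Nat.beq (vl (rowc (L i)) 0) (vl (rowc e) i) = true := by
    intro i; have := vl_row (L i) 0; rw [Fin.val_zero] at this; rw [this, vl_row, beq_val, h1]
  rcases i with ⟨i, hi⟩; rcases i with _ | i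
  · unfold redD; rw [Nat.beq_eq]; exact congrArg rowc h3
  · exact this _
theorem L2 {L : Sq} (h : LS L) : ∃ p, Sp p L := by
  obtain ⟨σ, τ, hs, ht, e1, e2⟩ := h.nrm id injective_id
  have := (h.comp hs ht injective_id).all (redD (rowc id)) (fun N => spN 0 N || spN 1 N || spN 2 N)
    (redD_ok e1 e2) (by decide +kernel)
  simp only [Bool.or_eq_true] at this; rcases this with (h | h) | h
  · exact ⟨0, Sp.of_comp hs ht ((spN_iff (p := 0)).1 h)⟩
  · exact ⟨1, Sp.of_comp hs ht ((spN_iff (p := 1)).1 h)⟩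
  · exact ⟨2, Sp.of_comp hs ht ((spN_iff (p := 2)).1 h)⟩
theorem Sp.third {L : Sq} {p q : Td} (hpq : p ≠ q) (h : Sp p L) (h' : Sp q L) (r : Td) : Sp r L := by
  by_cases hr : p = r
  · exact hr ▸ h
  by_cases hr' : q = r
  · exact hr' ▸ h'
  intro a a' b b'; have g1 := h a a' b b'; have g2 := h' a a' b b'; rw [chi_third p q r _ hpq hr hr', chi_third p q r _ hpq hr hr', chi_third p q r _ hpq hr hr', chi_third p q r _ hpq hr hr']; revert g1 g2; generalize chi p (L a b) = t1; generalize chi p (L a b') = t2; generalize chi p (L a' b) = t3; generalize chi p (L a' b') = t4; generalize chi q (L a b) = t5; generalize chi q (L a b') = t6; generalize chi q (L a' b) = t7; generalize chi q (L a' b') = t8; revert t1 t2 t3 t4 t5 t6 t7 t8; decide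
def ppi (s s' : Td) (v : Qd) : Qd :=
  match chi s v, chi s' v with
  | false, false => 0
  | false, true => 1
  | true, false => 2
  | true, true => 3
theorem ppi_inj : ∀ s s', s ≠ s' → Injective (ppi s s') := by unfold Injective; decide
theorem ppi0 : ∀ s s' v, chi 0 (ppi s s' v) = chi s v := by decide
theorem ppi1 : ∀ s s' v, chi 1 (ppi s s' v) = chi s' v := by decide
theorem col0 {L : Sq} (h : LS L) (hs : Sp 0 L) (hn : ¬ Sp 1 L) : ∃ σ τ : Qd → Qd, Injective σ ∧ Injective τ ∧ ∀ a b, L (σ a) (τ b) = h0 a b := by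
  obtain ⟨σ, τ, hσ, hτ, e1, e2⟩ := h.nrm enc (by unfold Injective; decide)
  have hs' : Sp 0 (fun a b => L (σ a) (τ b)) := fun a a' b b' => hs _ _ _ _
  have hn' : ¬ Sp 1 (fun a b => L (σ a) (τ b)) := fun h => hn (h.of_comp hσ hτ)
  refine ⟨σ, τ, hσ, hτ, ?_⟩
  have := (h.comp hσ hτ injective_id).all (redD (rowc enc)) (fun N => !(spN 0 N) || spN 1 N || Nat.beq N (codeS h0))
    (redD_ok e1 e2) (by decide +kernel)
  simp only [Bool.or_eq_true, Bool.not_eq_true', ← Bool.not_eq_true] at this; rcases this with (h | h) | h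
  · exact absurd ((spN_iff (p := 0)).2 hs') h
  · exact absurd ((spN_iff (p := 1)).1 h) hn'
  · rw [Nat.beq_eq] at h; intro a b; have := vq_eq h0 a b; rw [← h, vq_eq] at this; exact Fin.val_injective this
theorem col1 {L : Sq} (h : LS L) (hs : Sp 1 L) (hn : ¬ Sp 0 L) : ∃ σ τ : Qd → Qd, Injective σ ∧ Injective τ ∧ ∀ a b, L (σ a) (τ b) = h1 a b := by
  obtain ⟨σ, τ, hσ, hτ, e1, e2⟩ := h.nrm id injective_id
  have hs' : Sp 1 (fun a b => L (σ a) (τ b)) := fun a a' b b' => hs _ _ _ _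
  have hn' : ¬ Sp 0 (fun a b => L (σ a) (τ b)) := fun h => hn (h.of_comp hσ hτ)
  refine ⟨σ, τ, hσ, hτ, ?_⟩
  have := (h.comp hσ hτ injective_id).all (redD (rowc id)) (fun N => !(spN 1 N) || spN 0 N || Nat.beq N (codeS h1))
    (redD_ok e1 e2) (by decide +kernel)
  simp only [Bool.or_eq_true, Bool.not_eq_true', ← Bool.not_eq_true] at this; rcases this with (h | h) | h
  · exact absurd ((spN_iff (p := 1)).2 hs') h
  · exact absurd ((spN_iff (p := 0)).1 h) hn'
  · rw [Nat.beq_eq] at h; intro a b; have := vq_eq h1 a b; rw [← h, vq_eq] at this; exact Fin.val_injective this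
def mix8 : List ℕ := [518278065, 912513165, 3627443085, 3329790765, 2379768630, 3021726030, 920161635, 970091655]
def Mx (s : Td) (h L : Sq) (v : Qd) : Prop :=
  ∃ a b a' b', L a b = v ∧ L a' b' = v ∧ chi s (h a b) ≠ chi s (h a' b')
def memN (N : ℕ) (l : List ℕ) : Bool := l.any fun n => Nat.beq n N
theorem memN_iff {N : ℕ} {l : List ℕ} : memN N l = true ↔ N ∈ l := by
  unfold memN; rw [List.any_eq_true]; simp [Nat.beq_eq]
theorem chiN_beq {p : Td} {u v : Qd} : Nat.beq (chiN p u) (chiN p v) = true ↔ chi p u = chi p v := by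
  rw [chiN_eq, chiN_eq, Nat.beq_eq]
  cases chi p u <;> cases chi p v <;> decide
theorem mix8_mx {L : Sq} (hL : codeS L ∈ mix8) (v : Qd) : Mx 0 h0 L v := by
  have key : (mix8.all fun N => rg.all fun v => rg.any fun a => rg.any fun b => rg.any fun a' => rg.any fun b' =>
    Nat.beq (vq N a b) v && Nat.beq (vq N a' b') v && !(Nat.beq (chiN 0 (vq (codeS h0) a b)) (chiN 0 (vq (codeS h0) a' b')))) = true := by
    decide +kernel
  rw [List.all_eq_true] at key; have := key _ hL; simp only [rg_all, rg_any, vq_eq, Bool.and_eq_true, Bool.not_eq_true', ← Bool.not_eq_true, beq_val] at this; obtain ⟨a, b, a', b', h1, h2⟩ := this v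
  exact ⟨a, b, a', b', h1.1, h1.2, fun e => h2 ((chiN_beq (p := 0)).2 e)⟩
theorem F8 {L : Sq} (h : LS L) (hd : ∀ a b, L a b ≠ h0 a b) : codeS L ∈ mix8 ∨ ∀ a b a' b', L a b = L a' b' → chi 0 (h0 a b) = chi 0 (h0 a' b') := by
  have := h.all (fun i r => djN r (Nat.mod (Nat.div (codeS h0) (Nat.pow 256 i)) 256)) (fun N => memN N mix8 ||
    rg.all fun a => rg.all fun b => rg.all fun a' => rg.all fun b' => !(Nat.beq (vq N a b) (vq N a' b')) ||
      Nat.beq (chiN 0 (vq (codeS h0) a b)) (chiN 0 (vq (codeS h0) a' b'))) (by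
      intro i
      have e : Nat.mod (Nat.div (codeS h0) (Nat.pow 256 i)) 256 = rowc (h0 i) := by revert i; decide
      rw [e]; unfold djN; rw [rg_all]; intro b; rw [vl_row, vl_row, Bool.not_eq_true', ← Bool.not_eq_true, beq_val]
      exact hd i b) (by decide +kernel)
  rw [Bool.or_eq_true, memN_iff] at this
  refine this.imp_right fun h a b a' b' e => ?_
  simp only [rg_all, vq_eq, Bool.or_eq_true, Bool.not_eq_true', ← Bool.not_eq_true, beq_val] at h; exact (chiN_beq (p := 0)).1 ((h a b a' b').resolve_left (not_not.2 e))
theorem F8' {L : Sq} (h : LS L) (hd : ∀ a b, L a b ≠ h0 a b) {v : Qd} (hm : Mx 0 h0 L v) : codeS L ∈ mix8 := by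
  refine (F8 h hd).resolve_right fun hn => ?_
  obtain ⟨a, b, a', b', e1, e2, hne⟩ := hm; exact hne (hn a b a' b' (e1.trans e2.symm))
theorem Mx.tr {s s' : Td} {h L : Sq} {σ τ : Qd → Qd} (hs : s ≠ s') (h1 : Injective σ) (h2 : Injective τ) (hh : ∀ a b, ppi s s' (h (σ a) (τ b)) = h0 a b) (v : Qd) (π : Qd → Qd) (hπ : Injective π) : Mx s h L v ↔ Mx 0 h0 (fun a b => π (L (σ a) (τ b))) (π v) := by
  have hinj := ppi_inj s s' hs
  constructor
  · rintro ⟨a, b, a', b', e1, e2, hne⟩; obtain ⟨a, rfl⟩ := Finite.injective_iff_surjective.1 h1 a; obtain ⟨a', rfl⟩ := Finite.injective_iff_surjective.1 h1 a'; obtain ⟨b, rfl⟩ := Finite.injective_iff_surjective.1 h2 b; obtain ⟨b', rfl⟩ := Finite.injective_iff_surjective.1 h2 b'; refine ⟨a, b, a', b', ?_, ?_, ?_⟩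
    · beta_reduce; rw [e1]
    · beta_reduce; rw [e2]
    · rw [← hh, ← hh, ppi0, ppi0]; exact hne
  · rintro ⟨a, b, a', b', e1, e2, hne⟩; refine ⟨_, _, _, _, hπ e1, hπ e2, ?_⟩; rw [← hh, ← hh, ppi0, ppi0] at hne; exact hne
theorem Sp_ppi0 {s s' : Td} {L : Sq} : Sp 0 (fun a b => ppi s s' (L a b)) ↔ Sp s L := by
  unfold Sp; simp only [ppi0]
theorem Sp_ppi1 {s s' : Td} {L : Sq} : Sp 1 (fun a b => ppi s s' (L a b)) ↔ Sp s' L := by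
  unfold Sp; simp only [ppi1]
theorem FD1 {s s' : Td} {h L : Sq} (hh : LS h) (h1 : Sp s h) (h2 : ¬ Sp s' h) (hL : LS L) (hd : ∀ a b, L a b ≠ h a b) {v : Qd} (hm : Mx s h L v) (w : Qd) : Mx s h L w := by
  have hs : s ≠ s' := fun e => h2 (e ▸ h1)
  have hi := ppi_inj s s' hs
  obtain ⟨σ, τ, a1, a2, a3⟩ := col0 (hh.comp injective_id injective_id hi) (Sp_ppi0.2 h1) (fun e => h2 (Sp_ppi1.1 e))
  have tr := fun v => Mx.tr (L := L) hs a1 a2 a3 v _ hi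
  rw [tr] at hm ⊢
  refine mix8_mx (F8' (hL.comp a1 a2 hi) (fun a b e => ?_) hm) _
  rw [← a3] at e; exact hd _ _ (hi e)
def cmp (i j : ℕ) (N N' : ℕ) : Bool := rg.all fun a => rg.all fun b =>
  !(Nat.beq (Nat.mod (Nat.add (vq N a b) j) 4) (Nat.mod (Nat.add (vq N' a b) i) 4))
theorem F16 : (mix8.all fun L0 => mix8.all fun L1 => !(cmp 0 1 L0 L1) || mix8.all fun L2 => !(cmp 0 2 L0 L2 && cmp 1 2 L1 L2) ||
    mix8.all fun L3 => !(cmp 0 3 L0 L3 && cmp 1 3 L1 L3 && cmp 2 3 L2 L3) || rg.any fun a => rg.any fun b =>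
      Nat.beq (chiN 1 (vq L0 a b)) (chiN 1 (vq L1 a b)) && Nat.beq (chiN 1 (vq L0 a b)) (chiN 1 (vq L2 a b)) &&
      Nat.beq (chiN 1 (vq L0 a b)) (chiN 1 (vq L3 a b))) = true := by decide +kernel
theorem cmp_aux : ∀ u v b b' : Qd, Nat.mod (Nat.add u b') 4 = Nat.mod (Nat.add v b) 4 → u - b = v - b' := by
  intro u v b b' h; have h : (u.val + b'.val) % 4 = (v.val + b.val) % 4 := h; apply Fin.ext; rw [Fin.sub_def, Fin.sub_def]; simp only; omega
theorem FD2 {s s' : Td} {h k : Sq} (hs : s ≠ s') (hh : LS h) (hk : LS k) (h1s : Sp s h) (h1n : ∃ p, ¬ Sp p h) (h2s : Sp s' k) (h2n : ∃ p, ¬ Sp p k) (g : Qd → Sq) (hg : ∀ b, LS (g b)) (hgi : ∀ a a', Injective (fun b => g b a a')) (hd : ∀ b a a', k (g b a a') b ≠ h a a') (m1 : ∀ b v, Mx s h (g b) v) (m2 : ∀ a a', ∃ b b', chi s' (k (g b a a') b) ≠ chi s' (k (g b' a a') b')) : False := by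
  have hi := ppi_inj s s' hs
  have n1 : ¬ Sp s' h := fun e => by obtain ⟨p, hp⟩ := h1n; exact hp (Sp.third hs h1s e p)
  have n2 : ¬ Sp s k := fun e => by obtain ⟨p, hp⟩ := h2n; exact hp (Sp.third hs e h2s p)
  obtain ⟨σ, τ, a1, a2, a3⟩ := col0 (hh.comp injective_id injective_id hi) (Sp_ppi0.2 h1s) (fun e => n1 (Sp_ppi1.1 e))
  obtain ⟨σ', τ', b1, b2, b3⟩ := col1 (hk.comp injective_id injective_id hi) (Sp_ppi1.2 h2s) (fun e => n2 (Sp_ppi0.1 e))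
  have hL : ∀ b, codeS (fun a a' => ppi s s' (k (g (τ' b) (σ a) (τ a')) (τ' b))) ∈ mix8 := by
    intro b
    have hi2 : Injective (fun c => ppi s s' (k c (τ' b))) := fun x y e => hk.c _ (hi e)
    refine F8' ((hg (τ' b)).comp a1 a2 hi2) (fun a a' e => ?_) ((Mx.tr hs a1 a2 a3 0 _ hi2).1 (m1 _ 0))
    rw [← a3] at e; exact hd _ _ _ (hi e)
  have hc : ∀ b b' : Qd, b ≠ b' → cmp b b' (codeS fun a a' => ppi s s' (k (g (τ' b) (σ a) (τ a')) (τ' b)))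
      (codeS fun a a' => ppi s s' (k (g (τ' b') (σ a) (τ a')) (τ' b'))) = true := by
    intro b b' hb; unfold cmp; simp only [rg_all, vq_eq, Bool.not_eq_true', ← Bool.not_eq_true, Nat.beq_eq]; intro a a' e
    have e : ppi s s' (k (g (τ' b) (σ a) (τ a')) (τ' b)) - b = ppi s s' (k (g (τ' b') (σ a) (τ a')) (τ' b')) - b' := by
      have := cmp_aux _ _ _ _ e; exact this
    have key : ∀ b, σ' (ppi s s' (k (g (τ' b) (σ a) (τ a')) (τ' b)) - b) = g (τ' b) (σ a) (τ a') := by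
      intro b; apply hk.c (τ' b); apply hi
      beta_reduce
      have := b3 (ppi s s' (k (g (τ' b) (σ a) (τ a')) (τ' b)) - b) b; simp only [id] at this; rw [this]; unfold h1; simp
    have := (key b).symm.trans ((congrArg σ' e).trans (key b')); exact hb (b2 (hgi _ _ this))
  have H := F16; simp only [List.all_eq_true, Bool.or_eq_true, Bool.not_eq_true', ← Bool.not_eq_true, Bool.and_eq_true, rg_any] at H
  have := (((H _ (hL 0) _ (hL 1)).resolve_left (not_not.2 (hc 0 1 (by decide))) _ (hL 2)).resolve_left
    (not_not.2 ⟨hc 0 2 (by decide), hc 1 2 (by decide)⟩)) _ (hL 3)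
  obtain ⟨a, a', ⟨e1, e2⟩, e3⟩ := this.resolve_left (not_not.2 ⟨⟨hc 0 3 (by decide), hc 1 3 (by decide)⟩, hc 2 3 (by decide)⟩)
  simp only [vq_eq] at e1 e2 e3; have e1 := (chiN_beq (p := 1)).1 e1; have e2 := (chiN_beq (p := 1)).1 e2; have e3 := (chiN_beq (p := 1)).1 e3; simp only [ppi1] at e1 e2 e3; obtain ⟨b, b', hne⟩ := m2 (σ a) (τ a'); obtain ⟨b, rfl⟩ := Finite.injective_iff_surjective.1 b2 b; obtain ⟨b', rfl⟩ := Finite.injective_iff_surjective.1 b2 b'; apply hne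
  fin_cases b <;> fin_cases b' <;> simp only [Fin.zero_eta, Fin.mk_one, Fin.reduceFinMk] <;> simp [← e1, ← e2, ← e3]
structure Cf (A B : Sn) (s s' : Td) (h k : Pf) : Prop where
  dis : ∀ i ∈ A, i ∉ B
  ne : s ≠ s'
  qh : Q A h
  th : Top s h A
  qk : Q B k
  tk : Top s' k B
theorem Cf.symm {A B : Sn} {s s' : Td} {h k : Pf} (c : Cf A B s s' h k) : Cf B A s' s k h :=
  ⟨fun i hi hA => c.dis i hA hi, c.ne.symm, c.qk, c.tk, c.qh, c.th⟩
theorem Top.two {s : Td} {h : Pf} {A : Sn} (htop : Top s h A) : 2 ≤ A.card := by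
  by_contra hlt; apply htop.1; intro X hX hne hXA
  exfalso
  have := card_lt_card (Finset.ssubset_iff_subset_ne.2 ⟨hX, hXA⟩); have := Finset.card_pos.2 hne; omega
theorem Top.ne {s : Td} {h : Pf} {A : Sn} (htop : Top s h A) : ∃ i, i ∈ A := by
  have := htop.two
  exact Finset.card_pos.1 (by omega)
theorem levels {A B : Sn} (hAB : ∀ i ∈ A, i ∉ B) {h : Pf} {R : P → Prop} (hq : Q A h) (hR : MDS (A ∪ B) R) {i0 : ℕ} (hi0 : i0 ∈ A) (hl : ∀ x y, (∀ k ∈ B, x k = y k) → R x → R y → h x = h y) : ∃ k1, Q B k1 ∧ ∀ x, R x ↔ h x = k1 x := by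
  have hA : ∀ i ∈ A, i ∈ A ∪ B := fun i hi => mem_union_left _ hi
  have hB : ∀ i ∈ B, i ∈ A ∪ B := fun i hi => mem_union_right _ hi
  have hn0 : ∀ k ∈ B, k ≠ i0 := fun k hk e => hAB i0 hi0 (e ▸ hk)
  choose u hu using fun x => hR.ex x i0 (hA i0 hi0)
  have hdep : Dep B (fun x => h (update x i0 (u x))) := by
    intro x y hxy; refine hl _ _ ?_ (hu x) (hu y); intro k hk; rw [update_of_ne (hn0 k hk), update_of_ne (hn0 k hk)]; exact hxy k hk
  have hiff : ∀ x, R x ↔ h x = h (update x i0 (u x)) := by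
    intro x
    constructor
    · intro hx; refine hl _ _ ?_ hx (hu x); intro k hk; rw [update_of_ne (hn0 k hk)]
    · intro e; have := hq.eq' x hi0 e.symm; have := hu x
      rwa [hq.eq' x hi0 e.symm, update_eq_self] at this
  refine ⟨fun x => h (update x i0 (u x)), ⟨hdep, ?_⟩, hiff⟩
  intro x b hb v v' e
  have hbA : b ∉ A := fun hh => hAB b hh hb
  have hbi : i0 ≠ b := fun e => hbA (e ▸ hi0)
  obtain ⟨a, ha⟩ := hR.ex (update x b v) i0 (hA i0 hi0); rw [update_comm hbi.symm] at ha
  have e1 : ∀ v, h (update (update x b v) i0 (u (update x b v))) =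
      h (update (update (update x i0 a) b v) i0 (u (update (update x i0 a) b v))) := by
    intro v; apply hdep; intro k hk
    by_cases hkb : k = b
    · subst hkb; simp
    · rw [update_of_ne hkb, update_of_ne hkb, update_of_ne (hn0 k hk)]
  have h2 : R (update (update x i0 a) b v') := by
    rw [hiff, ← e1]
    beta_reduce at e
    rw [← e, e1, ← (hiff _).1 ha]; rw [hq.dep.upd hbA, hq.dep.upd hbA]
  exact hR.un _ b (hB b hb) _ _ ha h2
section
variable {A B : Sn} {s s' : Td} {h k : Pf} {R : P → Prop}
def NLv (B : Sn) (h : Pf) (R : P → Prop) (x : P) : Prop :=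
  ∃ y y', (∀ k ∈ B, x k = y k) ∧ (∀ k ∈ B, x k = y' k) ∧ R y ∧ R y' ∧ h y ≠ h y'
theorem DJ1 (c : Cf A B s s' h k) (hR : MDS (A ∪ B) R) (hd : ∀ x, R x → h x ≠ k x) (hI : ∀ i ∈ A, ∀ j ∈ A, i ≠ j → ∀ x, scol s h i j x → Unm R (cc s h) {i, j} x) : (∃ h1, Q A h1 ∧ ∀ x, R x ↔ h1 x = k x) ∨ (∃ k1, Q B k1 ∧ ∀ x, R x ↔ h x = k1 x) := by
  classical
  have hA : ∀ i ∈ A, i ∈ A ∪ B := fun i hi => mem_union_left _ hi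
  have hB : ∀ i ∈ B, i ∈ A ∪ B := fun i hi => mem_union_right _ hi
  obtain ⟨i0, hi0⟩ := c.th.ne
  have hn0 : ∀ k ∈ B, k ≠ i0 := fun k hk e => c.dis i0 hi0 (e ▸ hk)
  have hBA : ∀ b ∈ B, b ∉ A := fun b hb hh => c.dis b hh hb
  have E1 : ∀ x y, (∀ k ∈ B, x k = y k) → R x → R y → cc s h x = cc s h y := by
    intro x y hxy hx hy
    have := T0gen s _ A h (fun z => R (A.piecewise z x)) rfl c.qh c.th (hR.frz subset_union_left x) ?_ x y
      (by rw [pw_self]; exact hx) ?_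
    · exact this
    · intro i hi j hj hij z hz w w' hw hw' hRw hRw'
      have e : ∀ w, cc s h (A.piecewise w x) = cc s h w := by
        intro w; apply (c.qh.bal s).dep; intro l hl; simp [hl]
      rw [← e w, ← e w']
      have sub : ∀ l ∈ A, l ∉ ({i, j} : Sn) → True := fun _ _ _ => trivial
      refine hI i hi j hj hij (A.piecewise z x) ?_ _ _ ?_ ?_ hRw hRw'
      · unfold scol PlSep at hz ⊢
        have o : ∀ p (y z : P), (∀ l ∈ A, y l = z l) → ∀ u v, odd (cc p h) y i u j v = odd (cc p h) z i u j v := fun p y z hyz u v => odd_dep (c.qh.bal p).dep y z hyz i u j v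
        have tr : ∀ p, (∀ y, Ag {i, j} z y → ∀ u v, odd (cc p h) y i u j v = false) ↔
            (∀ y, Ag {i, j} (A.piecewise z x) y → ∀ u v, odd (cc p h) y i u j v = false) := by
          intro p
          constructor
          · intro H y hy u v
            rw [← H (({i, j} : Sn).piecewise y z) (fun l hl => by simp only [piecewise_eq_of_notMem _ _ _ hl]) u v]
            apply o; intro l hl
            by_cases hm : l ∈ ({i, j} : Sn)
            · rw [piecewise_eq_of_mem _ _ _ hm]
            · rw [piecewise_eq_of_notMem _ _ _ hm, ← hy l hm, piecewise_eq_of_mem _ _ _ hl]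
          · intro H y hy u v
            rw [← H (({i, j} : Sn).piecewise y (A.piecewise z x)) (fun l hl => by simp only [piecewise_eq_of_notMem _ _ _ hl]) u v]
            apply o; intro l hl
            by_cases hm : l ∈ ({i, j} : Sn)
            · rw [piecewise_eq_of_mem _ _ _ hm]
            · rw [piecewise_eq_of_notMem _ _ _ hm, ← hy l hm, piecewise_eq_of_mem _ _ _ hl]
        refine ⟨(tr s).1 hz.1, ?_⟩; obtain ⟨p, hp⟩ := hz.2
        exact ⟨p, fun hh => hp ((tr p).2 hh)⟩
      · intro l hl
        by_cases hlA : l ∈ A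
        · simp [hlA, hw l hl]
        · simp [hlA]
      · intro l hl
        by_cases hlA : l ∈ A
        · simp [hlA, hw' l hl]
        · simp [hlA]
    · refine (hR.dep _ _ ?_).mpr hy; intro l hl
      by_cases hlA : l ∈ A
      · simp [hlA]
      · simp [hlA, hxy l ((Finset.mem_union.1 hl).resolve_left hlA)]
  by_cases hlev : ∀ x y, (∀ k ∈ B, x k = y k) → R x → R y → h x = h y
  · exact Or.inr (levels c.dis c.qh hR hi0 hlev)
  push Not at hlev
  obtain ⟨x0, y0, hxy0, hx0, hy0, hne0⟩ := hlev
  left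
  choose u hu using fun x => hR.ex x i0 (hA i0 hi0)
  obtain ⟨e, he1, he2⟩ : ∃ e : P → Bool, (∀ x, R x → cc s h x = e x) ∧ Dep B e := by
    refine ⟨fun x => cc s h (update x i0 (u x)), ?_, ?_⟩
    · intro x hx; refine E1 _ _ ?_ hx (hu x); intro l hl; rw [update_of_ne (hn0 l hl)]
    · intro x y hxy; refine E1 _ _ ?_ (hu x) (hu y); intro l hl; rw [update_of_ne (hn0 l hl), update_of_ne (hn0 l hl)]; exact hxy l hl
  have he3 : ∀ x, ∀ b ∈ B, ∀ a v, e (update (update x i0 a) b v) = e (update x b v) := by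
    intro x b hb a v; apply he2; intro l hl
    by_cases hlb : l = b
    · subst hlb; simp
    · rw [update_of_ne hlb, update_of_ne hlb, update_of_ne (hn0 l hl)]
  have two_e : ∀ x, ∀ b ∈ B, Two (fun v => e (update x b v)) := by
    intro x b hb
    choose v hv using fun a => hR.ex (update x i0 a) b (hB b hb)
    have hvi : Injective v := by
      intro a a' e; have h1 := hv a; have h2 := hv a'; rw [← e] at h2; rw [update_comm (hn0 b hb).symm] at h1 h2; exact hR.un _ i0 (hA i0 hi0) _ _ h1 h2
    have h2 := (c.qh.bal s).two x i0 hi0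
    have : (fun a => cc s h (update x i0 a)) = fun a => e (update x b (v a)) := by
      funext a; rw [← he3 x b hb a, ← he1 _ (hv a), (c.qh.bal s).dep.upd (hBA b hb)]
    rw [this] at h2; unfold Two at h2 ⊢; rw [← h2]
    exact (Finset.card_bijective v (Finite.injective_iff_bijective.1 hvi) (by simp)).symm
  have comp : ∀ x, ∀ b ∈ B, ∀ v v', v ≠ v' → e (update x b v) = e (update x b v') → ∀ y, (∀ k ∈ B, x k = y k) →
      cc s h y = e (update x b v) → (R (update y b v) ↔ ¬ R (update y b v')) := by
    intro x b hb v v' hvv hee y hxy hy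
    constructor
    · intro h1 h2; exact hvv (hR.un _ b (hB b hb) _ _ h1 h2)
    · intro hn; obtain ⟨w, hw⟩ := hR.ex y b (hB b hb); have e1 := he1 _ hw; rw [(c.qh.bal s).dep.upd (hBA b hb)] at e1
      have e2 : e (update y b w) = e (update x b w) := by
        apply he2; intro l hl
        by_cases hlb : l = b
        · subst hlb; simp
        · rw [update_of_ne hlb, update_of_ne hlb]; exact (hxy l hl).symm
      by_cases hwv : w = v
      · rwa [← hwv]
      · exfalso
        have hwv' : w ≠ v' := fun e => hn (e ▸ hw)
        refine two_mem _ (two_e x b hb) v v' w hvv hee hwv hwv' ?_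
        beta_reduce
        rw [← e2, ← e1, hy]
  have hkB : ∀ x y, (∀ k ∈ B, x k = y k) → k x = k y := c.qk.dep
  have nl : ∀ x, NLv B h R x → e x ≠ cc s k x := by
    rintro x ⟨y, y', h1, h2, h3, h4, h5⟩ hex; apply h5
    have : ∀ y, (∀ k ∈ B, x k = y k) → R y → h y = mate s (k x) := by
      intro y hy hRy; have q := he1 y hRy; rw [← he2 x y hy, hex] at q; refine (chi_eq s _ _ q).resolve_left ?_; rw [hkB x y hy]; exact hd y hRy
    rw [this y h1 h3, this y' h2 h4]
  have tg : ∀ x, ∀ b ∈ B, ∀ v, v ≠ x b → cc s k (update x b v) = cc s k x → NLv B h R x →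
      NLv B h R (update x b v) ∧ e (update x b v) = e x := by
    intro x b hb v hv hck hnl
    obtain ⟨v1, hv1, hev1⟩ : ∃ v1, v1 ≠ x b ∧ e (update x b v1) = e (update x b (x b)) := by
      have key : ∀ g : Qd → Bool, Two g → ∀ a, ∃ r, r ≠ a ∧ g r = g a := by decide
      exact key _ (two_e x b hb) (x b)
    rw [update_eq_self] at hev1
    have hNL : NLv B h R (update x b v1) := by
      obtain ⟨y, y', h1, h2, h3, h4, h5⟩ := hnl
      have hy : ∀ y, (∀ k ∈ B, x k = y k) → R y → ∃ z, (∀ k ∈ B, update x b v1 k = z k) ∧ R z ∧ h z ≠ h y := by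
        intro y hxy hRy; obtain ⟨a, ha⟩ := hR.ex (update y b v1) i0 (hA i0 hi0); refine ⟨_, ?_, ha, ?_⟩
        · intro l hl; rw [update_of_ne (hn0 l hl)]
          by_cases hlb : l = b
          · subst hlb; simp
          · rw [update_of_ne hlb, update_of_ne hlb]; exact hxy l hl
        · intro hh; rw [update_comm (hn0 b hb), c.qh.dep.upd (hBA b hb)] at hh; have hay := c.qh.eq' y hi0 hh; rw [hay, update_comm (hn0 b hb), update_eq_self] at ha
          have := hR.un y b (hB b hb) v1 (y b) ha (by rw [update_eq_self]; exact hRy)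
          exact hv1 (this.trans (hxy b hb).symm)
      obtain ⟨z, z1, z2, z3⟩ := hy y h1 h3; obtain ⟨z', z1', z2', z3'⟩ := hy y' h2 h4
      refine ⟨z, z', z1, z1', z2, z2', fun hzz => ?_⟩
      have ce : ∀ w, (∀ k ∈ B, x k = w k) → R w → cc s h w = e x := fun w hw hRw => by
        rw [he1 w hRw, he2 x w hw]
      have cz : cc s h z = e x := by rw [he1 z z2, ← hev1, he2 _ z z1]
      have c1 := (chi_eq s (h z) (h y) (cz.trans (ce y h1 h3).symm)).resolve_left z3; have c2 := (chi_eq s (h y') (h y) ((ce y' h2 h4).trans (ce y h1 h3).symm)).resolve_left (Ne.symm h5); exact z3' (hzz ▸ c1.trans c2.symm)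
    have n1 := nl _ hNL; have n0 := nl _ hnl; rw [hev1] at n1
    have hk1 : cc s k (update x b v1) = cc s k x := by
      revert n0 n1; generalize e x = t1; generalize cc s k x = t2; generalize cc s k (update x b v1) = t3
      cases t1 <;> cases t2 <;> cases t3 <;> decide
    have : v1 = v := by
      by_contra hvv; refine two_mem _ ((c.qk.bal s).two x b hb) (x b) v v1 hv.symm ?_ hv1 hvv ?_
      · simp only [update_eq_self]; exact hck.symm
      · simp only [update_eq_self]; exact hk1
    subst this; exact ⟨hNL, hev1⟩
  have hconn : ConnC (cc s k) B := c.tk.2 s c.ne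
  have hNL0 : NLv B h R x0 := ⟨x0, y0, fun _ _ => rfl, hxy0, hx0, hy0, hne0⟩
  have cls1 : ∀ y, cc s k y = cc s k x0 → NLv B h R y := by
    intro y hy; refine D1 (c.qk.bal s) hconn (NLv B h R) ?_ ?_ x0 y hy hNL0
    · intro x y hxy; unfold NLv
      have : ∀ z : P, (∀ k ∈ B, x k = z k) ↔ (∀ k ∈ B, y k = z k) := fun z =>
        forall_congr' fun l => ⟨fun H hl => (hxy l hl) ▸ H hl, fun H hl => (hxy l hl).symm ▸ H hl⟩
      simp only [this]
    · intro x b hb v hv hx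
      by_cases hvb : v = x b
      · subst hvb; rwa [update_eq_self]
      · exact (tg x b hb v hvb hv hx).1
  have pt : ∀ x, ∀ b ∈ B, ∀ v, v ≠ x b → cc s k (update x b v) = cc s k x → e (update x b v) = e x := by
    intro x b hb v hv hck
    by_cases hx : cc s k x = cc s k x0
    · exact (tg x b hb v hv hck (cls1 x hx)).2
    · have key : ∀ g g' : Qd → Bool, Two g → Two g' → ∀ a v, v ≠ a → g v = g a → (∀ w w', w ≠ w' → g w ≠ g a → g w' ≠ g a → g' w = g' w') → g' v = g' a := by
        unfold Two; decide +kernel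
      have := key _ _ ((c.qk.bal s).two x b hb) (two_e x b hb) (x b) v hv (by simp only [update_eq_self]; exact hck) ?_
      · simpa only [update_eq_self] using this
      · intro w w' hww h1 h2; simp only [update_eq_self] at h1 h2
        have h3 : cc s k (update x b w) = cc s k x0 := by
          revert h1 hx; generalize cc s k (update x b w) = t1; generalize cc s k x = t2; generalize cc s k x0 = t3
          cases t1 <;> cases t2 <;> cases t3 <;> decide
        have h4 : cc s k (update x b w') = cc s k x0 := by
          revert h2 hx; generalize cc s k (update x b w') = t1; generalize cc s k x = t2; generalize cc s k x0 = t3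
          cases t1 <;> cases t2 <;> cases t3 <;> decide
        have := (tg (update x b w) b hb w' (by simpa using hww.symm) (by rw [update_idem, h3, h4]) (cls1 _ h3)).2
        rw [update_idem] at this; exact this.symm
  have final : ∀ x y, k y = k x → ∀ α, R (A.piecewise α y) ↔ R (A.piecewise α x) := by
    intro x y hkxy
    have hRB : ∀ α y y', (∀ l ∈ B, y l = y' l) → (R (A.piecewise α y) ↔ R (A.piecewise α y')) := by
      intro α y y' hyy; refine iff_of_eq (hR.dep _ _ ?_); intro l hl
      by_cases hlA : l ∈ A
      · simp [hlA]
      · simp [hlA, hyy l ((Finset.mem_union.1 hl).resolve_left hlA)]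
    have := D1 (c.qk.bal s) hconn (fun y => e y = e x ∧ ((k y = k x ∧ ∀ α, R (A.piecewise α y) ↔ R (A.piecewise α x)) ∨
      (k y = mate s (k x) ∧ ∀ α, cc s h α = e x → (R (A.piecewise α y) ↔ ¬ R (A.piecewise α x))))) ?_ ?_ x y
      (by unfold cc; rw [hkxy]) ⟨rfl, Or.inl ⟨rfl, fun _ => Iff.rfl⟩⟩
    · rcases this.2 with H | H
      · exact H.2
      · exact absurd (H.1.symm.trans hkxy) (mate_ne _ _)
    · intro y y' hyy
      beta_reduce
      rw [he2 y y' hyy, hkB y y' hyy]; simp only [hRB _ y y' hyy]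
    · intro z b hb v hv hz
      by_cases hvb : v = z b
      · subst hvb; rwa [update_eq_self]
      · have hez := pt z b hb v hvb hv
        have hkz : k (update z b v) = mate s (k z) := (chi_eq s _ _ hv).resolve_left
          (fun e => hvb (c.qk.eq' z hb e))
        have hco : ∀ α, cc s h α = e z → (R (A.piecewise α (update z b v)) ↔ ¬ R (A.piecewise α z)) := by
          intro α hα; rw [pw_upd_out (hBA b hb)]
          have := comp z b hb v (z b) hvb (by rw [update_eq_self]; exact hez) (A.piecewise α z)
            (fun l hl => by simp [hBA l hl]) (by
              rw [hez, ← hα]; apply (c.qh.bal s).dep; intro l hl; simp [hl])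
          rw [this]
          have e : update (A.piecewise α z) b (z b) = A.piecewise α z := by
            funext l; by_cases hl : l = b
            · subst hl; simp [hBA l hb]
            · simp [hl]
          rw [e]
        have hoff : ∀ z α, e z ≠ cc s h α → ¬ R (A.piecewise α z) := by
          intro z α hα hRz; apply hα; have := he1 _ hRz
          rw [he2 z (A.piecewise α z) (fun l hl => by simp [hBA l hl]), ← this]
          apply (c.qh.bal s).dep; intro l hl; simp [hl]
        refine ⟨hez.trans hz.1, ?_⟩; rcases hz.2 with H | H
        · right
          refine ⟨by rw [hkz, H.1], fun α hα => ?_⟩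
          rw [hco α (hα.trans hz.1.symm), H.2]
        · left
          refine ⟨by rw [hkz, H.1, mate_mate], fun α => ?_⟩
          by_cases hα : cc s h α = e x
          · rw [hco α (hα.trans hz.1.symm), H.2 α hα, not_not]
          · exact iff_of_false (hoff _ _ fun ee => hα (ee.symm.trans (hez.trans hz.1)))
              (hoff _ _ fun ee => hα ee.symm)
  obtain ⟨b0, hb0⟩ := c.tk.ne
  have := levels (fun i hi hA => c.dis i hA hi) c.qk (by rwa [Finset.union_comm]) hb0 (R := R) (B := A) (h := k) ?_
  · obtain ⟨h1, q1, q2⟩ := this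
    exact ⟨h1, q1, fun x => (q2 x).trans eq_comm⟩
  · intro x y hxy hx hy; obtain ⟨v, hv⟩ := c.qk.ex x hb0 (k y)
    have e1 : A.piecewise x (update x b0 v) = update x b0 v := by
      rw [pw_upd_out (hBA b0 hb0), pw_self]
    have e2 := (final y (update x b0 v) hv x).2 ((hR.dep _ _ ?_).mpr hy)
    · rw [e1] at e2
      have := hR.un x b0 (hB b0 hb0) v (x b0) e2 (by rw [update_eq_self]; exact hx)
      rw [← hv, this, update_eq_self]
    · intro l hl
      by_cases hlA : l ∈ A
      · simp [hlA, hxy l hlA]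
      · simp [hlA]
end
def sqf (f : Pf) (i j : ℕ) (x : P) : Sq := fun a b => f (update (update x i a) j b)
theorem Q.ls {A : Sn} {f : Pf} (h : Q A f) {i j : ℕ} (hi : i ∈ A) (hj : j ∈ A) (hij : i ≠ j) (x : P) : LS (sqf f i j x) where
  r := fun a => h.inj _ j hj
  c := fun b u v e => by
    unfold sqf at e
    beta_reduce at e
    rw [update_comm hij, update_comm hij] at e; exact h.inj _ i hi e
theorem ag2 {i j : ℕ} {x y : P} (h : Ag {i, j} x y) : y = update (update x i (y i)) j (y j) := by
  funext l
  by_cases hj : l = j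
  · subst hj; simp
  · rw [update_of_ne hj]
    by_cases hi : l = i
    · subst hi; simp
    · rw [update_of_ne hi, h l (by simp [hi, hj])]
theorem odd_sqf {f : Pf} {i j : ℕ} (hij : i ≠ j) (x : P) (p : Td) (a a' b b' : Qd) : odd (cc p f) (update (update x i a) j b) i a' j b' = ((chi p (sqf f i j x a b) ^^ chi p (sqf f i j x a' b)) ^^ (chi p (sqf f i j x a b') ^^ chi p (sqf f i j x a' b'))) := by
  have e1 : update (update (update x i a) j b) i a' = update (update x i a') j b := by
    rw [update_comm hij.symm, update_idem]
  have e2 : update (update (update x i a) j b) j b' = update (update x i a) j b' := by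
    rw [update_idem]
  have e3 : update (update (update (update x i a) j b) i a') j b' = update (update x i a') j b' := by
    rw [e1, update_idem]
  unfold odd cc sqf; rw [e3, e2, e1]
theorem plsep_iff {f : Pf} {i j : ℕ} (hij : i ≠ j) {x : P} {p : Td} : PlSep p f i j x ↔ Sp p (sqf f i j x) := by
  constructor
  · intro h a a' b b'
    have := h (update (update x i a) j b) ((Ag.rfl'.upd (by simp) a).upd (by simp) b) a' b'
    rwa [odd_sqf hij] at this
  · intro h y hy u v; rw [ag2 hy, odd_sqf hij]; exact h _ _ _ _
theorem unm_iff {R : P → Prop} {c : P → Bool} {i j : ℕ} {x : P} : Unm R c {i, j} x ↔ ∀ a b a' b', R (update (update x i a) j b) → R (update (update x i a') j b') → c (update (update x i a) j b) = c (update (update x i a') j b') := by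
  constructor
  · intro h a b a' b' h1 h2
    exact h _ _ ((Ag.rfl'.upd (by simp) _).upd (by simp) _) ((Ag.rfl'.upd (by simp) _).upd (by simp) _) h1 h2
  · intro h y y' hy hy' h1 h2; rw [ag2 hy] at h1 ⊢; rw [ag2 hy'] at h2 ⊢; exact h _ _ _ _ h1 h2
section
variable {A B : Sn} {s s' : Td} {h k : Pf} {R : P → Prop}
def MP (s : Td) (h : Pf) (R : P → Prop) (i j : ℕ) (x : P) : Prop :=
  scol s h i j x ∧ ¬ Unm R (cc s h) {i, j} x
theorem sqf_upd_out {h : Pf} (hd : Dep A h) {b : ℕ} (hb : b ∉ A) {i j : ℕ} (hbi : i ≠ b) (hbj : j ≠ b) (x : P) (v : Qd) : sqf h i j (update x b v) = sqf h i j x := by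
  funext a a'; unfold sqf; rw [update_comm hbi.symm, update_comm hbj.symm, hd.upd hb]
theorem MP.step (c : Cf A B s s' h k) (hR : MDS (A ∪ B) R) (hd : ∀ x, R x → h x ≠ k x) {i j : ℕ} (hi : i ∈ A) (hj : j ∈ A) (hij : i ≠ j) (x : P) (b : ℕ) (hb : b ∈ B) (v : Qd) (hx : MP s h R i j x) : MP s h R i j (update x b v) := by
  have hA : ∀ i ∈ A, i ∈ A ∪ B := fun i hi => mem_union_left _ hi
  have hB : ∀ i ∈ B, i ∈ A ∪ B := fun i hi => mem_union_right _ hi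
  have hbA : b ∉ A := fun hh => c.dis b hh hb
  have hbi : i ≠ b := fun e => hbA (e ▸ hi)
  have hbj : j ≠ b := fun e => hbA (e ▸ hj)
  have hiB := c.dis i hi; have hjB := c.dis j hj; unfold MP scol at hx ⊢; simp only [plsep_iff hij, sqf_upd_out c.qh.dep hbA hbi hbj] at hx ⊢; refine ⟨hx.1, ?_⟩; obtain ⟨⟨hs, p, hp⟩, hm⟩ := hx
  choose g hg using fun a a' => hR.ex (update (update x i a) j a') b (hB b hb)
  have gk : ∀ w a a', R (update (update (update x b w) i a) j a') ↔ k (update x b (g a a')) = k (update x b w) := by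
    intro w a a'; have hg' := hg a a'
    constructor
    · intro hh; rw [update_comm hbi.symm, update_comm hbj.symm] at hh; rw [hR.un _ b (hB b hb) _ _ hh hg']
    · intro hh; rw [update_comm hbi.symm, update_comm hbj.symm, ← c.qk.eq x hb hh]; exact hg'
  have hL : LS (fun a a' => k (update x b (g a a'))) := by
    constructor
    · intro a u w e; have h1 := (gk _ a u).2 rfl; have h2 := (gk (g a u) a w).2 e.symm; exact hR.un _ j (hA j hj) _ _ h1 h2
    · intro a u w e; have h1 := (gk _ u a).2 rfl; have h2 := (gk (g u a) w a).2 e.symm; rw [update_comm hij] at h1 h2; exact hR.un _ i (hA i hi) _ _ h1 h2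
  have hdL : ∀ a a', k (update x b (g a a')) ≠ sqf h i j x a a' := by
    intro a a' e; have := hd _ (hg a a'); rw [c.qh.dep.upd hbA, update_comm hbj, update_comm hbi, c.qk.dep.upd hjB, c.qk.dep.upd hiB] at this; exact this e.symm
  have hMx : ∀ w, Mx s (sqf h i j x) (fun a a' => k (update x b (g a a'))) (k (update x b w)) ↔
      ¬ Unm R (cc s h) {i, j} (update x b w) := by
    intro w; rw [unm_iff]
    push Not
    unfold Mx; simp only [← gk]
    refine exists_congr fun a => exists_congr fun a' => exists_congr fun d => exists_congr fun d' => ?_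
    refine and_congr_right fun _ => and_congr_right fun _ => ?_
    have e : ∀ a a', cc s h (update (update (update x b w) i a) j a') = chi s (sqf h i j x a a') := by
      intro a a'; unfold cc sqf; rw [update_comm hbi.symm, update_comm hbj.symm, c.qh.dep.upd hbA]
    rw [e, e]
  rw [← hMx]
  have hm' : Mx s (sqf h i j x) (fun a a' => k (update x b (g a a'))) (k (update x b (x b))) := by
    rw [hMx, update_eq_self]; exact hm
  exact FD1 (c.qh.ls hi hj hij x) hs hp hL hdL hm' _
theorem MP.dep {A B : Sn} (hq : Q A h) (hR : MDS (A ∪ B) R) {i j : ℕ} (hij : i ≠ j) : Dep (A ∪ B) (MP s h R i j) := by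
  intro x y hxy
  have hu : ∀ a a', ∀ l ∈ A ∪ B, update (update x i a) j a' l = update (update y i a) j a' l := by
    intro a a' l hl
    by_cases hlj : l = j
    · subst hlj; simp
    · rw [update_of_ne hlj, update_of_ne hlj]
      by_cases hli : l = i
      · subst hli; simp
      · rw [update_of_ne hli, update_of_ne hli]; exact hxy l hl
  have hu' : ∀ a a', h (update (update x i a) j a') = h (update (update y i a) j a') := fun a a' => hq.dep _ _ fun l hl => hu a a' l (mem_union_left _ hl)
  unfold MP scol; simp only [plsep_iff hij, unm_iff]
  have e : sqf h i j x = sqf h i j y := by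
    funext a a'; exact hu' a a'
  rw [e]
  have e2 : ∀ a a', R (update (update x i a) j a') = R (update (update y i a) j a') := fun a a' => hR.dep _ _ (hu a a')
  unfold cc; simp only [e2, hu']
theorem DJ (c : Cf A B s s' h k) (hR : MDS (A ∪ B) R) (hd : ∀ x, R x → h x ≠ k x) : (∃ h1, Q A h1 ∧ ∀ x, R x ↔ h1 x = k x) ∨ (∃ k1, Q B k1 ∧ ∀ x, R x ↔ h x = k1 x) := by
  classical
  have hA : ∀ i ∈ A, i ∈ A ∪ B := fun i hi => mem_union_left _ hi
  have hB : ∀ i ∈ B, i ∈ A ∪ B := fun i hi => mem_union_right _ hi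
  have hR' : MDS (B ∪ A) R := by rwa [Finset.union_comm]
  have hd' : ∀ x, R x → k x ≠ h x := fun x hx => (hd x hx).symm
  by_cases hI : ∀ i ∈ A, ∀ j ∈ A, i ≠ j → ∀ x, scol s h i j x → Unm R (cc s h) {i, j} x
  · exact DJ1 c hR hd hI
  by_cases hII : ∀ i ∈ B, ∀ j ∈ B, i ≠ j → ∀ x, scol s' k i j x → Unm R (cc s' k) {i, j} x
  · rcases DJ1 c.symm hR' hd' hII with ⟨h1, q1, q2⟩ | ⟨h1, q1, q2⟩
    · exact Or.inr ⟨h1, q1, fun x => (q2 x).trans eq_comm⟩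
    · exact Or.inl ⟨h1, q1, fun x => (q2 x).trans eq_comm⟩
  exfalso
  push Not at hI hII
  obtain ⟨i, hi, j, hj, hij, x, hx1, hx2⟩ := hI; obtain ⟨a, ha, b, hb, hab, y, hy1, hy2⟩ := hII
  have mz : ∀ z, (∀ l ∈ A, z l = x l) → MP s h R i j z := by
    intro z hz
    have := walk B (MP s h R i j) (fun w b hb v hw => MP.step c hR hd hi hj hij w b hb v hw) x (B.piecewise z x)
      (fun l hl => by simp [hl]) ⟨hx1, hx2⟩
    refine (MP.dep c.qh hR hij _ _ ?_).mp this; intro l hl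
    by_cases hlB : l ∈ B
    · simp [hlB]
    · simp [hlB, hz l ((Finset.mem_union.1 hl).resolve_right hlB)]
  have mz' : ∀ z, (∀ l ∈ B, z l = y l) → MP s' k R a b z := by
    intro z hz
    have := walk A (MP s' k R a b) (fun w b' hb' v hw => MP.step c.symm hR' hd' ha hb hab w b' hb' v hw) y (A.piecewise z y)
      (fun l hl => by simp [hl]) ⟨hy1, hy2⟩
    refine (MP.dep c.qk hR' hab _ _ ?_).mp this; intro l hl
    by_cases hlB : l ∈ A
    · simp [hlB]
    · simp [hlB, hz l ((Finset.mem_union.1 hl).resolve_right hlB)]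
  set z : P := A.piecewise x y with hz
  have hAB := c.dis
  have haA : a ∉ A := fun hh => hAB a hh ha
  have hbA : b ∉ A := fun hh => hAB b hh hb
  have hia : i ≠ a := fun e => haA (e ▸ hi)
  have hib : i ≠ b := fun e => hbA (e ▸ hi)
  have hja : j ≠ a := fun e => haA (e ▸ hj)
  have hjb : j ≠ b := fun e => hbA (e ▸ hj)
  have hiB := hAB i hi; have hjB := hAB j hj
  have h1 : ∀ v w, MP s h R i j (update (update z a v) b w) := by
    intro v w; apply mz; intro l hl
    have n1 : l ≠ b := fun e => hbA (e ▸ hl)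
    have n2 : l ≠ a := fun e => haA (e ▸ hl)
    rw [update_of_ne n1, update_of_ne n2]; simp [hz, hl]
  have h2 : ∀ v w, MP s' k R a b (update (update z i v) j w) := by
    intro v w; apply mz'; intro l hl
    have n1 : l ≠ j := fun e => hjB (e ▸ hl)
    have n2 : l ≠ i := fun e => hiB (e ▸ hl)
    rw [update_of_ne n1, update_of_ne n2]
    have : l ∉ A := fun hh => hAB l hh hl
    simp [hz, this]
  have m1 := h1 (z a) (z b); have m2 := h2 (z i) (z j); simp only [update_eq_self] at m1 m2; have m1 := m1.1; have m2 := m2.1; unfold scol at m1 m2; simp only [plsep_iff hij, plsep_iff hab] at m1 m2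
  choose g hg using fun w u v => hR.ex (update (update (update z i u) j v) b w) a (hB a ha)
  have gi : ∀ w u v t, R (update (update (update (update z i u) j v) a t) b w) ↔ g w u v = t := by
    intro w u v t; rw [update_comm hab]
    constructor
    · intro hh; exact hR.un _ a (hB a ha) _ _ (hg w u v) hh
    · intro hh; rw [← hh]; exact hg w u v
  have perm : ∀ u v t w, update (update (update (update z i u) j v) a t) b w =
      update (update (update (update z a t) b w) i u) j v := by
    intro u v t w; rw [update_comm hja, update_comm hia, update_comm hjb, update_comm hib]
  refine FD2 c.ne (c.qh.ls hi hj hij z) (c.qk.ls ha hb hab z) m1.1 m1.2 m2.1 m2.2 g ?_ ?_ ?_ ?_ ?_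
  · intro w
    constructor
    · intro u v v' e; have e1 := (gi w u v _).2 rfl; have e2 := (gi w u v' _).2 e.symm; rw [perm] at e1 e2; exact hR.un _ j (hA j hj) _ _ e1 e2
    · intro u v v' e; have e1 := (gi w v u _).2 rfl; have e2 := (gi w v' u _).2 e.symm; rw [perm, update_comm hij] at e1 e2; exact hR.un _ i (hA i hi) _ _ e1 e2
  · intro u v w w' e; have e1 := (gi w u v _).2 rfl; have e2 := (gi w' u v _).2 e.symm; exact hR.un _ b (hB b hb) _ _ e1 e2
  · intro w u v e; have e1 := (gi w u v _).2 rfl; refine hd _ e1 ?_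
    have ek : k (update (update (update (update z i u) j v) a (g w u v)) b w) = sqf k a b z (g w u v) w := by
      rw [perm, c.qk.dep.upd hjB, c.qk.dep.upd hiB]; rfl
    rw [ek, e, c.qh.dep.upd hbA, c.qh.dep.upd haA]; rfl
  · intro w t; have := (h1 t w).2; rw [unm_iff] at this
    push Not at this
    obtain ⟨u, v, u', v', r1, r2, r3⟩ := this; rw [← perm] at r1 r2 r3; rw [← perm] at r3; refine ⟨u, v, u', v', (gi _ _ _ _).1 r1, (gi _ _ _ _).1 r2, ?_⟩; unfold cc at r3
    rwa [c.qh.dep.upd hbA, c.qh.dep.upd haA, c.qh.dep.upd hbA, c.qh.dep.upd haA] at r3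
  · intro u v; have := (h2 u v).2; rw [unm_iff] at this
    push Not at this
    obtain ⟨t, w, t', w', r1, r2, r3⟩ := this; refine ⟨w, w', ?_⟩; rw [(gi w u v t).1 r1, (gi w' u v t').1 r2]; unfold cc at r3
    rwa [perm, perm, c.qk.dep.upd hjB, c.qk.dep.upd hiB, c.qk.dep.upd hjB, c.qk.dep.upd hiB] at r3
end
def bt (n b : ℕ) : Bool := Nat.beq (Nat.mod (Nat.div n (Nat.pow 2 b)) 2) 1
def r16 : List ℕ := [0, 1, 2, 3, 4, 5, 6, 7, 8, 9, 10, 11, 12, 13, 14, 15]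
def sel (r0 r1 r2 r3 a : ℕ) : ℕ := match a with
  | 0 => r0
  | 1 => r1
  | 2 => r2
  | _ => r3
def rok (a r : ℕ) : Bool := !(bt r a) && rg.any fun b => bt r b
def rsN (S : ℕ → ℕ → Bool) (a b : ℕ) : Bool := rg.all fun b' => S a b' == Nat.beq b' b
def csN (S : ℕ → ℕ → Bool) (a b : ℕ) : Bool := rg.all fun a' => S a' b == Nat.beq a' a
def vdN (S : ℕ → ℕ → Bool) : Bool :=
  (rg.all fun a => rg.all fun b => rsN S a b == csN S a b) && !(rg.all fun a => rg.any fun b => rsN S a b)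
def djr (r m : ℕ) : Bool := rg.all fun b => !(bt r b && bt m b)
def chkM : Bool := r16.all fun r0 => !rok 0 r0 || r16.all fun r1 => !rok 1 r1 || r16.all fun r2 => !rok 2 r2 ||
  r16.all fun r3 => !rok 3 r3 || !vdN (fun a b => bt (sel r0 r1 r2 r3 a) b) ||
  r16.all fun m0 => !rok 0 m0 || !djr r0 m0 || r16.all fun m1 => !rok 1 m1 || !djr r1 m1 || r16.all fun m2 => !rok 2 m2 ||
    !djr r2 m2 || r16.all fun m3 => !rok 3 m3 || !djr r3 m3 || !vdN (fun a b => bt (sel m0 m1 m2 m3 a) b)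
theorem chkM_ok : chkM = true := by decide +kernel
theorem r16_ex : ∀ r : Qd → Bool, ∃ n ∈ r16, ∀ b : Qd, bt n b = r b := by decide
structure Vd (I : Qd → Qd → Prop) : Prop where
  od : ∀ a, ¬ I a a
  ne : ∀ a, ∃ b, I a b
  rc : ∀ a b, (∀ b', I a b' ↔ b' = b) ↔ (∀ a', I a' b ↔ a' = a)
  np : ¬ ∀ a, ∃ b, ∀ b', I a b' ↔ b' = b
theorem Vd.code {I : Qd → Qd → Prop} (h : Vd I) : ∃ r : Qd → ℕ, (∀ a, r a ∈ r16) ∧ (∀ a b : Qd, bt (r a) b = true ↔ I a b) ∧ (∀ a : Qd, rok a (r a) = true) ∧ vdN (fun a b => bt (sel (r 0) (r 1) (r 2) (r 3) a) b) = true := by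
  classical
  choose r hr hb using fun a => r16_ex (fun b => decide (I a b))
  have hb' : ∀ a b : Qd, bt (r a) b = true ↔ I a b := fun a b => by rw [hb]; simp
  have hsel : ∀ a : Qd, sel (r 0) (r 1) (r 2) (r 3) a = r a := by
    intro a; fin_cases a <;> rfl
  refine ⟨r, hr, hb', ?_, ?_⟩
  · intro a; unfold rok; rw [Bool.and_eq_true, rg_any]; refine ⟨?_, ?_⟩
    · rw [hb]; simp [h.od]
    · obtain ⟨b, hab⟩ := h.ne a; exact ⟨b, (hb' a b).2 hab⟩
  · have e1 : ∀ a b : Qd, rsN (fun a b => bt (sel (r 0) (r 1) (r 2) (r 3) a) b) a b = true ↔ ∀ b', I a b' ↔ b' = b := by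
      intro a b; unfold rsN; rw [rg_all]
      refine forall_congr' fun b' => ?_
      beta_reduce
      rw [hsel, beq_iff_eq, Bool.eq_iff_iff, hb', beq_val]
    have e2 : ∀ a b : Qd, csN (fun a b => bt (sel (r 0) (r 1) (r 2) (r 3) a) b) a b = true ↔ ∀ a', I a' b ↔ a' = a := by
      intro a b; unfold csN; rw [rg_all]
      refine forall_congr' fun b' => ?_
      beta_reduce
      rw [hsel, beq_iff_eq, Bool.eq_iff_iff, hb', beq_val]
    unfold vdN; rw [Bool.and_eq_true, rg_all]
    constructor
    · intro a; rw [rg_all]; intro b; rw [beq_iff_eq, Bool.eq_iff_iff, e1, e2]; exact h.rc a b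
    · rw [Bool.not_eq_true', Bool.eq_false_iff, Ne, rg_all]; simp only [rg_any, e1]; exact h.np
theorem Vd.no {I J : Qd → Qd → Prop} (h : Vd I) (h' : Vd J) (hd : ∀ a b, I a b → ¬ J a b) : False := by
  obtain ⟨r, r1, r2, r3, r4⟩ := h.code; obtain ⟨m, m1, m2, m3, m4⟩ := h'.code
  have dj : ∀ a : Qd, djr (r a) (m a) = true := by
    intro a; unfold djr; rw [rg_all]; intro b; rw [Bool.not_eq_true', Bool.eq_false_iff, Ne, Bool.and_eq_true, r2, m2]
    exact fun hh => hd a b hh.1 hh.2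
  have key := chkM_ok; unfold chkM at key; simp only [List.all_eq_true, Bool.or_eq_true, Bool.not_eq_true'] at key
  have k0 := (key _ (r1 0)).resolve_left (by have := r3 0; simp at this ⊢; exact this)
  have k1 := (k0 _ (r1 1)).resolve_left (by have := r3 1; simp at this ⊢; exact this)
  have k2 := (k1 _ (r1 2)).resolve_left (by have := r3 2; simp at this ⊢; exact this)
  have k3 := (k2 _ (r1 3)).resolve_left (by have := r3 3; simp at this ⊢; rw [r4]; simp [this])
  have k0 := (k3 _ (m1 0)).resolve_left (by have := m3 0; simp at this ⊢; simp [this, dj])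
  have k1 := (k0 _ (m1 1)).resolve_left (by have := m3 1; simp at this ⊢; simp [this, dj])
  have k2 := (k1 _ (m1 2)).resolve_left (by have := m3 2; simp at this ⊢; simp [this, dj])
  have k3 := (k2 _ (m1 3)); have := m3 3; simp at this; simp [this, dj, m4] at k3
theorem Vd.mk' {A : Sn} {g h : Pf} (hg : Q A g) (hh : Q A h) {i : ℕ} (hi : i ∈ A) (hd : ∀ x, g x ≠ h x) (hn : ¬ ∃ π : Qd → Qd, Injective π ∧ ∀ x, g x = π (h x)) : Vd (fun a b => ∃ x, g x = a ∧ h x = b) := by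
  have lv : ∀ {g h : Pf}, Q A g → Q A h → ∀ a b, (∀ x, g x = a → h x = b) → ∀ x, h x = b → g x = a := by
    intro g h hg hh a b hab x hx; obtain ⟨v, hv⟩ := hg.ex x hi a; have := hab _ hv; rw [← hx] at this; rw [hh.eq' x hi this, update_eq_self] at hv; exact hv
  have x0 : P := fun _ => 0
  have ne1 : ∀ {g : Pf}, Q A g → ∀ a, ∃ x, g x = a := fun hg a => by
    obtain ⟨v, hv⟩ := hg.ex x0 hi a; exact ⟨_, hv⟩
  have rce : ∀ {g h : Pf}, Q A g → Q A h → ∀ a b, (∀ b', (∃ x, g x = a ∧ h x = b') ↔ b' = b) ↔ (∀ x, g x = a → h x = b) := by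
    intro g h hg hh a b
    constructor
    · intro hab x hx; exact (hab _).1 ⟨x, hx, rfl⟩
    · intro hab b'
      constructor
      · rintro ⟨x, hx, rfl⟩; exact hab x hx
      · rintro rfl; obtain ⟨x, hx⟩ := ne1 hg a; exact ⟨x, hx, hab x hx⟩
  refine ⟨?_, ?_, ?_, ?_⟩
  · rintro a ⟨x, h1, h2⟩; exact hd x (h1.trans h2.symm)
  · intro a; obtain ⟨x, hx⟩ := ne1 hg a; exact ⟨_, x, hx, rfl⟩
  · intro a b; rw [rce hg hh]
    have e : (∀ a', (∃ x, g x = a' ∧ h x = b) ↔ a' = a) ↔ (∀ a', (∃ x, h x = b ∧ g x = a') ↔ a' = a) := by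
      simp only [and_comm]
    rw [e, rce hh hg]; exact ⟨lv hg hh a b, lv hh hg b a⟩
  · intro hall; apply hn
    choose σ hσ using hall
    have h1 : ∀ x, h x = σ (g x) := fun x => ((hσ (g x) (h x)).1 ⟨x, rfl, rfl⟩)
    have hs : Surjective σ := fun b => by
      obtain ⟨x, hx⟩ := ne1 hh b
      exact ⟨g x, by rw [← h1, hx]⟩
    have hb : Bijective σ := Finite.surjective_iff_bijective.1 hs
    refine ⟨(Equiv.ofBijective σ hb).symm, (Equiv.injective _), fun x => ?_⟩
    rw [h1]; exact ((Equiv.ofBijective σ hb).symm_apply_apply _).symm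
section
variable {A B : Sn} {s s' : Td} {h k : Pf} {R : P → Prop}
theorem glue {e : ℕ} (hAB : ∀ i ∈ A, i ∉ B) (heA : e ∉ A) (heB : e ∉ B) {b : ℕ} (hb : b ∈ B) (qk : Q B k) (hR : MDS (insert e (A ∪ B)) R) (hv : ∀ v, ∃ h1, Q A h1 ∧ ∀ x, R (update x e v) ↔ h1 x = k x) : ∃ H, Q (insert e A) H ∧ ∀ x, R x ↔ H x = k x := by
  choose g gq gr using hv
  have hbA : b ∉ A := fun hh => hAB b hh hb
  have heb : e ≠ b := fun h => heB (h ▸ hb)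
  refine ⟨fun x => g (x e) x, ⟨?_, ?_⟩, ?_⟩
  · intro x y hxy
    beta_reduce
    rw [hxy e (by simp)]
    exact (gq _).dep _ _ fun i hi => hxy i (by simp [hi])
  · intro x i hi u v huv
    beta_reduce at huv
    rcases Finset.mem_insert.1 hi with rfl | hi
    · simp only [update_self] at huv; rw [(gq u).dep.upd heA, (gq v).dep.upd heA] at huv; obtain ⟨w, hw⟩ := qk.ex x hb (g u x)
      have h1 := (gr u (update x b w)).2 (by rw [(gq u).dep.upd hbA, hw])
      have h2 := (gr v (update x b w)).2 (by rw [(gq v).dep.upd hbA, hw, huv])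
      exact hR.un _ i (by simp) _ _ h1 h2
    · have : e ≠ i := fun h => heA (h ▸ hi)
      rw [update_of_ne this, update_of_ne this] at huv; exact (gq _).inj x i hi huv
  · intro x; have := gr (x e) x
    rwa [update_eq_self] at this
theorem M {e : ℕ} (c : Cf A B s s' h k) (heA : e ∉ A) (heB : e ∉ B) (hR : MDS (insert e (A ∪ B)) R) (v0 : Qd) (h0 : ∀ x, R (update x e v0) ↔ h x = k x) : (∃ H, Q (insert e A) H ∧ ∀ x, R x ↔ H x = k x) ∨ (∃ K, Q (insert e B) K ∧ ∀ x, R x ↔ h x = K x) := by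
  obtain ⟨a, ha⟩ := c.th.ne; obtain ⟨b, hb⟩ := c.tk.ne; have haB := c.dis a ha
  have hbA : b ∉ A := fun hh => c.dis b hh hb
  have hRv : ∀ v, MDS (A ∪ B) (fun x => R (update x e v)) := by
    intro v
    have hne : ∀ i ∈ A ∪ B, e ≠ i := by
      intro i hi h; subst h; rcases Finset.mem_union.1 hi with h | h
      exacts [heA h, heB h]
    refine ⟨?_, ?_, ?_⟩
    · intro x y hxy; apply hR.dep; intro i hi; rcases Finset.mem_insert.1 hi with rfl | hi
      · simp
      · rw [update_of_ne (hne i hi).symm, update_of_ne (hne i hi).symm, hxy i hi]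
    · intro x i hi
      obtain ⟨w, hw⟩ := hR.ex (update x e v) i (by simp [hi])
      exact ⟨w, by rw [update_comm (hne i hi).symm]; exact hw⟩
    · intro x i hi u w hu hw
      beta_reduce at hu hw
      rw [update_comm (hne i hi).symm] at hu hw
      exact hR.un _ i (by simp [hi]) _ _ hu hw
  by_cases hH : ∀ v, ∃ h1, Q A h1 ∧ ∀ x, R (update x e v) ↔ h1 x = k x
  · exact Or.inl (glue c.dis heA heB hb c.qk hR hH)
  by_cases hK : ∀ v, ∃ k1, Q B k1 ∧ ∀ x, R (update x e v) ↔ h x = k1 x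
  · right
    have hR' : MDS (insert e (B ∪ A)) R := by rwa [Finset.union_comm B A]
    obtain ⟨K, K1, K2⟩ := glue c.symm.dis heB heA ha c.qh hR' (fun v => by
      obtain ⟨k1, q, r⟩ := hK v; exact ⟨k1, q, fun x => (r x).trans eq_comm⟩)
    exact ⟨K, K1, fun x => (K2 x).trans eq_comm⟩
  exfalso
  push Not at hH hK
  obtain ⟨v1, hv1⟩ := hH; obtain ⟨v2, hv2⟩ := hK
  have n1 : v1 ≠ v0 := by
    rintro rfl; obtain ⟨x, hx⟩ := hv1 h c.qh; have := h0 x; tauto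
  have n2 : v2 ≠ v0 := by
    rintro rfl; obtain ⟨x, hx⟩ := hv2 k c.qk; have := h0 x; tauto
  have hd : ∀ v, v ≠ v0 → ∀ x, R (update x e v) → h x ≠ k x := by
    intro v hv x hx hh
    exact hv (hR.un x e (by simp) _ _ hx ((h0 x).2 hh))
  have K1 : ∃ k1, Q B k1 ∧ ∀ x, R (update x e v1) ↔ h x = k1 x := by
    rcases DJ c (hRv v1) (hd v1 n1) with ⟨h1, q, r⟩ | h
    · obtain ⟨x, hx⟩ := hv1 h1 q; have := r x; tauto
    · exact h
  have H2 : ∃ h1, Q A h1 ∧ ∀ x, R (update x e v2) ↔ h1 x = k x := by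
    rcases DJ c (hRv v2) (hd v2 n2) with h | ⟨h1, q, r⟩
    · exact h
    · obtain ⟨x, hx⟩ := hv2 h1 q; have := r x; tauto
  obtain ⟨k1, qk1, rk1⟩ := K1; obtain ⟨h2, qh2, rh2⟩ := H2
  have hv12 : v1 ≠ v2 := by
    rintro rfl; obtain ⟨x, hx⟩ := hv1 h2 qh2; have := rh2 x; tauto
  refine Vd.no (I := fun a b => ∃ x, h2 x = a ∧ h x = b) (J := fun a b => ∃ x, k x = a ∧ k1 x = b)
    (Vd.mk' qh2 c.qh ha ?_ ?_) (Vd.mk' c.qk qk1 hb ?_ ?_) ?_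
  · intro x hx; obtain ⟨w, hw⟩ := c.qk.ex x hb (h x)
    have r1 := (rh2 (update x b w)).2 (by rw [qh2.dep.upd hbA, hw, hx])
    exact hd v2 n2 _ r1 (by rw [c.qh.dep.upd hbA, hw])
  · rintro ⟨π, hπ, he⟩; have hb' : Bijective π := Finite.injective_iff_bijective.1 hπ
    let E := Equiv.ofBijective π hb'
    obtain ⟨x, hx⟩ := hv2 (fun x => E.symm (k x)) ⟨fun x y hxy => by
        show E.symm (k x) = E.symm (k y)
        rw [c.qk.dep x y hxy], fun x i hi u v e => c.qk.inj x i hi (E.symm.injective e)⟩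
    have r1 := rh2 x; have : h x = E.symm (k x) ↔ π (h x) = k x := (E.eq_symm_apply); rw [he] at r1; tauto
  · intro x hx; obtain ⟨w, hw⟩ := c.qh.ex x ha (k x)
    have r1 := (rk1 (update x a w)).2 (by rw [qk1.dep.upd haB, hw, hx])
    exact hd v1 n1 _ r1 (by rw [c.qk.dep.upd haB, hw])
  · rintro ⟨π, hπ, he⟩
    obtain ⟨x, hx⟩ := hv1 (fun x => π (h x)) ⟨fun x y hxy => by
        show π (h x) = π (h y)
        rw [c.qh.dep x y hxy], fun x i hi u v e => c.qh.inj x i hi (hπ e)⟩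
    have r1 := rk1 x; have e2 := he x; rw [e2] at hx; have : h x = k1 x ↔ π (h x) = π (k1 x) := hπ.eq_iff.symm; tauto
  · rintro p q ⟨x, hx1, hx2⟩ ⟨y, hy1, hy2⟩
    let z : P := A.piecewise x y
    have zA : ∀ i ∈ A, z i = x i := fun i hi => by simp [z, hi]
    have zB : ∀ i ∈ B, z i = y i := fun i hi => by
      have : i ∉ A := fun hh => c.dis i hh hi
      simp [z, this]
    have r1 := (rk1 z).2 (by rw [c.qh.dep z x zA, qk1.dep z y zB, hx2, hy2])
    have r2 := (rh2 z).2 (by rw [qh2.dep z x zA, c.qk.dep z y zB, hx1, hy1])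
    exact hv12 (hR.un z e (by simp) _ _ r1 r2)
end
def Lin (π : Qd → Qd) : Prop := ∀ p a b, (chi p (π a) ^^ chi p (π b)) = (chi p a ^^ chi p b)
theorem Lin.inj {π : Qd → Qd} (h : Lin π) : Injective π := by
  intro a b e; have h0 := h 0 a b; have h1 := h 1 a b; rw [e] at h0 h1
  refine chi_sep 0 1 a b (by decide) ?_ ?_
  · simpa using h0.symm
  · simpa using h1.symm
theorem Lin.inv {π : Qd → Qd} (h : Lin π) : ∃ ρ, Lin ρ ∧ ∀ a b, π a = b ↔ a = ρ b := by
  have hb : Bijective π := Finite.injective_iff_bijective.1 h.inj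
  let E := Equiv.ofBijective π hb
  refine ⟨E.symm, ?_, fun a b => (E.eq_symm_apply).symm⟩
  intro p a b; have := h p (E.symm a) (E.symm b); have e : ∀ a, π (E.symm a) = a := E.apply_symm_apply; rw [e, e] at this; exact this.symm
theorem Lin.id : Lin (fun a => a) := fun _ _ _ => rfl
theorem Lin.comp {π ρ : Qd → Qd} (h : Lin π) (h' : Lin ρ) : Lin (fun a => π (ρ a)) :=
  fun p a b => by rw [h, h']
theorem SepC.of_cc {p : Td} {h g : Pf} {i j : ℕ} (hg : ∀ x y, (cc p g x ^^ cc p g y) = (cc p h x ^^ cc p h y)) : SepC (cc p h) i j → SepC (cc p g) i j := by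
  intro hs x u v; rw [← hs x u v]; unfold odd; rw [hg, hg]
theorem Top.lin {s : Td} {h : Pf} {A : Sn} (ht : Top s h A) {π : Qd → Qd} (hl : Lin π) : Top s (fun x => π (h x)) A := by
  have e : ∀ p x y, (cc p (fun x => π (h x)) x ^^ cc p (fun x => π (h x)) y) = (cc p h x ^^ cc p h y) := fun p x y => hl p _ _
  refine ⟨fun hc => ht.1 ?_, fun p hp => ?_⟩
  · exact hc.mono fun i _ j _ _ hs => SepC.of_cc (e s) hs
  · exact (ht.2 p hp).mono fun i _ j _ _ hs => SepC.of_cc (fun x y => (e p x y).symm) hs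
theorem Q.post {A : Sn} {h : Pf} (hq : Q A h) {π : Qd → Qd} (hl : Injective π) : Q A (fun x => π (h x)) :=
  ⟨fun x y hxy => congrArg π (hq.dep x y hxy), fun x i hi u v e => hq.inj x i hi (hl e)⟩
theorem Q.mds {A : Sn} {f : Pf} (hq : Q A f) {o : ℕ} (ho : o ∉ A) : MDS (insert o A) (fun x => f x = x o) where
  dep := fun x y hxy => by
    beta_reduce
    rw [hq.dep x y (fun i hi => hxy i (by simp [hi])), hxy o (by simp)]
  ex := fun x i hi => by
    rcases Finset.mem_insert.1 hi with rfl | hi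
    · exact ⟨f x, by rw [hq.dep.upd ho, update_self]⟩
    · obtain ⟨v, hv⟩ := hq.ex x hi (x o)
      have : o ≠ i := fun e => ho (e ▸ hi)
      exact ⟨v, by rw [hv, update_of_ne this]⟩
  un := fun x i hi u v hu hv => by
    rcases Finset.mem_insert.1 hi with rfl | hi
    · rw [hq.dep.upd ho, update_self] at hu hv; rw [← hu, ← hv]
    · have : o ≠ i := fun e => ho (e ▸ hi)
      rw [update_of_ne this] at hu hv; exact hq.eq x hi (hu.trans hv.symm)
theorem Q.sqc {A : Sn} {h : Pf} (hq : Q A h) {e : ℕ} (he : e ∉ A) {w : Sq} (hw : LS w) : Q (insert e A) (fun x => w (h x) (x e)) where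
  dep := fun x y hxy => by
    beta_reduce
    rw [hq.dep x y (fun i hi => hxy i (by simp [hi])), hxy e (by simp)]
  inj := fun x i hi u v huv => by
    beta_reduce at huv
    rcases Finset.mem_insert.1 hi with rfl | hi
    · rw [hq.dep.upd he, hq.dep.upd he, update_self, update_self] at huv; exact hw.r _ huv
    · have : e ≠ i := fun e' => he (e' ▸ hi)
      rw [update_of_ne this, update_of_ne this] at huv; exact hq.inj x i hi (hw.c _ huv)
theorem sqc_sep {A : Sn} {h : Pf} (hq : Q A h) {e : ℕ} (he : e ∉ A) {w : Sq} {i : ℕ} (hi : i ∈ A) (p : Td) : SepC (cc p (fun x => w (h x) (x e))) i e ↔ Sp p w := by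
  have hie : i ≠ e := fun e' => he (e' ▸ hi)
  have key : ∀ x u v, odd (cc p (fun x => w (h x) (x e))) x i u e v = ((chi p (w (h x) (x e)) ^^ chi p (w (h (update x i u)) (x e))) ^^
       (chi p (w (h x) v) ^^ chi p (w (h (update x i u)) v))) := by
    intro x u v; unfold odd cc; simp only [hq.dep.upd he, update_self, update_of_ne hie.symm]
  constructor
  · intro hs a a' b b'
    obtain ⟨u, hu⟩ := hq.ex (fun _ => b) hi a
    obtain ⟨u', hu'⟩ := hq.ex (fun _ => b) hi a'
    have := hs (update (fun _ => b) i u) u' b'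
    rw [key, update_idem, hu, hu', update_of_ne hie.symm] at this; exact this
  · intro hs x u v; rw [key]; exact hs _ _ _ _
theorem sqc_top {A : Sn} {h : Pf} (hq : Q A h) (hA : A.Nonempty) {e : ℕ} (he : e ∉ A) {w : Sq} {t : Td} (ht : Sp t w) (hn : ∀ p, p ≠ t → ¬ Sp p w) : Top t (fun x => w (h x) (x e)) (insert e A) := by
  constructor
  · intro hc; obtain ⟨a, ha⟩ := hA
    obtain ⟨i, hi, j, hj, hn⟩ := hc A (by simp) ⟨a, ha⟩ (fun hh => he (by rw [hh]; simp))
    have : j = e := by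
      simp at hj; tauto
    subst this; exact hn ((sqc_sep hq he hi t).2 ht)
  · intro p hp X hX hne hXA
    by_cases heX : e ∈ X
    · obtain ⟨j, hj, hjX⟩ := Finset.exists_of_ssubset (Finset.ssubset_iff_subset_ne.2 ⟨hX, hXA⟩)
      have hjA : j ∈ A := by
        rcases Finset.mem_insert.1 hj with rfl | h
        · exact absurd heX hjX
        · exact h
      exact ⟨e, heX, j, by simp [hjA, hjX], fun hs => hn p hp ((sqc_sep hq he hjA p).1 hs.symm)⟩
    · obtain ⟨i, hi⟩ := hne
      have hiA : i ∈ A := by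
        rcases Finset.mem_insert.1 (hX hi) with rfl | h
        · exact absurd hi heX
        · exact h
      exact ⟨i, hi, e, by simp [heX], fun hs => hn p hp ((sqc_sep hq he hiA p).1 hs)⟩
theorem ls_type {w : Sq} (hw : LS w) : (∀ p, Sp p w) ∨ ∃ t, Sp t w ∧ ∀ p, p ≠ t → ¬ Sp p w := by
  obtain ⟨t, ht⟩ := L2 hw
  by_cases h : ∃ p, p ≠ t ∧ Sp p w
  · obtain ⟨p, hp, hs⟩ := h; exact Or.inl (Sp.third hp hs ht)
  · push Not at h
    exact Or.inr ⟨t, ht, h⟩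
theorem LS.inv1 {w : Sq} (hw : LS w) : ∃ w' : Sq, LS w' ∧ ∀ a b v, w a v = b ↔ a = w' b v := by
  have hb : ∀ v, Bijective (fun a => w a v) := fun v => Finite.injective_iff_bijective.1 (hw.c v)
  choose w' hw' using fun b v => (hb v).2 b
  beta_reduce at hw'
  refine ⟨w', ⟨?_, ?_⟩, ?_⟩
  · intro a u v e; have h1 := hw' a u; have h2 := hw' a v; rw [← e] at h2; exact hw.r _ (h1.trans h2.symm)
  · intro v a b e
    beta_reduce at e
    rw [← hw' a v, ← hw' b v, e]
  · intro a b v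
    constructor
    · intro e; apply hw.c v; beta_reduce; rw [hw', e]
    · rintro rfl; exact hw' _ _
theorem Sp.inv1 {w w' : Sq} (he : ∀ a b v, w a v = b ↔ a = w' b v) {v0 : Qd} (h0 : ∀ a, w a v0 = a) {p : Td} (hs : Sp p w) : Sp p w' := by
  have e1 : ∀ b v, w (w' b v) v = b := fun b v => (he _ _ _).2 rfl
  have key : ∀ b b' v, (chi p (w' b v) ^^ chi p (w' b' v)) = (chi p b ^^ chi p b') := by
    intro b b' v; have := hs (w' b v) (w' b' v) v v0; rw [e1, e1, h0, h0] at this; revert this; generalize chi p (w' b v) = p1; generalize chi p (w' b' v) = p2; generalize chi p b = p3; generalize chi p b' = p4; revert p1 p2 p3 p4; decide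
  intro a a' b b'; rw [key, key]; simp
structure CFG (C : Sn) (R : P → Prop) (A B : Sn) (s s' : Td) (h k : Pf) (z : P) : Prop where
  sA : A ⊆ C
  sB : B ⊆ C
  cf : Cf A B s s' h k
  rep : ∀ x, R ((A ∪ B).piecewise x z) ↔ h x = k x
def Big (C : Sn) (R : P → Prop) (m : ℕ) : Prop :=
  ∃ A B s s' h k z, CFG C R A B s s' h k z ∧ A.card + B.card = m
theorem CFG.symm {C : Sn} {R : P → Prop} {A B : Sn} {s s' : Td} {h k : Pf} {z : P} (c : CFG C R A B s s' h k z) : CFG C R B A s' s k h z :=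
  ⟨c.sB, c.sA, c.cf.symm, fun x => by rw [Finset.union_comm B A, c.rep]; exact eq_comm⟩
def TT (N : ℕ) : Prop := ∀ (A : Sn) (g : Pf), Q A g → 2 ≤ A.card → A.card < N → ∃ p, ¬ ConnC (cc p g) A
theorem CFG.card {C : Sn} {R : P → Prop} {A B : Sn} {s s' : Td} {h k : Pf} {z : P} (c : CFG C R A B s s' h k z) {e : ℕ} (heC : e ∈ C) (heA : e ∉ A) (heB : e ∉ B) : A.card + B.card + 1 ≤ C.card := by
  have hd : Disjoint A B := Finset.disjoint_left.2 c.cf.dis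
  rw [← card_union_of_disjoint hd, ← card_insert_of_notMem (a := e) (by simp [heA, heB])]
  apply card_le_card; intro i hi; rcases Finset.mem_insert.1 hi with rfl | hi
  · exact heC
  · rcases Finset.mem_union.1 hi with h | h
    exacts [c.sA h, c.sB h]
theorem stepH {C : Sn} {R : P → Prop} {A B : Sn} {s s' : Td} {h k : Pf} {z : P} {N : ℕ} (hT : TT N) (hC : C.card ≤ N + 1) (c : CFG C R A B s s' h k z) {e : ℕ} (heC : e ∈ C) (heA : e ∉ A) (heB : e ∉ B) {H : Pf} (hH : Q (insert e A) H) (hr : ∀ x, R ((insert e (A ∪ B)).piecewise x z) ↔ H x = k x) : Big C R (A.card + B.card + 1) ∨ ∀ v, ∃ π, Lin π ∧ ∀ x, R ((A ∪ B).piecewise x (update z e v)) ↔ π (h x) = k x := by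
  classical
  obtain ⟨a, ha⟩ := c.cf.th.ne; obtain ⟨b, hb⟩ := c.cf.tk.ne
  have hbA : b ∉ A := fun hh => c.cf.dis b hh hb
  have hbe : b ≠ e := fun h => heB (h ▸ hb)
  have qh := c.cf.qh; have qk := c.cf.qk; have cA : (insert e A).card = A.card + 1 := card_insert_of_notMem heA; have cB : (insert e B).card = B.card + 1 := card_insert_of_notMem heB; have hb2 := c.cf.tk.two; have ha2 := c.cf.th.two; have hcard := c.card heC heA heB
  have he' : e ∉ A ∪ B := by simp [heA, heB]
  have pwe : ∀ x v, (insert e (A ∪ B)).piecewise (update x e v) z = (A ∪ B).piecewise x (update z e v) := by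
    intro x v
    rw [pw_upd_out he', pw_upd_in (by simp)]
    funext l
    by_cases hl : l = e
    · subst hl; simp
    · rw [update_of_ne hl, update_of_ne hl]
      by_cases hl' : l ∈ A ∪ B
      · rw [piecewise_eq_of_mem _ _ _ hl', piecewise_eq_of_mem _ _ _ (by simp only [mem_insert]; right; exact hl')]
      · rw [piecewise_eq_of_notMem _ _ _ hl', piecewise_eq_of_notMem _ _ _ (by simp only [mem_insert]; tauto)]
  have h0 : ∀ x, H (update x e (z e)) = h x := by
    intro x; obtain ⟨v, hv⟩ := qk.ex x hb (h x)
    have r1 := (c.rep (update x b v)).2 (by rw [hv, qh.dep.upd hbA])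
    have r2 : R ((insert e (A ∪ B)).piecewise (update (update x b v) e (z e)) z) := by
      rw [pwe, update_eq_self]; exact r1
    have r3 := (hr _).1 r2
    rw [qk.dep.upd heB, hv, update_comm hbe, hH.dep.upd (by simp [hbA, hbe])] at r3
    exact r3
  have un : ∀ x : P, (insert e A) ∪ B = insert e (A ∪ B) := fun x => by rw [Finset.insert_union]
  have un' : ∀ x : P, A ∪ (insert e B) = insert e (A ∪ B) := fun x => by rw [Finset.union_insert]
  have sA' : insert e A ⊆ C := Finset.insert_subset heC c.sA; have sB' : insert e B ⊆ C := Finset.insert_subset heC c.sB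
  by_cases hred : Red A H
  swap
  · left
    have hconn : ∀ p, p ≠ s → ConnC (cc p H) (insert e A) := by
      intro p hp X hX hne hXA; by_contra hcon
      push Not at hcon
      have hsh : ∀ i ∈ A, ∀ j ∈ A, SepC (cc p H) i j → SepC (cc p h) i j := by
        intro i hi j hj hs x u v
        have hie : i ≠ e := fun h => heA (h ▸ hi)
        have hje : j ≠ e := fun h => heA (h ▸ hj)
        have := hs (update x e (z e)) u v; unfold odd cc at this; rw [update_comm hie.symm, update_comm hje.symm, update_comm hje.symm] at this; rw [h0, h0, h0, h0] at this; exact this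
      have hAc := c.cf.th.2 p hp
      have hcases : A ∩ X = ∅ ∨ A ∩ X = A := by
        by_contra hcc
        push Not at hcc
        obtain ⟨i, hi, j, hj, hn⟩ := hAc (A ∩ X) Finset.inter_subset_left hcc.1 hcc.2; simp at hi hj
        exact hn (hsh i hi.1 j hj.1 (hcon i hi.2 j (by simp [hj.1, hj.2])))
      have hsep : ∀ i ∈ A, ∀ j ∈ (insert e A) \ A, SepC (cc p H) i j := by
        intro i hi j hj
        have hje : j = e := by simp at hj; tauto
        subst hje; rcases hcases with h1 | h1
        · have : X = {j} := by
            apply Finset.eq_singleton_iff_nonempty_unique_mem.2 ⟨hne, fun l hl => ?_⟩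
            rcases Finset.mem_insert.1 (hX hl) with h | h
            · exact h
            · have : l ∈ A ∩ X := by simp [h, hl]
              rw [h1] at this; simp at this
          subst this
          have hij : i ≠ j := fun h => heA (h ▸ hi)
          exact (hcon j (by simp) i (by simp [hi, hij])).symm
        · have hAX : A ⊆ X := Finset.inter_eq_left.1 h1
          have : j ∉ X := fun hh => hXA (Finset.Subset.antisymm hX (Finset.insert_subset hh hAX))
          exact hcon i (hAX hi) j (by simp [this])
      apply hred; refine D2 hH (Finset.subset_insert _ _) p hsep ?_
      exact hAc.mono fun i hi j hj _ hs => hsh i hi j hj hs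
    have htop : Top s H (insert e A) := by
      refine ⟨?_, hconn⟩
      obtain ⟨p, hp⟩ := hT _ H hH (by omega) (by omega)
      by_cases hps : p = s
      · rwa [← hps]
      · exact absurd (hconn p hps) hp
    refine ⟨insert e A, B, s, s', H, k, z, ⟨sA', c.sB, ⟨?_, c.cf.ne, hH, htop, qk, c.cf.tk⟩, fun x => ?_⟩, by omega⟩
    · intro i hi; rcases Finset.mem_insert.1 hi with rfl | hi
      · exact heB
      · exact c.cf.dis i hi
    · rw [un x]; exact hr x
  have hw : ∃ w : Sq, LS w ∧ ∀ x, H x = w (h x) (x e) := by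
    choose g hg using fun y => qh.ex (fun _ => 0) ha y
    let al : Qd → P := fun u => update (fun _ => 0) a (g u)
    have hal : ∀ u, h (al u) = u := hg
    have hpw : ∀ x : P, ∀ v, H (A.piecewise x (fun _ => v)) = H (update x e v) := by
      intro x v; apply hH.dep; intro i hi; rcases Finset.mem_insert.1 hi with rfl | hi
      · simp [heA]
      · have : i ≠ e := fun h => heA (h ▸ hi)
        simp [hi, this]
    have rr : ∀ x y v v', H (update x e v) = H (update y e v) → H (update x e v') = H (update y e v') := by
      intro x y v v' hxy; rw [← hpw, ← hpw] at hxy ⊢; exact hred x y _ _ hxy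
    have rep : ∀ x, H x = H (update (al (h x)) e (x e)) := by
      intro x
      have := rr x (al (h x)) (z e) (x e) (by rw [h0, h0, hal])
      rwa [update_eq_self] at this
    refine ⟨fun u v => H (update (al u) e v), ⟨fun u => hH.inj _ e (by simp), ?_⟩, rep⟩
    intro v u u' huu; have := rr _ _ v (z e) huu
    rwa [h0, h0, hal, hal] at this
  obtain ⟨w, lw, hw⟩ := hw
  have hwe : H = fun x => w (h x) (x e) := funext hw
  have w0 : ∀ u, w u (z e) = u := by
    intro u
    obtain ⟨v, hv⟩ := qh.ex (fun _ => 0) ha u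
    have := h0 (update (fun _ => 0) a v)
    rw [hw, qh.dep.upd heA, update_self, hv] at this; exact this
  rcases ls_type lw with hl | ⟨t, ht, hnt⟩
  · right
    intro v
    refine ⟨fun u => w u v, ?_, ?_⟩
    · intro p a b; have := hl p a b v (z e); rw [w0, w0] at this; revert this; generalize chi p (w a v) = p1; generalize chi p (w b v) = p2; generalize chi p a = p3; generalize chi p b = p4; revert p1 p2 p3 p4; decide
    · intro x; rw [← pwe, hr, hw, qk.dep.upd heB, qh.dep.upd heA, update_self]
  · left
    by_cases hts : t = s'
    · have hts' : s ≠ t := fun h => c.cf.ne (h.trans hts)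
      obtain ⟨w', lw', hw'⟩ := lw.inv1
      have w0' : ∀ u, w' u (z e) = u := fun u => ((hw' u u (z e)).1 (w0 u)).symm
      have hw'' : ∀ a b v, w' a v = b ↔ a = w b v := fun a b v => by
        rw [eq_comm, ← hw', eq_comm]
      refine ⟨A, insert e B, s, t, h, fun x => w' (k x) (x e), z, ⟨c.sA, sB', ⟨?_, hts', qh, c.cf.th, qk.sqc heB lw', ?_⟩, ?_⟩, by omega⟩
      · intro i hi hi'; rcases Finset.mem_insert.1 hi' with rfl | h
        · exact heA hi
        · exact c.cf.dis i hi h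
      · exact sqc_top qk ⟨b, hb⟩ heB (ht.inv1 hw' w0) (fun p hp hs => hnt p hp (hs.inv1 hw'' w0'))
      · intro x; rw [un' x, hr, hw]; exact hw' _ _ _
    · refine ⟨insert e A, B, t, s', H, k, z, ⟨sA', c.sB, ⟨?_, hts, hH, ?_, qk, c.cf.tk⟩, fun x => ?_⟩, by omega⟩
      · intro i hi; rcases Finset.mem_insert.1 hi with rfl | hi
        · exact heB
        · exact c.cf.dis i hi
      · rw [hwe]; exact sqc_top qh ⟨a, ha⟩ heA ht hnt
      · rw [un x]; exact hr x
theorem step {C : Sn} {R : P → Prop} {A B : Sn} {s s' : Td} {h k : Pf} {z : P} {N : ℕ} (hT : TT N) (hC : C.card ≤ N + 1) (hR : MDS C R) (c : CFG C R A B s s' h k z) {e : ℕ} (heC : e ∈ C) (heA : e ∉ A) (heB : e ∉ B) : Big C R (A.card + B.card + 1) ∨ ∀ v, ∃ π, Lin π ∧ ∀ x, R ((A ∪ B).piecewise x (update z e v)) ↔ π (h x) = k x := by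
  classical
  have hsub : insert e (A ∪ B) ⊆ C := Finset.insert_subset heC (union_subset c.sA c.sB); have hR' := hR.frz hsub z
  have he' : e ∉ A ∪ B := by simp [heA, heB]
  rcases M c.cf heA heB hR' (z e) (fun x => by
    rw [← c.rep]
    have : (insert e (A ∪ B)).piecewise (update x e (z e)) z = (A ∪ B).piecewise x z := by
      funext l
      by_cases hl : l = e
      · subst hl; simp [heA, heB]
      · by_cases hl' : l ∈ A ∪ B
        · rw [piecewise_eq_of_mem _ _ _ hl', piecewise_eq_of_mem _ _ _ (by simp only [mem_insert]; right; exact hl'), update_of_ne hl]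
        · rw [piecewise_eq_of_notMem _ _ _ hl', piecewise_eq_of_notMem _ _ _ (by simp only [mem_insert]; tauto)]
    rw [this]) with ⟨H, qH, rH⟩ | ⟨K, qK, rK⟩
  · exact stepH hT hC c heC heA heB qH rH
  · rcases stepH hT hC c.symm heC heB heA qK (fun x => by rw [Finset.union_comm B A, rK]; exact eq_comm) with h | h
    · left; rwa [Nat.add_comm A.card]
    · right
      intro v; obtain ⟨π, lp, hp⟩ := h v; obtain ⟨ρ, lr, hrho⟩ := lp.inv
      refine ⟨ρ, lr, fun x => ?_⟩
      rw [Finset.union_comm A B, hp, hrho]; exact eq_comm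
theorem CFG.glob {C : Sn} {R : P → Prop} {A B : Sn} {s s' : Td} {h k : Pf} {z : P} {N : ℕ} (hT : TT N) (hC : C.card ≤ N + 1) (hR : MDS C R) (c : CFG C R A B s s' h k z) (hmax : ¬ Big C R (A.card + B.card + 1)) : ∀ z', ∃ π, Lin π ∧ ∀ x, R ((A ∪ B).piecewise x z') ↔ π (h x) = k x := by
  classical
  have hs : ∀ y : P, ∀ e ∈ C \ (A ∪ B), ∀ v, (∃ π, Lin π ∧ ∀ x, R ((A ∪ B).piecewise x y) ↔ π (h x) = k x) →
      (∃ π, Lin π ∧ ∀ x, R ((A ∪ B).piecewise x (update y e v)) ↔ π (h x) = k x) := by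
    rintro y e he v ⟨π, lp, hp⟩; simp only [mem_sdiff, mem_union, not_or] at he
    have c' : CFG C R A B s s' (fun x => π (h x)) k y := ⟨c.sA, c.sB, ⟨c.cf.dis, c.cf.ne, c.cf.qh.post lp.inj, c.cf.th.lin lp, c.cf.qk, c.cf.tk⟩, hp⟩
    obtain ⟨ρ, lr, hr⟩ := (step hT hC hR c' he.1 he.2.1 he.2.2).resolve_left hmax v; exact ⟨_, lr.comp lp, hr⟩
  intro z'
  obtain ⟨π, lp, hp⟩ := walk (C \ (A ∪ B)) _ hs z ((C \ (A ∪ B)).piecewise z' z) (fun i hi => by simp only [hi, piecewise_eq_of_notMem, not_false_eq_true])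
    ⟨_, Lin.id, c.rep⟩
  refine ⟨π, lp, fun x => ?_⟩
  rw [← hp]; apply iff_of_eq; apply hR.dep; intro i hi
  by_cases hi' : i ∈ A ∪ B
  · rw [piecewise_eq_of_mem _ _ _ hi', piecewise_eq_of_mem _ _ _ hi']
  · rw [piecewise_eq_of_notMem _ _ _ hi', piecewise_eq_of_notMem _ _ _ hi', piecewise_eq_of_mem _ _ _ (by rw [mem_sdiff]; exact ⟨hi, hi'⟩)]
theorem good_of_red {D X : Sn} {f : Pf} (hf : Q D f) (hT : TT D.card) (hX : X ⊆ D) (h2 : 2 ≤ X.card) (hlt : X.card < D.card) (hr : Red X f) : ∃ p, ¬ ConnC (cc p f) D := by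
  classical
  obtain ⟨i, hi⟩ := Finset.card_pos.1 (show 0 < X.card by omega)
  have hsub : X.erase i ⊆ D := (Finset.erase_subset _ _).trans hX
  have hc : (D \ X.erase i).card = D.card - (X.card - 1) := by
    rw [Finset.card_sdiff_of_subset hsub, Finset.card_erase_of_mem hi]
  obtain ⟨p, hp⟩ := hT _ _ (hf.frz (sdiff_subset (s := D) (t := X.erase i)) (fun _ => 0)) (by omega) (by omega)
  exact ⟨p, fun hc => hp (RC hf hX hi hr _ p hc)⟩
theorem red_of_glob {D A B : Sn} {o : ℕ} (ho : o ∉ D) {f : Pf} (hf : Q D f) {h k : Pf} (hAB : ∀ i ∈ A, i ∉ B) (hoA : o ∉ A) (qh : Q A h) (qk : Q B k) (hg : ∀ z' : P, ∃ π, Lin π ∧ ∀ x : P, f ((A ∪ B).piecewise x z') = (A ∪ B).piecewise x z' o ↔ π (h x) = k x) : Red A f := by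
  classical
  have key : ∀ (w : P) (c : Qd), ∃ π, Lin π ∧ ∀ x, f (A.piecewise x w) = c ↔ π (h x) = k (update w o c) := by
    intro w c; obtain ⟨π, lp, hp⟩ := hg (update w o c)
    refine ⟨π, lp, fun x => ?_⟩
    have := hp (A.piecewise x (update w o c))
    have e : (A ∪ B).piecewise (A.piecewise x (update w o c)) (update w o c) = update (A.piecewise x w) o c := by
      rw [pw_upd_out hoA]; funext l
      by_cases hl : l ∈ A
      · have hlo : l ≠ o := fun h => hoA (h ▸ hl)
        rw [piecewise_eq_of_mem _ _ _ (by simp [hl])]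
      · by_cases hlB : l ∈ B
        · rw [piecewise_eq_of_mem _ _ _ (by simp [hlB])]
        · rw [piecewise_eq_of_notMem _ _ _ (by simp [hlB, hl])]
          by_cases hlo : l = o
          · subst hlo; simp
          · rw [update_of_ne hlo, update_of_ne hlo, piecewise_eq_of_notMem _ _ _ hl]
    rw [e, hf.dep.upd ho, update_self] at this; rw [this]
    rw [qh.dep (A.piecewise x (update w o c)) x (fun i hi => by simp [hi]),
      qk.dep (A.piecewise x (update w o c)) (update w o c) (fun i hi => by
        have : i ∉ A := fun hh => hAB i hh hi
        rw [piecewise_eq_of_notMem _ _ _ this])]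
  intro x y w w' hxy; obtain ⟨π, lp, hp⟩ := key w (f (A.piecewise x w)); obtain ⟨ρ, lr, hr⟩ := key w' (f (A.piecewise x w')); have e : h x = h y := lp.inj (((hp x).1 rfl).trans ((hp y).1 hxy.symm).symm); have := (hr x).1 rfl; rw [e] at this; exact ((hr y).2 this).symm
theorem MC {D : Sn} {f : Pf} (hf : Q D f) (hT : TT D.card) {o : ℕ} (ho : o ∉ D) {m : ℕ} (hb : Big (insert o D) (fun x => f x = x o) m) : ∃ p, ¬ ConnC (cc p f) D := by
  classical
  have hR := hf.mds ho; have hC : (insert o D).card = D.card + 1 := card_insert_of_notMem ho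
  have key : ∀ d m, d + m = D.card + 2 → Big (insert o D) (fun x => f x = x o) m → ∃ p, ¬ ConnC (cc p f) D := by
    intro d
    induction d with
    | zero =>
      rintro m hm ⟨A, B, s, s', h, k, z, c, e⟩; have hd : Disjoint A B := Finset.disjoint_left.2 c.cf.dis; have := card_le_card (union_subset c.sA c.sB); rw [card_union_of_disjoint hd] at this; omega
    | succ d ih =>
      rintro m hm ⟨A, B, s, s', h, k, z, c, e⟩
      by_cases hmax : Big (insert o D) (fun x => f x = x o) (A.card + B.card + 1)
      · exact ih _ (by omega) hmax
      have hg := c.glob hT hC.le hR hmax; have hd : Disjoint A B := Finset.disjoint_left.2 c.cf.dis; have hu := card_le_card (union_subset c.sA c.sB); rw [card_union_of_disjoint hd] at hu; have hA2 := c.cf.th.two; have hB2 := c.cf.tk.two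
      have sub : ∀ X : Sn, X ⊆ insert o D → o ∉ X → X ⊆ D := fun X hX hoX i hi => by
        rcases Finset.mem_insert.1 (hX hi) with rfl | h
        · exact absurd hi hoX
        · exact h
      by_cases hoA : o ∈ A
      · have hoB := c.cf.dis o hoA
        refine good_of_red hf hT (sub B c.sB hoB) hB2 (by omega) ?_
        refine red_of_glob ho hf c.symm.cf.dis hoB c.cf.qk c.cf.qh (fun z' => ?_)
        obtain ⟨π, lp, hp⟩ := hg z'; obtain ⟨ρ, lr, hr⟩ := lp.inv
        refine ⟨ρ, lr, fun x => ?_⟩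
        have := hp x; rw [Finset.union_comm B A]; rw [this, hr]; exact eq_comm
      · exact good_of_red hf hT (sub A c.sA hoA) hA2 (by omega) (red_of_glob ho hf c.cf.dis hoA c.cf.qh c.cf.qk hg)
  by_cases hm : m ≤ D.card + 2
  · exact key (D.card + 2 - m) m (by omega) hb
  · obtain ⟨A, B, s, s', h, k, z, c, e⟩ := hb; have hd : Disjoint A B := Finset.disjoint_left.2 c.cf.dis; have := card_le_card (union_subset c.sA c.sB); rw [card_union_of_disjoint hd] at this; omega
set_option synthInstance.maxHeartbeats 400000 in
set_option synthInstance.maxSize 1000 in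
theorem chi_perm : ∀ τ : Qd → Qd, Injective τ → ∀ p, ∃ q, ∀ a b, (chi p (τ a) ^^ chi p (τ b)) = (chi q a ^^ chi q b) := by
  have key : ∀ t0 t1 t2 t3 : Qd, t0 ≠ t1 → t0 ≠ t2 → t0 ≠ t3 → t1 ≠ t2 → t1 ≠ t3 → t2 ≠ t3 →
    ∀ p, ∃ q, ∀ a b : Qd, (chi p (![t0, t1, t2, t3] a) ^^ chi p (![t0, t1, t2, t3] b)) = (chi q a ^^ chi q b) := by decide +kernel
  intro τ hτ p
  have e : τ = ![τ 0, τ 1, τ 2, τ 3] := by funext i; fin_cases i <;> rfl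
  have := key (τ 0) (τ 1) (τ 2) (τ 3) (hτ.ne (by decide)) (hτ.ne (by decide)) (hτ.ne (by decide)) (hτ.ne (by decide))
    (hτ.ne (by decide)) (hτ.ne (by decide)) p
  rw [← e] at this; exact this
def SL (p : Td) (g : Pf) (D : Sn) : Prop := ∀ i ∈ D, ∀ j ∈ D, i ≠ j → SepC (cc p g) i j
def NS (g : Pf) (D : Sn) : Prop := ∀ p, ¬ SL p g D
theorem SL.of_cc {p q : Td} {h g : Pf} {D : Sn} (hg : ∀ x y, (cc p g x ^^ cc p g y) = (cc q h x ^^ cc q h y)) (hs : SL q h D) : SL p g D := by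
  intro i hi j hj hij x u v; rw [← hs i hi j hj hij x u v]; unfold odd; rw [hg, hg]
theorem NS.post {h : Pf} {D : Sn} (hn : NS h D) {τ : Qd → Qd} (hτ : Injective τ) : NS (fun x => τ (h x)) D := by
  intro p hp; obtain ⟨q, hq⟩ := chi_perm τ hτ p
  exact hn q (hp.of_cc fun x y => (hq _ _).symm)
theorem Big.lift {C C' : Sn} {R : P → Prop} (hC : C' ⊆ C) (z0 : P) {m : ℕ} (hb : Big C' (fun x => R (C'.piecewise x z0)) m) : Big C R m := by
  classical
  obtain ⟨A, B, s, s', h, k, z, c, e⟩ := hb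
  refine ⟨A, B, s, s', h, k, C'.piecewise z z0, ⟨c.sA.trans hC, c.sB.trans hC, c.cf, fun x => ?_⟩, e⟩
  rw [← c.rep]; have hsub := union_subset c.sA c.sB
  have : (A ∪ B).piecewise x (C'.piecewise z z0) = C'.piecewise ((A ∪ B).piecewise x z) z0 := by
    funext l
    by_cases hl : l ∈ A ∪ B
    · rw [piecewise_eq_of_mem _ _ _ hl, piecewise_eq_of_mem _ _ _ (hsub hl), piecewise_eq_of_mem _ _ _ hl]
    · rw [piecewise_eq_of_notMem _ _ _ hl]
      by_cases hl' : l ∈ C'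
      · rw [piecewise_eq_of_mem _ _ _ hl', piecewise_eq_of_mem _ _ _ hl', piecewise_eq_of_notMem _ _ _ hl]
      · rw [piecewise_eq_of_notMem _ _ _ hl', piecewise_eq_of_notMem _ _ _ hl']
  rw [this]
theorem Big.congr {C : Sn} {R R' : P → Prop} (h : ∀ x, R x ↔ R' x) {m : ℕ} (hb : Big C R m) : Big C R' m := by
  have : R = R' := funext fun x => propext (h x)
  rwa [← this]
theorem cube {X : Sn} {h : Pf} (hq : Q X h) {p q : Td} (hp : SL p h X) (hpq : ¬ SL q h X) : ∃ i ∈ X, ∃ j ∈ X, i ≠ j ∧ ∃ x : P, Q {i, j} (fun y => h (({i, j} : Sn).piecewise y x)) ∧ Top p (fun y => h (({i, j} : Sn).piecewise y x)) {i, j} := by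
  classical
  unfold SL SepC at hpq
  push Not at hpq
  obtain ⟨i, hi, j, hj, hij, x, u, v, hn⟩ := hpq
  have hsub : ({i, j} : Sn) ⊆ X := by
    intro l hl; simp at hl; rcases hl with rfl | rfl <;> assumption
  have hii : i ∈ ({i, j} : Sn) := by simp
  have hjj : j ∈ ({i, j} : Sn) := by simp
  refine ⟨i, hi, j, hj, hij, x, hq.frz hsub x, ?_⟩; have hL := hq.ls hi hj hij x
  have s1 : Sp p (sqf h i j x) := (plsep_iff hij).1 fun y _ u v => hp i hi j hj hij y u v
  have s2 : ¬ Sp q (sqf h i j x) := fun hs => hn ((plsep_iff hij).2 hs x Ag.rfl' u v)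
  have s3 : ∀ r, r ≠ p → ¬ Sp r (sqf h i j x) := fun r hr hs => s2 (Sp.third hr hs s1 q)
  constructor
  · intro hc
    obtain ⟨a, ha, b, hb, hn⟩ := hc {i} (by simp) (by simp) (fun e => by
      have := congrArg Finset.card e; rw [Finset.card_pair hij] at this; simp at this)
    simp at ha hb
    obtain rfl : b = j := by tauto
    subst ha; exact hn (SepC.frz hii hjj x (hp a hi b hj hij))
  · intro r hr Y hY hne hYA
    have ns : ¬ SepC (cc r (fun y => h (({i, j} : Sn).piecewise y x))) i j := by
      intro hs; apply s3 r hr; rw [← plsep_iff hij]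
      have := (pl_frz (h := h) hii hjj x x (p := r)).1 (fun y _ u v => hs y u v)
      rwa [pw_self] at this
    by_cases hiY : i ∈ Y
    · have : j ∉ Y := fun hjY => hYA (Finset.Subset.antisymm hY (by intro l hl; simp at hl; rcases hl with rfl | rfl <;> assumption))
      exact ⟨i, hiY, j, by simp [this], ns⟩
    · obtain ⟨l, hl⟩ := hne; have := hY hl; simp at this; rcases this with rfl | rfl
      · exact absurd hl hiY
      · exact ⟨l, hl, i, by simp [hiY], fun hs => ns hs.symm⟩
theorem restr {X B : Sn} {h K : Pf} (hXB : ∀ i ∈ X, i ∉ B) (qK : Q B K) {b : ℕ} (hb : b ∈ B) (qh : Q X h) {R : P → Prop} (hR : ∀ x, R x ↔ h x = K x) (hns : NS h X) (ih : ∀ g, Q X g → NS g X → ∃ m, Big (insert b X) (fun x => g x = x b) m) {C : Sn} (hX : X ⊆ C) (hB : B ⊆ C) : ∃ m, Big C R m := by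
  classical
  have hbX : b ∉ X := fun hh => hXB b hh hb
  let z0 : P := fun _ => 0
  have hinj := qK.inj z0 b hb
  let E := Equiv.ofBijective _ (Finite.injective_iff_bijective.1 hinj)
  obtain ⟨m, hm⟩ := ih (fun x => E.symm (h x)) (qh.post E.symm.injective) (hns.post E.symm.injective)
  refine ⟨m, Big.lift (Finset.insert_subset (hB hb) hX) z0 (hm.congr fun x => ?_)⟩
  rw [hR]
  have e1 : h ((insert b X).piecewise x z0) = h x := qh.dep _ _ fun i hi => by simp [hi]
  have e2 : K ((insert b X).piecewise x z0) = E (x b) := by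
    show _ = K (update z0 b (x b))
    apply qK.dep; intro i hi
    have : i ∉ X := fun hh => hXB i hh hi
    by_cases hib : i = b
    · subst hib; simp
    · simp [hib, this]
  rw [e1, e2, E.symm_apply_eq]
theorem SepC.out {A : Sn} {c : P → Bool} (hd : Dep A c) {i j : ℕ} (hi : i ∉ A) : SepC c i j := by
  intro x u v; unfold odd
  by_cases hij : i = j
  · subst hij; simp [hd.upd hi]
  · rw [update_comm hij, hd.upd hi, hd.upd hi]; simp
theorem odd_xor (c d : P → Bool) (x : P) (i : ℕ) (u : Qd) (j : ℕ) (v : Qd) : odd (fun y => c y ^^ d y) x i u j v = (odd c x i u j v ^^ odd d x i u j v) := by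
  unfold odd
  beta_reduce
  generalize c x = a1; generalize c (update x i u) = a2; generalize c (update x j v) = a3; generalize c (update (update x i u) j v) = a4; generalize d x = b1; generalize d (update x i u) = b2; generalize d (update x j v) = b3; generalize d (update (update x i u) j v) = b4; revert a1 a2 a3 a4 b1 b2 b3 b4; decide
theorem SL_comp {D X : Sn} {o : ℕ} (ho : o ∉ D) (hX : X ⊆ D) {g h K : Pf} (qg : Q D g) (qh : Q X h) (qK : Q (insert o (D \ X)) K) (hR : ∀ x, g x = x o ↔ h x = K x) {p : Td} (hp : SL p h X) (hK : SL p K (insert o (D \ X))) : ∃ q, SL q g D := by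
  classical
  have hoX : o ∉ X := fun h => ho (hX h)
  obtain ⟨q, hq⟩ := chi_perm _ (qK.inj (fun _ => 0) o (by simp)) p
  refine ⟨q, ?_⟩
  have ks : ∀ x y : P, ∀ u u', (cc p K (update x o u) ^^ cc p K (update x o u')) = (cc p K (update y o u) ^^ cc p K (update y o u')) := by
    intro x y u u'
    have := sep_split (X := {o}) (qK.bal p).dep (fun i hi j hj => by
      simp at hi; subst hi; simp only [mem_sdiff, mem_singleton] at hj
      exact hK i (by simp) j hj.1 (Ne.symm hj.2)) (fun _ => u) (fun _ => u') x y
    have e : ∀ x : P, ∀ u, ({o} : Sn).piecewise (fun _ => u) x = update x o u := by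
      intro x u; funext l; by_cases hl : l = o
      · subst hl; simp
      · simp [hl]
    rwa [e, e, e, e] at this
  have val : ∀ x, h x = K (update x o (g x)) := by
    intro x
    have := (hR (update x o (g x))).1 (by rw [qg.dep.upd ho, update_self])
    rwa [qh.dep.upd hoX] at this
  let d : P → Bool := fun x => cc p h x ^^ cc p K (update x o 0)
  have key : ∀ x y, (cc q g x ^^ cc q g y) = (d x ^^ d y) := by
    intro x y; have h1 := hq (g x) (g y)
    have h2 := ks x (fun _ => 0) (g x) 0
    have h3 := ks y (fun _ => 0) (g y) 0
    show (chi q (g x) ^^ chi q (g y)) = ((chi p (h x) ^^ cc p K (update x o 0)) ^^ (chi p (h y) ^^ cc p K (update y o 0)))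
    rw [← h1, val x, val y]
    change (cc p K (update (fun _ => 0) o (g x)) ^^ cc p K (update (fun _ => 0) o (g y))) = ((cc p K (update x o (g x)) ^^ cc p K (update x o 0)) ^^ (cc p K (update y o (g y)) ^^ cc p K (update y o 0)))
    rw [h2, h3]
    generalize cc p K (update (fun _ => 0) o (g x)) = a; generalize cc p K (update (fun _ => 0) o (g y)) = b
    generalize cc p K (update (fun _ => 0) o 0) = c
    revert a b c; decide
  intro i hi j hj hij x u v
  have e : odd (cc q g) x i u j v = odd d x i u j v := by
    unfold odd; rw [key, key]
  rw [e]
  show odd (fun y => cc p h y ^^ cc p K (update y o 0)) x i u j v = false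
  rw [odd_xor]
  have dK : Dep (D \ X) (fun y => cc p K (update y o 0)) := by
    intro x y hxy; apply (qK.bal p).dep; intro l hl
    by_cases hlo : l = o
    · subst hlo; simp
    · rw [update_of_ne hlo, update_of_ne hlo]; exact hxy l ((Finset.mem_insert.1 hl).resolve_left hlo)
  have io : o ≠ i := fun e => ho (e ▸ hi)
  have jo : o ≠ j := fun e => ho (e ▸ hj)
  have s1 : SepC (cc p h) i j := by
    by_cases hiX : i ∈ X
    · by_cases hjX : j ∈ X
      · exact hp i hiX j hjX hij
      · exact (SepC.out (qh.bal p).dep hjX).symm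
    · exact SepC.out (qh.bal p).dep hiX
  have s2 : SepC (fun y => cc p K (update y o 0)) i j := by
    by_cases hiX : i ∈ X
    · exact SepC.out dK (by simp [hiX])
    · by_cases hjX : j ∈ X
      · exact (SepC.out dK (by simp [hjX])).symm
      · have := hK i (by simp [hi, hiX]) j (by simp [hj, hjX]) hij
        intro x u v; have := this (update x o 0) u v; unfold odd at this ⊢
        rwa [update_comm io, update_comm jo, update_comm jo] at this
  rw [s1, s2]; rfl
theorem N' : ∀ n, ∀ (D : Sn) (g : Pf) (o : ℕ), D.card = n → o ∉ D → Q D g → TT (n + 1) → 2 ≤ n → NS g D → ∃ m, Big (insert o D) (fun x => g x = x o) m := by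
  classical
  intro n
  induction n using Nat.strong_induction_on with
  | _ n ih =>
  intro D g o hn ho qg hT h2 hns
  obtain ⟨q, hq⟩ := hT D g qg (by omega) (by omega)
  have : ¬ SL q g D := hns q; unfold SL at this
  push Not at this
  obtain ⟨i, hi, j, hj, hij, hs⟩ := this
  obtain ⟨X, hXD, hiX, hXs, hXc⟩ := exists_comp D (fun a b => ¬ SepC (cc q g) a b) hi (fun a b h h' => h h'.symm)
  have hXs' : ∀ a ∈ X, ∀ b ∈ D \ X, SepC (cc q g) a b := fun a ha b hb => not_not.1 (hXs a ha b hb)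
  have hjX : j ∈ X := by
    by_contra hjX; exact hs (hXs' i hiX j (by simp [hj, hjX]))
  have hX2 : 2 ≤ X.card := Finset.one_lt_card.2 ⟨i, hiX, j, hjX, hij⟩
  have hXn : X ≠ D := by
    rintro rfl; exact hq hXc
  have hXlt : X.card < D.card := card_lt_card (Finset.ssubset_iff_subset_ne.2 ⟨hXD, hXn⟩); have hred : Red X g := D2 qg hXD q hXs' hXc
  have hoX : o ∉ X := fun h => ho (hXD h)
  set B := insert o (D \ X) with hB
  have hXB : ∀ i ∈ X, i ∉ B := by
    intro i hi hiB; rcases Finset.mem_insert.1 hiB with rfl | h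
    · exact hoX hi
    · exact (Finset.mem_sdiff.1 h).2 hi
  have hUn : X ∪ B = insert o D := by
    rw [hB, Finset.union_insert, Finset.union_sdiff_of_subset hXD]
  have hBc : B.card = D.card - X.card + 1 := by
    rw [hB, card_insert_of_notMem (by simp [ho]), Finset.card_sdiff_of_subset hXD]
  let w0 : P := fun _ => 0
  have qh := qg.frz hXD w0
  set h : Pf := fun x => g (X.piecewise x w0) with hh
  obtain ⟨K, qK, hR⟩ := levels (R := fun x => g x = x o) hXB qh (by rw [hUn]; exact qg.mds ho) hiX (by
    intro x y hxy rx ry; have e1 : X.piecewise x x = x := pw_self x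
    have e2 : g (X.piecewise y x) = g y := by
      apply qg.dep; intro l hl
      by_cases hlX : l ∈ X
      · simp [hlX]
      · simp only [hlX, not_false_eq_true, piecewise_eq_of_notMem]
        exact hxy l (by rw [hB]; simp [hl, hlX])
    refine hred x y x w0 ?_
    rw [e1, e2, rx, ry]; exact hxy o (by rw [hB]; simp))
  have TTmono : ∀ k, k ≤ n → TT (k + 1) := fun k hk A g q h2 hlt => hT A g q h2 (by omega)
  by_cases nh : NS h X
  · have hoB : o ∈ B := by rw [hB]; simp
    exact restr hXB qK hoB qh hR nh (fun g' q' n' => ih X.card (by omega) X g' o rfl hoX q' (TTmono _ (by omega)) hX2 n')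
      (hUn ▸ subset_union_left) (hUn ▸ Finset.subset_union_right)
  by_cases nK : NS K B
  · exact restr (fun a ha hb => hXB a hb ha) qh hiX qK (fun x => (hR x).trans eq_comm) nK
      (fun g' q' n' => ih B.card (by omega) B g' i rfl (hXB i hiX) q' (TTmono _ (by omega)) (by omega) n')
      (hUn ▸ Finset.subset_union_right) (hUn ▸ subset_union_left)
  unfold NS at nh nK
  push Not at nh nK
  obtain ⟨p, hp⟩ := nh; obtain ⟨s, hsK⟩ := nK
  have np : ¬ SL s h X := fun hs' => by
    obtain ⟨r, hr⟩ := SL_comp ho hXD qg qh qK hR hs' hsK; exact hns r hr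
  have ns : ¬ SL p K B := fun hs' => by
    obtain ⟨r, hr⟩ := SL_comp ho hXD qg qh qK hR hp hs'; exact hns r hr
  have hps : p ≠ s := by rintro rfl; exact np hp
  obtain ⟨a, ha, b, hb, hab, x1, q1, t1⟩ := cube qh hp np; obtain ⟨c, hc, d, hd, hcd, x2, q2, t2⟩ := cube qK hsK ns
  have sX : ({a, b} : Sn) ⊆ X := by intro l hl; simp at hl; rcases hl with rfl | rfl <;> assumption
  have sB : ({c, d} : Sn) ⊆ B := by intro l hl; simp at hl; rcases hl with rfl | rfl <;> assumption
  refine ⟨_, {a, b}, {c, d}, p, s, _, _, X.piecewise x1 x2, ⟨?_, ?_, ⟨fun l hl hl' => hXB l (sX hl) (sB hl'), hps, q1, t1, q2, t2⟩, ?_⟩, rfl⟩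
  · exact sX.trans (hUn ▸ subset_union_left)
  · exact sB.trans (hUn ▸ Finset.subset_union_right)
  · intro x; have := hR ((({a, b} : Sn) ∪ {c, d}).piecewise x (X.piecewise x1 x2)); rw [this]
    have e1 : h ((({a, b} : Sn) ∪ {c, d}).piecewise x (X.piecewise x1 x2)) = h (({a, b} : Sn).piecewise x x1) := by
      apply qh.dep; intro l hl
      by_cases h1 : l ∈ ({a, b} : Sn)
      · rw [piecewise_eq_of_mem _ _ _ h1, piecewise_eq_of_mem _ _ _ (mem_union_left _ h1)]
      · have h2 : l ∉ ({a, b} : Sn) ∪ {c, d} := by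
          rw [mem_union, not_or]; exact ⟨h1, fun h2 => hXB l hl (sB h2)⟩
        rw [piecewise_eq_of_notMem _ _ _ h1, piecewise_eq_of_notMem _ _ _ h2, piecewise_eq_of_mem _ _ _ hl]
    have e2 : K ((({a, b} : Sn) ∪ {c, d}).piecewise x (X.piecewise x1 x2)) = K (({c, d} : Sn).piecewise x x2) := by
      apply qK.dep; intro l hl
      have hlX : l ∉ X := fun h => hXB l h hl
      by_cases h1 : l ∈ ({c, d} : Sn)
      · rw [piecewise_eq_of_mem _ _ _ h1, piecewise_eq_of_mem _ _ _ (mem_union_right _ h1)]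
      · have h2 : l ∉ ({a, b} : Sn) ∪ {c, d} := by
          rw [mem_union, not_or]; exact ⟨fun h2 => hlX (sX h2), h1⟩
        rw [piecewise_eq_of_notMem _ _ _ h1, piecewise_eq_of_notMem _ _ _ h2, piecewise_eq_of_notMem _ _ _ hlX]
    rw [e1, e2]
abbrev Cu := Qd → Qd → Qd → Qd
structure LC (c : Cu) : Prop where
  i1 : ∀ b d, Injective (fun a => c a b d)
  i2 : ∀ a d, Injective (fun b => c a b d)
  i3 : ∀ a b, Injective (fun d => c a b d)
def spF (p : ℕ) (F : ℕ → ℕ → ℕ) : Bool := rg.all fun a => rg.all fun b =>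
  Nat.beq (Nat.mod (Nat.add (Nat.add (chiN p (F 0 0)) (chiN p (F a 0))) (Nat.add (chiN p (F 0 b)) (chiN p (F a b)))) 2) 0
theorem spF_sp {p : Td} {L : Sq} {F : ℕ → ℕ → ℕ} (hF : ∀ a b : Qd, F a b = L a b) (h : spF p F = true) : Sp p L := by
  unfold spF at h; simp only [rg_all] at h
  have key : ∀ a b : Qd, ((chi p (L 0 0) ^^ chi p (L a 0)) ^^ (chi p (L 0 b) ^^ chi p (L a b))) = false := by
    intro a b; have := h a b; have e1 := hF 0 0; have e2 := hF a 0; have e3 := hF 0 b; rw [Fin.val_zero] at e1 e2 e3; rw [e1, e2, e3, hF, chiN_eq, chiN_eq, chiN_eq, chiN_eq, Nat.beq_eq] at this; revert this; generalize chi p (L 0 0) = t1; generalize chi p (L a 0) = t2; generalize chi p (L 0 b) = t3; generalize chi p (L a b) = t4; revert t1 t2 t3 t4; decide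
  intro a a' b b'; have k1 := key a b; have k2 := key a' b; have k3 := key a b'; have k4 := key a' b'; revert k1 k2 k3 k4; generalize chi p (L 0 0) = t1; generalize chi p (L a 0) = t2; generalize chi p (L a' 0) = t3; generalize chi p (L 0 b) = t4; generalize chi p (L 0 b') = t5; generalize chi p (L a b) = t6; generalize chi p (L a' b) = t7; generalize chi p (L a b') = t8; generalize chi p (L a' b') = t9; revert t1 t2 t3 t4 t5 t6 t7 t8 t9; decide
def dsq (i r N : ℕ) : Bool := rg.all fun d => !(Nat.beq (vl r d) (vq N i d))
def fst0 (v i r : ℕ) : Bool := match i with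
  | 0 => Nat.beq (vl r 0) v
  | _ => true
def ck (N0 N1 N2 N3 : ℕ) (p : ℕ) : Bool :=
  let F := fun a b d => vq (sel N0 N1 N2 N3 a) b d
  let s12 := rg.all fun d => spF p (fun a b => F a b d)
  let s13 := rg.all fun b => spF p (fun a d => F a b d)
  let s23 := rg.all fun a => spF p (fun b d => F a b d)
  (s12 && s13) || (s12 && s23) || (s13 && s23)
def srC : Bool :=
  srS (redD (rowc id)) fun N0 => srS (fun i r => fst0 1 i r && dsq i r N0) fun N1 =>
  srS (fun i r => fst0 2 i r && dsq i r N0 && dsq i r N1) fun N2 =>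
  srS (fun i r => fst0 3 i r && dsq i r N0 && dsq i r N1 && dsq i r N2) fun N3 =>
  ck N0 N1 N2 N3 0 || ck N0 N1 N2 N3 1 || ck N0 N1 N2 N3 2
theorem srC_ok : srC = true := by decide +kernel
def S12 (p : Td) (c : Cu) := ∀ d, Sp p (fun a b => c a b d)
def S13 (p : Td) (c : Cu) := ∀ b, Sp p (fun a d => c a b d)
def S23 (p : Td) (c : Cu) := ∀ a, Sp p (fun b d => c a b d)
def G3 (p : Td) (c : Cu) := (S12 p c ∧ S13 p c) ∨ (S12 p c ∧ S23 p c) ∨ (S13 p c ∧ S23 p c)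
theorem ck_ok {p : Td} {c : Cu} (h : ck (codeS (c 0)) (codeS (c 1)) (codeS (c 2)) (codeS (c 3)) p = true) : G3 p c := by
  have e : ∀ a b d : Qd, vq (sel (codeS (c 0)) (codeS (c 1)) (codeS (c 2)) (codeS (c 3)) a) b d = c a b d := by
    intro a b d
    rw [← vq_eq]; congr 1; fin_cases a <;> rfl
  unfold ck at h; simp only [Bool.or_eq_true, Bool.and_eq_true, rg_all] at h
  have h12 : (∀ d : Qd, spF p (fun a b => vq (sel (codeS (c 0)) (codeS (c 1)) (codeS (c 2)) (codeS (c 3)) a) b d) = true) → S12 p c := fun hh d => spF_sp (fun a b => e a b d) (hh d)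
  have h13 : (∀ b : Qd, spF p (fun a d => vq (sel (codeS (c 0)) (codeS (c 1)) (codeS (c 2)) (codeS (c 3)) a) b d) = true) → S13 p c := fun hh b => spF_sp (fun a d => e a b d) (hh b)
  have h23 : (∀ a : Qd, spF p (fun b d => vq (sel (codeS (c 0)) (codeS (c 1)) (codeS (c 2)) (codeS (c 3)) a) b d) = true) → S23 p c := fun hh a => spF_sp (fun b d => e a b d) (hh a)
  rcases h with (⟨h1, h2⟩ | ⟨h1, h2⟩) | ⟨h1, h2⟩
  · exact Or.inl ⟨h12 h1, h13 h2⟩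
  · exact Or.inr (Or.inl ⟨h12 h1, h23 h2⟩)
  · exact Or.inr (Or.inr ⟨h13 h1, h23 h2⟩)
theorem cube_red {c : Cu} (h : LC c) (h1 : ∀ a, c a 0 0 = a) (h2 : ∀ b, c 0 b 0 = b) (h3 : ∀ d, c 0 0 d = d) : ∃ p, G3 p c := by
  have ls : ∀ a, LS (c a) := fun a => ⟨fun b => h.i3 a b, fun d => h.i2 a d⟩
  have ds : ∀ (a a' i : Qd), a ≠ a' → dsq i (rowc (c a i)) (codeS (c a')) = true := by
    intro a a' i hne; unfold dsq; rw [rg_all]; intro d; rw [vl_row, vq_eq, Bool.not_eq_true', ← Bool.not_eq_true, beq_val]; intro e; exact hne (h.i1 i d e)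
  have f0 : ∀ (a : Qd) (i : Qd), fst0 a i (rowc (c a i)) = true := by
    intro a i; rcases i with ⟨i, hi⟩; rcases i with _ | i
    · unfold fst0; have := vl_row (c a 0) 0; rw [Fin.val_zero, h1] at this
      show Nat.beq (vl (rowc (c a 0)) 0) a = true
      rw [this]; simp
    · rfl
  have H := srC_ok; unfold srC at H; have H0 := (ls 0).all _ _ (redD_ok (e := id) h2 h3) H
  have H1 := (ls 1).all _ _ (fun i => by
    rw [Bool.and_eq_true]; exact ⟨f0 1 i, ds 1 0 i (by decide)⟩) H0
  have H2 := (ls 2).all _ _ (fun i => by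
    rw [Bool.and_eq_true, Bool.and_eq_true]; exact ⟨⟨f0 2 i, ds 2 0 i (by decide)⟩, ds 2 1 i (by decide)⟩) H1
  have H3 := (ls 3).all _ _ (fun i => by
    rw [Bool.and_eq_true, Bool.and_eq_true, Bool.and_eq_true]
    exact ⟨⟨⟨f0 3 i, ds 3 0 i (by decide)⟩, ds 3 1 i (by decide)⟩, ds 3 2 i (by decide)⟩) H2
  rw [Bool.or_eq_true, Bool.or_eq_true] at H3; rcases H3 with (h | h) | h
  · exact ⟨0, ck_ok h⟩
  · exact ⟨1, ck_ok h⟩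
  · exact ⟨2, ck_ok h⟩
theorem cube3 {c : Cu} (h : LC c) : ∃ p, G3 p c := by
  choose s hs using fun v => (Finite.injective_iff_surjective.1 (h.i1 0 0)) v
  choose t ht using fun v => (Finite.injective_iff_surjective.1 (h.i2 (s 0) 0)) v
  choose r hr using fun v => (Finite.injective_iff_surjective.1 (h.i3 (s 0) 0)) v
  beta_reduce at hs ht hr
  have t0 : t 0 = 0 := h.i2 (s 0) 0 (by beta_reduce; rw [ht, hs])
  have r0 : r 0 = 0 := h.i3 (s 0) 0 (by beta_reduce; rw [hr, hs])
  have is : Injective s := fun a b e => by rw [← hs a, ← hs b, e]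
  have it : Injective t := fun a b e => by rw [← ht a, ← ht b, e]
  have ir : Injective r := fun a b e => by rw [← hr a, ← hr b, e]
  have ss := Finite.injective_iff_surjective.1 is; have st := Finite.injective_iff_surjective.1 it; have sr := Finite.injective_iff_surjective.1 ir
  obtain ⟨p, hp⟩ := cube_red (c := fun a b d => c (s a) (t b) (r d))
    ⟨fun b d x y e => is (h.i1 _ _ e), fun b d x y e => it (h.i2 _ _ e), fun b d x y e => ir (h.i3 _ _ e)⟩
    (fun a => by rw [t0, r0, hs]) (fun a => by rw [r0, ht]) (fun a => by rw [t0, hr])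
  refine ⟨p, ?_⟩
  have h12 : S12 p (fun a b d => c (s a) (t b) (r d)) → S12 p c := fun hh d => by
    obtain ⟨d, rfl⟩ := sr d; exact Sp.of_comp is it (hh d)
  have h13 : S13 p (fun a b d => c (s a) (t b) (r d)) → S13 p c := fun hh d => by
    obtain ⟨d, rfl⟩ := st d; exact Sp.of_comp is ir (hh d)
  have h23 : S23 p (fun a b d => c (s a) (t b) (r d)) → S23 p c := fun hh d => by
    obtain ⟨d, rfl⟩ := ss d; exact Sp.of_comp it ir (hh d)
  rcases hp with ⟨a, b⟩ | ⟨a, b⟩ | ⟨a, b⟩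
  · exact Or.inl ⟨h12 a, h13 b⟩
  · exact Or.inr (Or.inl ⟨h12 a, h23 b⟩)
  · exact Or.inr (Or.inr ⟨h13 a, h23 b⟩)
theorem iso_nc {D : Sn} {c : P → Bool} {i : ℕ} (hi : i ∈ D) (h2 : 2 ≤ D.card) (hs : ∀ j ∈ D, j ≠ i → SepC c i j) : ¬ ConnC c D := by
  intro hc
  obtain ⟨a, ha, b, hb, hn⟩ := hc {i} (by simpa using hi) (by simp) (fun e => by rw [← e] at h2; simp at h2)
  simp at ha hb; subst ha; exact hn (hs b hb.1 hb.2)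
theorem T2 {D : Sn} {f : Pf} (hf : Q D f) (h2 : D.card = 2) : ∃ p, ¬ ConnC (cc p f) D := by
  obtain ⟨i, j, hij, rfl⟩ := Finset.card_eq_two.1 h2
  obtain ⟨p, hp⟩ := L2 (hf.ls (i := i) (j := j) (by simp) (by simp) hij (fun _ => 0))
  refine ⟨p, iso_nc (i := i) (by simp) h2.ge ?_⟩
  intro l hl hli
  obtain rfl : l = j := by simp at hl; tauto
  intro x u v
  have e : sqf f i l x = sqf f i l (fun _ => 0) := by
    funext a b; apply hf.dep; intro k hk; simp at hk; rcases hk with rfl | rfl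
    · simp [update_of_ne hij]
    · simp
  rw [← e] at hp; exact (plsep_iff hij).2 hp x Ag.rfl' u v
theorem T3 {D : Sn} {f : Pf} (hf : Q D f) (h2 : D.card = 3) : ∃ p, ¬ ConnC (cc p f) D := by
  obtain ⟨i, j, k, hij, hik, hjk, rfl⟩ := Finset.card_eq_three.1 h2
  let pt : Qd → Qd → Qd → P := fun a b d => update (update (update (fun _ => 0) i a) j b) k d
  have fpt : ∀ x, f x = f (pt (x i) (x j) (x k)) := by
    intro x; apply hf.dep; intro l hl; simp at hl; rcases hl with rfl | rfl | rfl
    · simp [pt, hij, hik]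
    · simp [pt, hjk]
    · simp [pt]
  have lc : LC (fun a b d => f (pt a b d)) := by
    refine ⟨fun b d => ?_, fun a d => ?_, fun a b => ?_⟩
    · have := hf.inj (pt 0 b d) i (by simp)
      convert this using 2 with a
      simp only [pt]; rw [update_comm hik.symm, update_comm hij.symm, update_idem]
    · have := hf.inj (pt a 0 d) j (by simp)
      convert this using 2 with b
      simp only [pt]; rw [update_comm hjk.symm, update_idem]
    · exact hf.inj (update (update (fun _ => 0) i a) j b) k (by simp)
  obtain ⟨p, hp⟩ := cube3 lc; refine ⟨p, ?_⟩
  have h12 : S12 p (fun a b d => f (pt a b d)) → SepC (cc p f) i j := by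
    intro hh x u v; refine (plsep_iff hij).2 ?_ x Ag.rfl' u v
    convert hh (x k) using 1
    funext a b; unfold sqf; rw [fpt]; simp [hij, hik, hjk, hij.symm, hik.symm, hjk.symm]
  have h13 : S13 p (fun a b d => f (pt a b d)) → SepC (cc p f) i k := by
    intro hh x u v; refine (plsep_iff hik).2 ?_ x Ag.rfl' u v
    convert hh (x j) using 1
    funext a b; unfold sqf; rw [fpt]; simp [hij, hik, hjk, hij.symm, hik.symm, hjk.symm]
  have h23 : S23 p (fun a b d => f (pt a b d)) → SepC (cc p f) j k := by
    intro hh x u v; refine (plsep_iff hjk).2 ?_ x Ag.rfl' u v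
    convert hh (x i) using 1
    funext a b; unfold sqf; rw [fpt]; simp [hij, hik, hjk, hij.symm, hik.symm, hjk.symm]
  rcases hp with ⟨a, b⟩ | ⟨a, b⟩ | ⟨a, b⟩
  · refine iso_nc (i := i) (by simp) (by omega) ?_
    intro l hl hli; simp at hl; rcases hl with rfl | rfl | rfl
    exacts [absurd rfl hli, h12 a, h13 b]
  · refine iso_nc (i := j) (by simp) (by omega) ?_
    intro l hl hli; simp at hl; rcases hl with rfl | rfl | rfl
    exacts [(h12 a).symm, absurd rfl hli, h23 b]
  · refine iso_nc (i := k) (by simp) (by omega) ?_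
    intro l hl hli; simp at hl; rcases hl with rfl | rfl | rfl
    exacts [(h13 a).symm, (h23 b).symm, absurd rfl hli]
def rc (f : Pf) (p : Td) (i j : ℕ) (x : P) (a b : Qd) : Prop :=
  ∀ q, q ≠ p → odd (cc q f) x i a j b = true
theorem rc_ex {f : Pf} {q : Td} {i j : ℕ} {x : P} {a b : Qd} (h : odd (cc q f) x i a j b = true) : ∃ p, p ≠ q ∧ rc f p i j x a b := by
  have key : ∀ (q : Td) (a b c d : Qd), ((chi q a ^^ chi q b) ^^ (chi q c ^^ chi q d)) = true →
    ∃ p, p ≠ q ∧ ∀ q, q ≠ p → ((chi q a ^^ chi q b) ^^ (chi q c ^^ chi q d)) = true := by decide +kernel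
  exact key _ _ _ _ _ h
def HLy (D : Sn) (f : Pf) (p : Td) (t : ℕ) (v : Qd) : Prop :=
  ∀ x : P, x t = v → ∀ i ∈ D, ∀ j ∈ D, i ≠ t → j ≠ t → i ≠ j → ∀ a b, odd (cc p f) x i a j b = false
def ZZ (D : Sn) (f : Pf) (p : Td) (t : ℕ) (v : Qd) : Prop :=
  ∃ i ∈ D, ∃ j ∈ D, i ≠ t ∧ j ≠ t ∧ i ≠ j ∧ ∃ x : P, x t = v ∧ ∃ a b, rc f p i j x a b
theorem rc.symm {f : Pf} {p : Td} {i j : ℕ} {x : P} {a b : Qd} (hij : i ≠ j) (h : rc f p i j x a b) : rc f p j i x b a := fun q hq => by rw [odd_comm _ _ hij.symm]; exact h q hq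
theorem out3 {D : Sn} (h4 : 4 ≤ D.card) (i j k : ℕ) : ∃ m ∈ D, m ≠ i ∧ m ≠ j ∧ m ≠ k := by
  by_contra! hn
  have : D ⊆ {i, j, k} := fun m hm => by
    simp only [mem_insert, mem_singleton]; by_contra! h; exact h.2.2 (hn m hm h.1 h.2.1)
  have := (card_le_card this).trans Finset.card_le_three; omega
section
variable {D : Sn} {f : Pf} (hf : Q D f) (h4 : 4 ≤ D.card) (HL : ∀ t ∈ D, ∀ v, ∃ p, HLy D f p t v)
include HL
theorem ZZ.ly {p : Td} {t : ℕ} {v : Qd} (ht : t ∈ D) (h : ZZ D f p t v) : HLy D f p t v := by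
  obtain ⟨r, hr⟩ := HL t ht v; obtain ⟨i, hi, j, hj, hit, hjt, hij, x, hx, a, b, hrc⟩ := h
  by_cases e : r = p
  · exact e ▸ hr
  · have := hrc r e; rw [hr x hx i hi j hj hit hjt hij] at this; simp at this
theorem ZZ.disj {p q : Td} {t : ℕ} {v : Qd} (ht : t ∈ D) (hpq : p ≠ q) (h : ZZ D f p t v) : ¬ ZZ D f q t v := by
  intro h'; have hr := h'.ly HL ht; obtain ⟨i, hi, j, hj, hit, hjt, hij, x, hx, a, b, hrc⟩ := h; have := hrc q hpq.symm; rw [hr x hx i hi j hj hit hjt hij] at this; simp at this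
include h4
theorem rc_in {p : Td} {i j t : ℕ} {x : P} {a b : Qd} (hi : i ∈ D) (hj : j ∈ D) (hij : i ≠ j) (h : rc f p i j x a b) : ∃ m ∈ D, m ≠ i ∧ m ≠ j ∧ m ≠ t ∧ HLy D f p m (x m) := by
  obtain ⟨m, hm, m1, m2, m3⟩ := out3 h4 i j t; exact ⟨m, hm, m1, m2, m3, ZZ.ly HL hm ⟨i, hi, j, hj, m1.symm, m2.symm, hij, x, rfl, a, b, h⟩⟩
theorem rc_of {p q : Td} {m : ℕ} (hpq : q ≠ p) {y : P} (hl : HLy D f p m (y m)) {i j : ℕ} (hi : i ∈ D) (hj : j ∈ D) (hij : i ≠ j) (him : i ≠ m) (hjm : j ≠ m) {a b : Qd} (h : odd (cc q f) y i a j b = true) : rc f p i j y a b := by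
  obtain ⟨r, hr, hrc⟩ := rc_ex h
  by_cases e : p = r
  · exact e ▸ hrc
  · have := hrc p e; rw [hl y rfl i hi j hj him hjm hij] at this; simp at this
include hf
theorem rc_mate {p : Td} {i j t : ℕ} {x : P} {a b : Qd} (hi : i ∈ D) (hj : j ∈ D) (hij : i ≠ j) (ht : t ∈ D) (hit : i ≠ t) (hjt : j ≠ t) (h : rc f p i j x a b) {u : Qd} (hu : chi p (f (update x t u)) = chi p (f x)) : rc f p i j (update x t u) a b := by
  by_cases hux : u = x t
  · subst hux; simpa using h
  obtain ⟨m, hm, m1, m2, m3, hl⟩ := rc_in h4 HL (t := t) hi hj hij h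
  have key : ∀ y : P, y m = x m → chi p (f (update y t u)) = chi p (f y) → y t = x t → ∀ q, q ≠ p →
      chi q (f (update y t u)) = !chi q (f y) := by
    intro y _ hy hyt q hq
    have n := fun e => chi_sep p q _ _ hq.symm hy e
    have n2 : chi q (f (update y t u)) ≠ chi q (f y) := fun e => hux (by rw [hf.eq' y ht (n e), hyt])
    revert n2; cases chi q (f (update y t u)) <;> cases chi q (f y) <;> simp
  have mv : ∀ y : P, y m = x m → chi p (f (update y t u)) = chi p (f y) → ∀ k ∈ D, k ≠ t → k ≠ m → ∀ c,
      chi p (f (update (update y k c) t u)) = chi p (f (update y k c)) := by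
    intro y hy hyu k hk hkt hkm c; have := hl y hy k hk t ht hkm m3.symm hkt c u; unfold odd cc at this; revert this; rw [hyu]; generalize chi p (f y) = t1; generalize chi p (f (update y k c)) = t2; generalize chi p (f (update (update y k c) t u)) = t3; revert t1 t2 t3; decide
  have c1 := mv x rfl hu i hi hit m1.symm a; have c2 := mv x rfl hu j hj hjt m2.symm b
  have c3 := mv (update x i a) (by simp [m1]) c1 j hj hjt m2.symm b
  intro q hq; have := h q hq; unfold odd cc at this ⊢; rw [update_comm hit.symm, update_comm hjt.symm, update_comm hjt.symm]
  rw [key x rfl hu rfl q hq, key _ (by simp [m1]) c1 (by simp [hit.symm]) q hq, key _ (by simp [m2]) c2 (by simp [hjt.symm]) q hq,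
    key _ (by simp [m1, m2]) c3 (by simp [hit.symm, hjt.symm]) q hq]
  revert this; generalize chi q (f x) = t1; generalize chi q (f (update x i a)) = t2; generalize chi q (f (update x j b)) = t3; generalize chi q (f (update (update x i a) j b)) = t4; revert t1 t2 t3 t4; decide
theorem chi_mex {p : Td} {t : ℕ} (ht : t ∈ D) (x : P) : ∃ u, u ≠ x t ∧ chi p (f (update x t u)) = chi p (f x) := by
  obtain ⟨u, hu⟩ := hf.ex x ht (mate p (f x))
  refine ⟨u, ?_, by rw [hu, chi_mate]⟩
  rintro rfl; simp at hu; exact mate_ne _ _ hu.symm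
theorem ZZ.two {p : Td} {t : ℕ} {v : Qd} (ht : t ∈ D) (h : ZZ D f p t v) : ∃ u, u ≠ v ∧ ZZ D f p t u := by
  obtain ⟨i, hi, j, hj, hit, hjt, hij, x, rfl, a, b, hrc⟩ := h; obtain ⟨u, hu, hc⟩ := chi_mex hf h4 HL (p := p) ht x
  exact ⟨u, hu, i, hi, j, hj, hit, hjt, hij, update x t u, by simp, a, b, rc_mate hf h4 HL hi hj hij ht hit hjt hrc hc⟩
theorem ZZ.ex2 {p q : Td} (hpq : p ≠ q) {t : ℕ} (ht : t ∈ D) {v w : Qd} (h : ZZ D f p t v) (h' : ZZ D f q t w) : ∀ u u', u ≠ u' → ZZ D f p t u → ZZ D f p t u' → ∀ s, s ≠ u → s ≠ u' → ¬ ZZ D f p t s := by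
  intro u u' hu z z' s su su' hs; obtain ⟨w', hw, h''⟩ := h'.two hf h4 HL ht
  have n : ∀ {a b}, ZZ D f p t a → ZZ D f q t b → a ≠ b := fun ha hb e => (ZZ.disj HL ht hpq ha) (e ▸ hb)
  have := n z h'; have := n z h''; have := n z' h'; have := n z' h''; have := n hs h'; have := n hs h''
  have key : ∀ a b c d e : Qd, a ≠ b → c ≠ a → c ≠ b → d ≠ e → a ≠ d → a ≠ e → b ≠ d → b ≠ e → c ≠ d → c ≠ e → False := by
    intro a b c d e; simp only [Ne, Fin.ext_iff]; omega
  exact key u u' s w w' hu su su' hw.symm (by assumption) (by assumption) (by assumption) (by assumption) (by assumption) (by assumption)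
theorem rc_ext {p q : Td} (hpq : p ≠ q) {i j t : ℕ} {x : P} {a b : Qd} (hi : i ∈ D) (hj : j ∈ D) (hij : i ≠ j) (ht : t ∈ D) (hit : i ≠ t) (hjt : j ≠ t) (h : rc f p i j x a b) {w : Qd} (hw : ZZ D f q t w) : ∃ y a b, rc f p i t y a b ∧ ∀ k, k ≠ j → y k = x k := by
  obtain ⟨m, hm, m1, m2, m3, hl⟩ := rc_in h4 HL (t := t) hi hj hij h; have h0 := h q hpq.symm
  have h1 : odd (cc q f) (update x t w) i a j b = false := by
    by_contra hn; rw [Bool.not_eq_false] at hn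
    have := rc_of h4 HL hpq.symm (y := update x t w) (m := m) (by simpa [m3] using hl) hi hj hij m1.symm m2.symm hn
    exact ZZ.disj HL ht hpq ⟨i, hi, j, hj, hit, hjt, hij, _, by simp, a, b, this⟩ hw
  have : odd (cc q f) x i a t w = true ∨ odd (cc q f) (update x j b) i a t w = true := by
    unfold odd cc at *
    beta_reduce at *
    rw [update_comm hit.symm, update_comm hjt.symm, update_comm hjt.symm] at h1; rw [update_comm hij.symm]; revert h0 h1; generalize chi q (f x) = t1; generalize chi q (f (update x i a)) = t2; generalize chi q (f (update x j b)) = t3; generalize chi q (f (update (update x i a) j b)) = t4; generalize chi q (f (update x t w)) = t5; generalize chi q (f (update (update x i a) t w)) = t6; generalize chi q (f (update (update x j b) t w)) = t7; generalize chi q (f (update (update (update x i a) j b) t w)) = t8; revert t1 t2 t3 t4 t5 t6 t7 t8; decide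
  rcases this with h | h
  · exact ⟨x, a, w, rc_of h4 HL hpq.symm hl hi ht hit m1.symm m3.symm h, fun _ _ => rfl⟩
  · exact ⟨update x j b, a, w, rc_of h4 HL hpq.symm (m := m) (by simpa [m2] using hl) hi ht hit m1.symm m3.symm h, fun k hk => by simp [hk]⟩
theorem Z_all {p q : Td} (hpq : p ≠ q) {i j t : ℕ} {x : P} {a b : Qd} (hi : i ∈ D) (hj : j ∈ D) (hij : i ≠ j) (ht : t ∈ D) (hit : i ≠ t) (hjt : j ≠ t) (h : rc f p i j x a b) {w : Qd} (hw : ZZ D f q t w) : ∀ k ∈ D, ∃ v, ZZ D f p k v := by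
  intro k hk
  by_cases hki : k = i
  · subst hki; obtain ⟨y, a, b, h, -⟩ := rc_ext hf h4 HL hpq hj hi hij.symm ht hjt hit (h.symm hij) hw; exact ⟨_, j, hj, t, ht, hij.symm, hit.symm, hjt, y, rfl, a, b, h⟩
  by_cases hkj : k = j
  · subst hkj; obtain ⟨y, a, b, h, -⟩ := rc_ext hf h4 HL hpq hi hj hij ht hit hjt h hw; exact ⟨_, i, hi, t, ht, hij, hjt.symm, hit, y, rfl, a, b, h⟩
  exact ⟨_, i, hi, j, hj, Ne.symm hki, Ne.symm hkj, hij, x, rfl, a, b, h⟩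
theorem Z_pair {p q : Td} (hpq : p ≠ q) (hq : ∀ k ∈ D, ∃ v, ZZ D f q k v) {t : ℕ} (ht : t ∈ D) {v : Qd} (h : ZZ D f p t v) {k : ℕ} (hk : k ∈ D) (hkt : k ≠ t) {u u' : Qd} (hu : ZZ D f p k u) (hu' : ZZ D f p k u') (hne : u ≠ u') (x : P) (hx : x t = v) : chi p (f (update x k u)) = chi p (f (update x k u')) := by
  have hl := h.ly HL ht
  have h' : ∃ i ∈ D, ∃ j ∈ D, i ≠ k ∧ j ≠ k ∧ i ≠ j ∧ ∃ y : P, y t = v ∧ ∃ a b, rc f p i j y a b := by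
    obtain ⟨i, hi, j, hj, hit, hjt, hij, y, hy, a, b, hrc⟩ := h
    by_cases hkj : j = k
    · subst hkj; obtain ⟨m, hm, m1, m2, m3⟩ := out3 h4 i j t; obtain ⟨w, hw⟩ := hq m hm; obtain ⟨y', a, b, h, h'⟩ := rc_ext hf h4 HL hpq hi hj hij hm m1.symm m2.symm hrc hw
      exact ⟨i, hi, m, hm, hij, m2, m1.symm, y', by rw [h' t hkt.symm, hy], a, b, h⟩
    by_cases hki : i = k
    · subst hki; obtain ⟨m, hm, m1, m2, m3⟩ := out3 h4 i j t; obtain ⟨w, hw⟩ := hq m hm; obtain ⟨y', a, b, h, h'⟩ := rc_ext hf h4 HL hpq hj hi hij.symm hm m2.symm m1.symm (hrc.symm hij) hw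
      exact ⟨j, hj, m, hm, hkj, m1, m2.symm, y', by rw [h' t hkt.symm, hy], a, b, h⟩
    exact ⟨i, hi, j, hj, hki, hkj, hij, y, hy, a, b, hrc⟩
  obtain ⟨i, hi, j, hj, hik, hjk, hij, y, hy, a, b, hrc⟩ := h'; obtain ⟨w, hw⟩ := hq k hk; obtain ⟨m, hmne, hm⟩ := chi_mex hf h4 HL (p := p) hk y; have z1 : ZZ D f p k (y k) := ⟨i, hi, j, hj, hik, hjk, hij, y, rfl, a, b, hrc⟩
  have z2 : ZZ D f p k m := ⟨i, hi, j, hj, hik, hjk, hij, update y k m, by simp, a, b, rc_mate hf h4 HL hi hj hij hk hik hjk hrc hm⟩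
  have ex := ZZ.ex2 hf h4 HL hpq hk hu hw u u' hne hu hu'
  have e0 : chi p (f (update y k u)) = chi p (f (update y k u')) := by
    have q1 : y k = u ∨ y k = u' := by by_contra! hn; exact ex _ hn.1 hn.2 z1
    have q2 : m = u ∨ m = u' := by by_contra! hn; exact ex _ hn.1 hn.2 z2
    have em : f (update y k (y k)) = f y := by simp
    rcases q1 with q1 | q1 <;> rcases q2 with q2 | q2
    · exact absurd (q2.trans q1.symm) hmne
    · rw [← q1, ← q2, em, hm]
    · rw [← q1, ← q2, em, hm]
    · exact absurd (q2.trans q1.symm) hmne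
  have := walk (D.erase t) (fun z => z t = v ∧ chi p (f (update z k u)) = chi p (f (update z k u'))) ?_ y
    ((D.erase t).piecewise x y) (fun l hl => by simp only [Finset.piecewise, hl, if_false]) ⟨hy, e0⟩
  · have e : ∀ c, f (update ((D.erase t).piecewise x y) k c) = f (update x k c) := by
      intro c; apply hf.dep; intro l hl
      by_cases hlk : l = k
      · subst hlk; simp
      · rw [update_of_ne hlk, update_of_ne hlk]
        by_cases hlt : l = t
        · subst hlt; simp [hx, hy]
        · simp [hlt, hl]
    rw [← e, ← e]; exact this.2
  · intro z l hlD c ⟨hz, e⟩; have hlt := Finset.ne_of_mem_erase hlD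
    refine ⟨by rw [update_of_ne hlt.symm, hz], ?_⟩
    by_cases hlk : l = k
    · subst hlk; simpa using e
    have := hl (update z k u) (by rw [update_of_ne hkt.symm, hz]) l (Finset.mem_of_mem_erase hlD) k hk hlt hkt hlk c u'
    unfold odd cc at this
    have e1 : update (update (update z k u) l c) k u' = update (update z k u') l c := by
      rw [update_comm hlk, update_idem]
    rw [e1, update_idem] at this; revert this e; generalize chi p (f (update z k u)) = t1; generalize chi p (f (update z k u')) = t2; rw [update_comm hlk, update_comm hlk]; generalize chi p (f (update (update z k u) l c)) = t3; generalize chi p (f (update (update z k u') l c)) = t4; revert t1 t2 t3 t4; decide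
theorem lemS (hns : ∀ p, ∃ i ∈ D, ∃ j ∈ D, i ≠ j ∧ ¬ SepC (cc p f) i j) : ∃ p, ¬ ConnC (cc p f) D := by
  have hw : ∀ p, ∃ q, q ≠ p ∧ ∃ i ∈ D, ∃ j ∈ D, i ≠ j ∧ ∃ x a b, rc f q i j x a b := by
    intro p; obtain ⟨i, hi, j, hj, hij, hs⟩ := hns p; unfold SepC at hs
    push Not at hs
    obtain ⟨x, u, v, hs⟩ := hs; obtain ⟨q, hq, h⟩ := rc_ex (Bool.eq_true_of_not_eq_false hs); exact ⟨q, hq, i, hi, j, hj, hij, x, u, v, h⟩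
  by_cases hA : ∃ p q, p ≠ q ∧ ∃ i ∈ D, ∃ j ∈ D, i ≠ j ∧ ∃ x a b, rc f p i j x a b ∧ ∃ k ∈ D, ∃ l ∈ D, k ≠ l ∧ ∃ y c d, rc f q k l y c d ∧ ∃ t ∈ D, t ≠ i ∧ t ≠ j ∧ t ≠ k ∧ t ≠ l
  · exfalso
    obtain ⟨p, q, hpq, i, hi, j, hj, hij, x, a, b, h, k, hk, l, hl, hkl, y, c, d, h', t, ht, t1, t2, t3, t4⟩ := hA; have z1 : ZZ D f p t (x t) := ⟨i, hi, j, hj, t1.symm, t2.symm, hij, x, rfl, a, b, h⟩; have z2 : ZZ D f q t (y t) := ⟨k, hk, l, hl, t3.symm, t4.symm, hkl, y, rfl, c, d, h'⟩; have a1 := Z_all hf h4 HL hpq hi hj hij ht t1.symm t2.symm h z2; have a2 := Z_all hf h4 HL hpq.symm hk hl hkl ht t3.symm t4.symm h' z1; obtain ⟨s, hs, st, -, -⟩ := out3 h4 t t t; obtain ⟨e, he, et, es, -⟩ := out3 h4 t s s; obtain ⟨w, hw⟩ := a2 s hs; obtain ⟨u, hu⟩ := a1 e he; obtain ⟨u',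 hu', zu⟩ := hu.two hf h4 HL he; obtain ⟨w1, hw1⟩ := a2 e he; obtain ⟨w2, hw2, zw⟩ := hw1.two hf h4 HL he
    set X := update (update x s w) t (x t) with hX
    have p1 := Z_pair hf h4 HL hpq a2 ht z1 he et hu zu hu'.symm X (by simp [hX])
    have p2 := Z_pair hf h4 HL hpq.symm a1 hs hw he es hw1 zw hw2.symm X (by simp [hX, st])
    have n : ∀ {a b}, ZZ D f p e a → ZZ D f q e b → a ≠ b := fun ha hb e' => (ZZ.disj HL he hpq ha) (e' ▸ hb)
    have key : ∀ p q : Td, p ≠ q → ∀ a b c d : Qd, a ≠ b → a ≠ c → a ≠ d → b ≠ c → b ≠ d → c ≠ d → chi p a = chi p b → chi q c = chi q d → False := by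
      decide +kernel
    have I := hf.inj X e he; exact key p q hpq _ _ _ _ (I.ne hu'.symm) (I.ne (n hu hw1)) (I.ne (n hu zw)) (I.ne (n zu hw1)) (I.ne (n zu zw)) (I.ne hw2.symm) p1 p2
  · push Not at hA
    obtain ⟨p, -, i, hi, j, hj, hij, x, a, b, h⟩ := hw 0; obtain ⟨q, hq, k, hk, l, hl, hkl, y, c, d, h'⟩ := hw p
    refine ⟨p, fun hc => ?_⟩
    obtain ⟨m, hm, m', hm', hn⟩ := hc {i, j} (by intro z; simp; rintro (rfl | rfl) <;> assumption) (by simp) (fun e => by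
      rw [← e, Finset.card_pair hij] at h4; omega)
    simp only [mem_sdiff, mem_insert, mem_singleton, not_or] at hm hm'
    have hmD : m ∈ D := by rcases hm with rfl | rfl <;> assumption
    have hmm : m ≠ m' := by rintro rfl; tauto
    unfold SepC at hn
    push Not at hn
    obtain ⟨z, u, v, hn⟩ := hn; obtain ⟨r, hr, hrc⟩ := rc_ex (Bool.eq_true_of_not_eq_false hn); have A1 := hA p r hr.symm i hi j hj hij x a b h m hmD m' hm'.1 hmm z u v hrc; obtain ⟨t, ht, t1, t2, t3⟩ := out3 h4 i j m'
    exact t3 (A1 t ht t1 t2 (by rintro rfl; tauto))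
end
theorem TTall : ∀ N, TT N := by
  intro N
  induction N with
  | zero => intro A g _ _ h; omega
  | succ N ih =>
    intro D f hf h2 hN
    by_cases hlt : D.card < N
    · exact ih D f hf h2 hlt
    obtain rfl : D.card = N := by omega
    by_cases c2 : D.card = 2
    · exact T2 hf c2
    by_cases c3 : D.card = 3
    · exact T3 hf c3
    have h4 : 4 ≤ D.card := by omega
    obtain ⟨o, ho⟩ := Infinite.exists_notMem_finset D
    by_cases hb : ∃ i ∈ D, ∃ w, NS (fun x => f ((D.erase i).piecewise x w)) (D.erase i)
    · obtain ⟨i, hi, w, hn⟩ := hb; have hce : (D.erase i).card = D.card - 1 := Finset.card_erase_of_mem hi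
      obtain ⟨m, hm⟩ := N' _ (D.erase i) _ o rfl (fun h => ho (Finset.mem_of_mem_erase h)) (hf.frz (Finset.erase_subset _ _) w)
        (by rw [hce]; convert ih using 1; omega) (by omega) hn
      refine MC hf ih ho (m := m) (Big.lift (C' := insert o (D.erase i)) (Finset.insert_subset_insert _ (Finset.erase_subset _ _)) w (Big.congr (fun x => ?_) hm))
      have e1 : f ((insert o (D.erase i)).piecewise x w) = f ((D.erase i).piecewise x w) := by
        apply hf.dep; intro l hl
        have : l ≠ o := fun e => ho (e ▸ hl)
        by_cases hli : l ∈ D.erase i <;> simp [Finset.piecewise, hli, this]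
      rw [e1]; simp
    · push Not at hb
      by_cases hs : ∃ p, SL p f D
      · obtain ⟨p, hp⟩ := hs
        obtain ⟨i, hi⟩ := Finset.card_pos.1 (by omega : 0 < D.card)
        exact ⟨p, iso_nc hi h2 fun j hj hji => hp i hi j hj hji.symm⟩
      · push Not at hs
        refine lemS hf h4 ?_ ?_
        · intro t ht v
          have := hb t ht (fun _ => v)
          unfold NS at this; push Not at this; obtain ⟨p, hp⟩ := this; refine ⟨p, ?_⟩; intro x hx i hi j hj hit hjt hij a b
          have h := hp i (by simp [hi, hit]) j (by simp [hj, hjt]) hij x a b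
          rw [← h]
          have e : ∀ y : P, y t = v → f y = f ((D.erase t).piecewise y fun _ => v) := by
            intro y hy; apply hf.dep; intro l hl
            by_cases hlt : l = t
            · subst hlt; simp [hy]
            · simp [hl, hlt]
          unfold odd cc; beta_reduce
          rw [← e x hx, ← e _ (by simp [hx, hit.symm]), ← e _ (by simp [hx, hjt.symm]), ← e _ (by simp [hx, hit.symm, hjt.symm])]
        · intro p; have := hs p; unfold SL at this; push Not at this; exact this
theorem exists_red {D : Sn} {g : Pf} (qg : Q D g) (h2 : 2 ≤ D.card) (hns : NS g D) : ∃ X ⊆ D, 2 ≤ X.card ∧ X.card < D.card ∧ Red X g := by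
  classical
  obtain ⟨q, hq⟩ := TTall _ D g qg h2 (Nat.lt_succ_self _); have : ¬ SL q g D := hns q; unfold SL at this
  push Not at this
  obtain ⟨i, hi, j, hj, hij, hs⟩ := this
  obtain ⟨X, hXD, hiX, hXs, hXc⟩ := exists_comp D (fun a b => ¬ SepC (cc q g) a b) hi (fun a b h h' => h h'.symm)
  have hXs' : ∀ a ∈ X, ∀ b ∈ D \ X, SepC (cc q g) a b := fun a ha b hb => not_not.1 (hXs a ha b hb)
  have hjX : j ∈ X := by
    by_contra hjX; exact hs (hXs' i hiX j (by simp [hj, hjX]))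
  refine ⟨X, hXD, Finset.one_lt_card.2 ⟨i, hiX, j, hjX, hij⟩, card_lt_card (Finset.ssubset_iff_subset_ne.2 ⟨hXD, ?_⟩), D2 qg hXD q hXs' hXc⟩; rintro rfl; exact hq hXc
theorem decomp {D X : Sn} {g : Pf} {o : ℕ} (ho : o ∉ D) (qg : Q D g) (hXD : X ⊆ D) (hne : X.Nonempty) (hred : Red X g) (w0 : P) : ∃ K, Q (insert o (D \ X)) K ∧ ∀ x, g x = x o ↔ g (X.piecewise x w0) = K x := by
  classical
  obtain ⟨i, hiX⟩ := hne
  have hoX : o ∉ X := fun h => ho (hXD h)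
  set B := insert o (D \ X) with hB
  have hXB : ∀ i ∈ X, i ∉ B := by
    intro i hi hiB; rcases Finset.mem_insert.1 hiB with rfl | h
    · exact hoX hi
    · exact (Finset.mem_sdiff.1 h).2 hi
  have hUn : X ∪ B = insert o D := by
    rw [hB, Finset.union_insert, Finset.union_sdiff_of_subset hXD]
  exact levels (R := fun x => g x = x o) hXB (qg.frz hXD w0) (by rw [hUn]; exact qg.mds ho) hiX (by
    intro x y hxy rx ry; have e1 : X.piecewise x x = x := pw_self x
    have e2 : g (X.piecewise y x) = g y := by
      apply qg.dep; intro l hl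
      by_cases hlX : l ∈ X
      · simp [hlX]
      · simp only [hlX, not_false_eq_true, piecewise_eq_of_notMem]
        exact hxy l (by rw [hB]; simp [hl, hlX])
    refine hred x y x w0 ?_
    rw [e1, e2, rx, ry]; exact hxy o (by rw [hB]; simp))
theorem Red.trans {X Y : Sn} {g : Pf} (hYX : Y ⊆ X) (hX : Red X g) {w0 : P} (hY : Red Y (fun x => g (X.piecewise x w0))) : Red Y g := by
  have e : ∀ x w : P, X.piecewise (Y.piecewise x w) w = Y.piecewise x w := by
    intro x w; funext l
    by_cases hl : l ∈ X
    · simp [hl]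
    · have : l ∉ Y := fun h => hl (hYX h)
      simp [hl, this]
  intro x y w w' h
  have h1 := hX (Y.piecewise x w) (Y.piecewise y w) w w0 (by rw [e, e, h])
  have h2 := hX _ _ w0 w' (hY x y w w' h1)
  rwa [e, e] at h2
theorem dec {D : Sn} {g : Pf} {o : ℕ} (ho : o ∉ D) (qg : Q D g) (h2 : 2 ≤ D.card) (hns : NS g D) : ∃ X, X ⊆ D ∧ 2 ≤ X.card ∧ X.card < D.card ∧ ∃ h K, Q X h ∧ Q (insert o (D \ X)) K ∧ (∀ x, g x = x o ↔ h x = K x) ∧ (∃ p, SL p h X) ∧ ∀ p, ¬ (SL p h X ∧ SL p K (insert o (D \ X))) := by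
  classical
  have hex : ∃ n, ∃ X ⊆ D, X.card = n ∧ 2 ≤ X.card ∧ X.card < D.card ∧ Red X g := by
    obtain ⟨X, a, b, c, d⟩ := exists_red qg h2 hns; exact ⟨_, X, a, rfl, b, c, d⟩
  obtain ⟨X, hX, hc, hX2, hXlt, hr⟩ := Nat.find_spec hex
  obtain ⟨K, qK, hR⟩ := decomp ho qg hX (Finset.card_pos.1 (by omega)) hr (fun _ => 0)
  have qh := qg.frz hX (fun _ => 0)
  refine ⟨X, hX, hX2, hXlt, _, K, qh, qK, hR, ?_, ?_⟩
  · by_contra hn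
    push Not at hn
    obtain ⟨Y, a, b, c, d⟩ := exists_red qh hX2 hn
    exact Nat.find_min hex (m := Y.card) (by omega) ⟨Y, a.trans hX, rfl, b, by omega, hr.trans a d⟩
  · rintro p ⟨s1, s2⟩; obtain ⟨q, hq⟩ := SL_comp ho hX qg qh qK hR s1 s2; exact hns q hq
theorem finQ (D : Sn) : {f | Q D f}.Finite := by
  classical
  have hI : Set.InjOn (fun f : Pf => fun y : D → Qd => f (fun i => if h : i ∈ D then y ⟨i, h⟩ else 0)) {f | Q D f} := by
    intro f hf g hg e; funext x
    have := congrFun e (fun i => x i)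
    beta_reduce at this
    rw [hf.dep x (fun i => if h : i ∈ D then x i else 0) (fun i hi => by simp [hi]),
      hg.dep x (fun i => if h : i ∈ D then x i else 0) (fun i hi => by simp [hi])]
    exact this
  exact Set.Finite.of_finite_image (Set.toFinite _) hI
open Classical in
noncomputable def qs (D : Sn) (R : (Pf) → Prop) : Finset (Pf) := (finQ D).toFinset.filter R
theorem mem_qs {D : Sn} {R : (Pf) → Prop} {f : Pf} : f ∈ qs D R ↔ Q D f ∧ R f := by simp [qs]
noncomputable def nv (D : Sn) : ℕ := (qs D fun _ => True).card
noncomputable def nn (D : Sn) : ℕ := (qs D fun f => NS f D).card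
noncomputable def ps (p : Td) (D : Sn) : ℕ := (qs D fun f => SL p f D).card
noncomputable def np (p : Td) (D : Sn) : ℕ := (qs D fun f => ¬ SL p f D).card
theorem SL.post {p : Td} {h : Pf} {D : Sn} (hs : SL p h D) (σ : Equiv.Perm (Qd)) : ∃ q, SL q (fun x => σ (h x)) D := by
  have key : ∀ p, ∃ q, ∀ a b, (chi q (σ a) ^^ chi q (σ b)) = (chi p a ^^ chi p b) := by
    intro p; obtain ⟨q, hq⟩ := chi_perm (σ⁻¹ : Equiv.Perm (Qd)) (Equiv.injective _) p
    exact ⟨q, fun a b => by have := hq (σ a) (σ b); simpa using this.symm⟩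
  obtain ⟨q, hq⟩ := key p
  exact ⟨q, SL.of_cc (fun x y => hq _ _) hs⟩
def al (D : Sn) : Finset (Sn) := D.powerset.filter fun A => 2 ≤ A.card ∧ A.card < D.card
open Classical in
noncomputable def UU (D : Sn) (o : ℕ) (A : Sn) : Finset ((Pf) × (Pf)) :=
  (qs A (fun _ => True) ×ˢ qs (insert o (D \ A)) (fun _ => True)).filter fun z =>
    (∃ p, SL p z.1 A) ∧ ∀ p, ¬ (SL p z.1 A ∧ SL p z.2 (insert o (D \ A)))
theorem rec1 {D : Sn} {o : ℕ} (ho : o ∉ D) (h2 : 2 ≤ D.card) : nn D * 24 ≤ ∑ A ∈ al D, (UU D o A).card := by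
  classical
  have hp : Fintype.card (Equiv.Perm (Qd)) = 24 := by rw [Fintype.card_perm]; rfl
  rw [← Finset.card_sigma, ← hp, ← Finset.card_univ, nn, ← Finset.card_product]
  have : ∀ g : Pf, ∃ X : Sn, ∃ h K : Pf, Q D g ∧ NS g D → X ⊆ D ∧ 2 ≤ X.card ∧ X.card < D.card ∧ Q X h ∧ Q (insert o (D \ X)) K ∧ (∀ x, g x = x o ↔ h x = K x) ∧
      (∃ p, SL p h X) ∧ ∀ p, ¬ (SL p h X ∧ SL p K (insert o (D \ X))) := by
    intro g
    by_cases hg : Q D g ∧ NS g D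
    · obtain ⟨X, a, b, c, h, K, r⟩ := dec ho hg.1 h2 hg.2
      exact ⟨X, h, K, fun _ => ⟨a, b, c, r⟩⟩
    · exact ⟨∅, g, g, fun h => absurd h hg⟩
  choose X h K H using this
  refine Finset.card_le_card_of_injOn (fun z => ⟨X z.1, fun x => z.2 (h z.1 x), fun x => z.2 (K z.1 x)⟩) ?_ ?_
  · rintro ⟨g, σ⟩ hg; obtain ⟨a, b, c, qh, qK, -, hs, hn⟩ := H g (mem_qs.1 (Finset.mem_product.1 hg).1); simp only [Finset.mem_coe, Finset.mem_sigma, al, UU, mem_filter, Finset.mem_powerset, mem_product, mem_qs]; refine ⟨⟨a, b, c⟩, ⟨⟨qh.post σ.injective, trivial⟩, qK.post σ.injective, trivial⟩, ?_, ?_⟩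
    · obtain ⟨p, hp⟩ := hs; exact hp.post σ
    · rintro p ⟨h1, h2⟩; obtain ⟨q, hq⟩ := chi_perm σ σ.injective p
      exact hn q ⟨SL.of_cc (fun x y => (hq _ _).symm) h1, SL.of_cc (fun x y => (hq _ _).symm) h2⟩
  · rintro ⟨g, σ⟩ hg ⟨g', τ⟩ hg' e; obtain ⟨a, b, -, qh, -, hR, -⟩ := H g (mem_qs.1 (Finset.mem_product.1 hg).1); obtain ⟨-, -, -, -, -, hR', -⟩ := H g' (mem_qs.1 (Finset.mem_product.1 hg').1); have q1 : Q D g := (mem_qs.1 (Finset.mem_product.1 hg).1).1; have q2 : Q D g' := (mem_qs.1 (Finset.mem_product.1 hg').1).1; simp only [Sigma.mk.injEq, heq_eq_eq, Prod.mk.injEq] at e; obtain ⟨eX, eh, eK⟩ := e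
    have e1 : g = g' := by
      funext x
      have := (hR (update x o (g x))).1 (by rw [q1.dep.upd ho, update_self])
      have := (hR' (update x o (g x))).2 (τ.injective (by
        rw [← congrFun eh, ← congrFun eK, this]))
      rw [q2.dep.upd ho, update_self] at this; exact this.symm
    subst e1
    obtain ⟨i, hi⟩ := Finset.card_pos.1 (show 0 < (X g).card by omega)
    have : σ = τ := by
      ext v
      obtain ⟨u, hu⟩ := qh.ex (fun _ => 0) hi v
      have := congrFun eh (update (fun _ => 0) i u)
      rw [hu] at this; rw [this]
    rw [this]
def lst : List ℕ := permc.flatMap fun r0 => (permc.filter fun r1 => djN r0 r1).flatMap fun r1 =>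
    (permc.filter fun r2 => djN r0 r2 && djN r1 r2).flatMap fun r2 =>
    (permc.filter fun r3 => djN r0 r3 && djN r1 r3 && djN r2 r3).map fun r3 =>
      Nat.add (Nat.add r0 (Nat.mul 256 r1)) (Nat.add (Nat.mul 65536 r2) (Nat.mul 16777216 r3))
theorem LS.mem {L : Sq} (h : LS L) : codeS L ∈ lst := by
  have := h.all (fun _ _ => true) (fun n => decide (n ∈ lst)) (fun _ => rfl) (by
    unfold srS; simp only [List.all_eq_true, Bool.or_eq_true, Bool.not_eq_true', ← Bool.not_eq_true, Bool.and_eq_true, true_and, decide_eq_true_eq]; intro r0 m0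
    refine Or.inr fun r1 m1 => ?_
    by_cases h1 : djN r0 r1 = true
    swap
    · exact Or.inl h1
    refine Or.inr fun r2 m2 => ?_
    by_cases h2 : djN r0 r2 = true ∧ djN r1 r2 = true
    swap
    · exact Or.inl h2
    refine Or.inr fun r3 m3 => ?_
    by_cases h3 : (djN r0 r3 = true ∧ djN r1 r3 = true) ∧ djN r2 r3 = true
    swap
    · exact Or.inl h3
    refine Or.inr ?_; unfold lst; rw [List.mem_flatMap]; refine ⟨r0, m0, ?_⟩; rw [List.mem_flatMap]; refine ⟨r1, List.mem_filter.2 ⟨m1, h1⟩, ?_⟩; rw [List.mem_flatMap]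
    refine ⟨r2, List.mem_filter.2 ⟨m2, by simp [h2]⟩, ?_⟩
    exact List.mem_map.2 ⟨r3, List.mem_filter.2 ⟨m3, by simp [h3]⟩, rfl⟩)
  exact of_decide_eq_true this
theorem lst_len : lst.length = 576 := by decide +kernel
theorem lst_np (p : Td) : (lst.filter fun n => !(spN p n)).length = 288 := by revert p; decide +kernel
theorem code_inj {D : Sn} {i j : ℕ} (hD : D = {i, j}) (hij : i ≠ j) : Set.InjOn (fun f => codeS (sqf f i j (fun _ => 0))) {f | Q D f} := by
  intro f hf g hg e
  beta_reduce at e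
  have k : ∀ a b, sqf f i j (fun _ => 0) a b = sqf g i j (fun _ => 0) a b := by
    intro a b; rw [← Fin.val_inj, ← vq_eq, ← vq_eq, e]
  funext x
  have h : ∀ h : Pf, Q D h → h x = sqf h i j (fun _ => 0) (x i) (x j) := by
    intro h qh; apply qh.dep; subst hD; intro l hl; simp only [mem_insert, mem_singleton] at hl; rcases hl with rfl | rfl
    · rw [update_of_ne hij, update_self]
    · rw [update_self]
  rw [h f hf, h g hg, k]
theorem c2 {D : Sn} (h2 : D.card = 2) : nv D ≤ 576 ∧ (∀ p, np p D ≤ 288) ∧ nn D = 0 := by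
  classical
  obtain ⟨i, j, hij, hD⟩ := Finset.card_eq_two.1 h2
  have hi : i ∈ D := by simp [hD]
  have hj : j ∈ D := by simp [hD]
  have sl : ∀ f p, Q D f → Sp p (sqf f i j (fun _ => 0)) → SL p f D := by
    intro f p hf hs
    have key : SepC (cc p f) i j := by
      intro x u v
      have e : PlSep p f i j x := by
        rw [plsep_iff hij]
        convert hs using 1
        funext a b; apply hf.dep; subst hD; intro l hl; simp only [mem_insert, mem_singleton] at hl; rcases hl with rfl | rfl
        · rw [update_of_ne hij, update_self, update_of_ne hij, update_self]
        · rw [update_self, update_self]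
      exact e x Ag.rfl' u v
    intro a ha b hb hab; subst hD; simp only [mem_insert, mem_singleton] at ha hb
    rcases ha with rfl | rfl <;> rcases hb with rfl | rfl
    · exact absurd rfl hab
    · exact key
    · exact key.symm
    · exact absurd rfl hab
  refine ⟨?_, ?_, ?_⟩
  · rw [← lst_len]; refine le_trans ?_ (List.toFinset_card_le lst)
    refine Finset.card_le_card_of_injOn _ ?_ ((code_inj hD hij).mono fun f hf => (mem_qs.1 hf).1)
    intro f hf; simp only [Finset.mem_coe, List.mem_toFinset]; exact ((mem_qs.1 hf).1.ls hi hj hij _).mem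
  · intro p; rw [← lst_np p]; refine le_trans ?_ (List.toFinset_card_le _)
    refine Finset.card_le_card_of_injOn _ ?_ ((code_inj hD hij).mono fun f hf => (mem_qs.1 hf).1)
    intro f hf; obtain ⟨qf, nf⟩ := mem_qs.1 hf; simp only [Finset.mem_coe, List.mem_toFinset, List.mem_filter]; refine ⟨(qf.ls hi hj hij _).mem, ?_⟩; rw [Bool.not_eq_true', ← Bool.not_eq_true, spN_iff]
    exact fun h => nf (sl f p qf h)
  · rw [nn, Finset.card_eq_zero, Finset.eq_empty_iff_forall_notMem]; intro f hf; obtain ⟨qf, nf⟩ := mem_qs.1 hf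
    obtain ⟨p, hp⟩ := L2 (qf.ls hi hj hij (fun _ => 0))
    exact nf p (sl f p qf hp)
def dc (p q : Td) (a b : Bool) : Qd :=
  if chi p 0 = a ∧ chi q 0 = b then 0 else if chi p 1 = a ∧ chi q 1 = b then 1 else if chi p 2 = a ∧ chi q 2 = b then 2 else 3
theorem dc1 : ∀ p q, p ≠ q → ∀ a b, chi p (dc p q a b) = a := by decide
theorem dc2 : ∀ p q, p ≠ q → ∀ a b, chi q (dc p q a b) = b := by decide
theorem p1 : ∀ p : Td, p ≠ p + 1 := by decide
def sm (D : Sn) (φ : D → Qd → Bool) (x : P) : Bool := ∑ i : D, φ i (x i)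
theorem badd (a b : Bool) : a + b = (a ^^ b) := rfl
theorem sm_upd {D : Sn} (φ : D → Qd → Bool) (x : P) {i : ℕ} (hi : i ∈ D) (u : Qd) : sm D φ (update x i u) = (sm D φ x ^^ (φ ⟨i, hi⟩ (x i) ^^ φ ⟨i, hi⟩ u)) := by
  unfold sm
  rw [← Finset.add_sum_erase _ _ (Finset.mem_univ (⟨i, hi⟩ : D)), ← Finset.add_sum_erase (a := ⟨i, hi⟩) _ (fun k : D => φ k (x k)) (Finset.mem_univ _)]
  have : ∑ k ∈ Finset.univ.erase (⟨i, hi⟩ : D), φ k (update x i u k) = ∑ k ∈ Finset.univ.erase (⟨i, hi⟩ : D), φ k (x k) := by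
    apply Finset.sum_congr rfl; intro k hk; rw [update_of_ne]; intro e; exact (Finset.mem_erase.1 hk).1 (Subtype.ext e)
  rw [this]; simp only [update_self, badd]; generalize φ ⟨i, hi⟩ u = a; generalize φ ⟨i, hi⟩ (x i) = b; generalize ∑ k ∈ Finset.univ.erase (⟨i, hi⟩ : D), φ k (x k) = c; revert a b c; decide
theorem sm_dep {D : Sn} (φ : D → Qd → Bool) : Dep D (sm D φ) := fun x y h =>
  Finset.sum_congr rfl fun i _ => by rw [h i i.2]
theorem sm_sep {D : Sn} (φ : D → Qd → Bool) (c0 : Bool) {c : P → Bool} (hc : ∀ x, c x = (c0 ^^ sm D φ x)) {i j : ℕ} (hi : i ∈ D) (hj : j ∈ D) (hij : i ≠ j) : SepC c i j := by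
  intro x u v; unfold odd; simp only [hc, sm_upd _ _ hi, sm_upd _ _ hj, update_of_ne hij.symm]; generalize sm D φ x = t1; generalize φ _ u = t2; generalize φ _ v = t3; generalize φ _ (x i) = t4; generalize φ _ (x j) = t5
  clear hc
  revert t1 t2 t3 t4 t5 c0; decide
def mk (D : Sn) (p : Td) (z : Bool × (D → Td) × ((D → Bool) → Bool)) (x : P) : Qd :=
  dc p (p + 1) (z.1 ^^ sm D (fun i => chi (z.2.1 i)) x)
    (z.2.2 (fun i => chi (z.2.1 i) (x i)) ^^ sm D (fun i => chi (z.2.1 i + 1)) x)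
theorem mk1 {D : Sn} {p : Td} {z : Bool × (D → Td) × ((D → Bool) → Bool)} (x : P) : chi p (mk D p z x) = (z.1 ^^ sm D (fun i => chi (z.2.1 i)) x) := dc1 _ _ (p1 p) _ _
theorem mk2 {D : Sn} {p : Td} {z : Bool × (D → Td) × ((D → Bool) → Bool)} (x : P) : chi (p + 1) (mk D p z x) = (z.2.2 (fun i => chi (z.2.1 i) (x i)) ^^ sm D (fun i => chi (z.2.1 i + 1)) x) := dc2 _ _ (p1 p) _ _
theorem xc {a b c : Bool} : (a ^^ b) = (a ^^ c) ↔ b = c := by revert a b c; decide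
theorem xr {a b c : Bool} : (a ^^ c) = (b ^^ c) ↔ a = b := by revert a b c; decide
theorem mk_Q {D : Sn} {p : Td} (z : Bool × (D → Td) × ((D → Bool) → Bool)) : Q D (mk D p z) where
  dep := fun x y h => by
    unfold mk; rw [sm_dep _ x y h, sm_dep _ x y h]
    have : (fun i : D => chi (z.2.1 i) (x i)) = fun i : D => chi (z.2.1 i) (y i) := by funext i; rw [h i i.2]
    rw [this]
  inj := fun x i hi u v e => by
    beta_reduce at e
    have e1 := congrArg (chi p) e; rw [mk1, mk1, sm_upd _ _ hi, sm_upd _ _ hi, xc, xc, xc] at e1; have e2 := congrArg (chi (p + 1)) e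
    have : (fun k : D => chi (z.2.1 k) (update x i u k)) = (fun k : D => chi (z.2.1 k) (update x i v k)) := by
      funext k
      by_cases hk : (k : ℕ) = i
      · obtain rfl : k = ⟨i, hi⟩ := Subtype.ext hk
        simpa using e1
      · rw [update_of_ne hk, update_of_ne hk]
    rw [mk2, mk2, sm_upd _ _ hi, sm_upd _ _ hi, this, xc, xc, xc] at e2; exact chi_sep _ _ _ _ (p1 _) e1 e2
theorem mk_SL {D : Sn} {p : Td} (z : Bool × (D → Td) × ((D → Bool) → Bool)) : SL p (mk D p z) D :=
  fun _ hi _ hj hij => sm_sep _ z.1 (fun x => mk1 x) hi hj hij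
theorem sm_inj {D : Sn} {c c' : Bool} {t t' : D → Td} (e : ∀ x, (c ^^ sm D (fun i => chi (t i)) x) = (c' ^^ sm D (fun i => chi (t' i)) x)) : c = c' ∧ t = t' := by
  have k : ∀ q q' : Td, (∀ u, (chi q 0 ^^ chi q u) = (chi q' 0 ^^ chi q' u)) → q = q' := by decide
  have ht : t = t' := by
    funext i; apply k; intro u
    have h0 := e (fun _ => 0)
    have h1 := e (update (fun _ => 0) i u)
    rw [sm_upd _ _ i.2, sm_upd _ _ i.2] at h1
    clear e
    revert h0 h1; generalize sm D _ _ = a; generalize sm D _ _ = b; simp only [Subtype.coe_eta]; generalize (chi (t i) 0 ^^ chi (t i) u) = a'; generalize (chi (t' i) 0 ^^ chi (t' i) u) = b'; revert a b a' b' c c'; decide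
  subst ht
  exact ⟨xr.1 (e fun _ => 0), rfl⟩
theorem mk_inj {D : Sn} {p : Td} : Injective (mk D p) := by
  rintro ⟨c, t, s⟩ ⟨c', t', s'⟩ e
  have h1 : ∀ x, (c ^^ sm D (fun i => chi (t i)) x) = (c' ^^ sm D (fun i => chi (t' i)) x) := fun x => by
    have := congrArg (chi p) (congrFun e x); rwa [mk1, mk1] at this
  obtain ⟨rfl, rfl⟩ := sm_inj h1
  congr 2
  funext b
  have := congrArg (chi (p + 1)) (congrFun e fun i => if h : i ∈ D then dc (t ⟨i, h⟩) (t ⟨i, h⟩ + 1) (b ⟨i, h⟩) false else 0)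
  rw [mk2, mk2, xr] at this; simp only [Finset.coe_mem, dite_true, Subtype.coe_eta, dc1 _ _ (p1 _)] at this; exact this
theorem SL.lin {D : Sn} {p : Td} {f : Pf} (qf : Q D f) (hs : SL p f D) : ∃ z : Bool × (D → Td), ∀ x, cc p f x = (z.1 ^^ sm D (fun i => chi (z.2 i)) x) := by
  classical
  have h1 : ∀ i : D, ∃ q, ∀ a b, (cc p f (update (fun _ => 0) i a) ^^ cc p f (update (fun _ => 0) i b)) = (chi q a ^^ chi q b) := fun i => chi_perm _ (qf.inj (fun _ => 0) i i.2) p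
  choose t ht using h1
  have hd : Dep D (cc p f) := fun x y h => by unfold cc; rw [qf.dep x y h]
  have h2 : ∀ (i : D) x u, cc p f (update x i u) = (cc p f x ^^ (chi (t i) (x i) ^^ chi (t i) u)) := by
    intro i x u
    have := sep_split (X := {(i : ℕ)}) hd (by
      intro a ha b hb; obtain rfl := Finset.mem_singleton.1 ha; have := Finset.mem_sdiff.1 hb
      exact hs _ i.2 _ this.1 fun e => this.2 (by simp [e])) x (fun _ => u) x (fun _ => 0)
    simp only [Finset.piecewise_singleton, update_eq_self, ht] at this; rw [← this]; generalize cc p f x = a; generalize cc p f _ = b; revert a b; decide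
  refine ⟨(cc p f (fun _ => 0) ^^ sm D (fun i => chi (t i)) (fun _ => 0), t), fun y => ?_⟩
  refine walk D (fun x => cc p f x = ((cc p f (fun _ => 0) ^^ sm D (fun i => chi (t i)) (fun _ => 0)) ^^ sm D (fun i => chi (t i)) x)) ?_
    (D.piecewise (fun _ => 0) y) y (fun i hi => by simp [hi]) ?_
  · intro x k hk v hx
    beta_reduce at hx ⊢
    rw [h2 ⟨k, hk⟩, sm_upd _ _ hk, hx, Bool.xor_assoc]
  · have e1 := hd (D.piecewise (fun _ => 0) y) (fun _ => 0) (fun i hi => by simp [hi])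
    have e2 := sm_dep (fun i => chi (t i)) (D.piecewise (fun _ => 0) y) (fun _ => 0) (fun i hi => by simp [hi])
    beta_reduce
    rw [e1, e2]; simp
theorem mk_surj {D : Sn} {p : Td} {f : Pf} (qf : Q D f) (hs : SL p f D) : ∃ z, mk D p z = f := by
  classical
  obtain ⟨⟨c, t⟩, hz⟩ := SL.lin qf hs
  let G : P → Bool := fun x => chi (p + 1) (f x) ^^ sm D (fun i => chi (t i + 1)) x
  have hG : Dep D G := fun x y h => by
    show (_ ^^ _) = (_ ^^ _)
    rw [qf.dep x y h, sm_dep _ x y h]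
  have st : ∀ x i (hi : i ∈ D) u, chi (t ⟨i, hi⟩) u = chi (t ⟨i, hi⟩) (x i) → G (update x i u) = G x := by
    intro x i hi u h
    by_cases hu : u = x i
    · rw [hu, update_eq_self]
    show (_ ^^ _) = (_ ^^ _)
    have e0 : chi p (f (update x i u)) = chi p (f x) := by
      have := hz (update x i u); rw [sm_upd _ _ hi, h, Bool.xor_self, Bool.xor_false, ← hz] at this; exact this
    have e1 : chi (p + 1) (f (update x i u)) ≠ chi (p + 1) (f x) := fun e =>
      hu (qf.eq' x hi (chi_sep _ _ _ _ (p1 _) e0 e))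
    have e2 : chi (t ⟨i, hi⟩ + 1) u ≠ chi (t ⟨i, hi⟩ + 1) (x i) := fun e =>
      hu (chi_sep _ _ _ _ (p1 _) h e)
    rw [sm_upd _ _ hi]; revert e1 e2; generalize chi (p + 1) _ = a1; generalize chi (p + 1) _ = a2; generalize chi (t _ + 1) _ = a3; generalize chi (t _ + 1) _ = a4; generalize sm _ _ _ = a5; revert a1 a2 a3 a4 a5; decide
  let rp : (D → Bool) → P := fun b i => if h : i ∈ D then dc (t ⟨i, h⟩) (t ⟨i, h⟩ + 1) (b ⟨i, h⟩) false else 0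
  have key : ∀ x, G (rp fun i => chi (t i) (x i)) = G x := by
    intro x
    set y := rp fun i => chi (t i) (x i)
    have hy : ∀ i (hi : i ∈ D), chi (t ⟨i, hi⟩) (y i) = chi (t ⟨i, hi⟩) (x i) := by
      intro i hi; simp only [y, rp, hi, dite_true]; exact dc1 _ _ (p1 _) _ _
    have := walk (α := Bool) D (fun b => G (fun i => if b i then y i else x i) = G x) (by
      intro b k hk v hb
      beta_reduce at hb ⊢
      rw [← hb]
      have e : (fun i => if update b k v i then y i else x i) = update (fun i => if b i then y i else x i) k (if v then y k else x k) := by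
        funext l
        by_cases hl : l = k
        · subst hl; simp
        · simp [update_of_ne hl]
      rw [e]; apply st _ _ hk; have := hy k hk
      cases v <;> cases b k <;> simp [this]) (fun _ => false) (D.piecewise (fun _ => true) (fun _ => false))
      (fun i hi => by simp [hi]) (by simp)
    beta_reduce at this
    rw [← this]; apply hG; intro i hi; simp [hi]
  refine ⟨⟨c, t, fun b => G (rp b)⟩, ?_⟩
  funext x; apply chi_sep _ _ _ _ (p1 p)
  · rw [mk1]; exact (hz x).symm
  · rw [mk2]; dsimp only; rw [key]
    show ((_ ^^ _) ^^ _) = _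
    simp
theorem ps_eq (p : Td) (D : Sn) : ps p D = 2 * (3 ^ D.card * 2 ^ 2 ^ D.card) := by
  classical
  have : qs D (fun f => SL p f D) = Finset.univ.image (mk D p) := by
    ext f; rw [mem_qs, Finset.mem_image]
    constructor
    · rintro ⟨a, b⟩; obtain ⟨z, hz⟩ := mk_surj a b; exact ⟨z, Finset.mem_univ _, hz⟩
    · rintro ⟨z, -, rfl⟩; exact ⟨mk_Q z, mk_SL z⟩
  rw [ps, this, Finset.card_image_of_injective _ mk_inj]; simp
theorem pq_le {p q : Td} (hpq : p ≠ q) (D : Sn) : (qs D fun f => SL p f D ∧ SL q f D).card ≤ (2 * 3 ^ D.card) ^ 2 := by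
  classical
  have : qs D (fun f => SL p f D ∧ SL q f D) ⊆ Finset.univ.image (fun (z : (Bool × (D → Td)) × (Bool × (D → Td))) (x : P) =>
      dc p q (z.1.1 ^^ sm D (fun i => chi (z.1.2 i)) x) (z.2.1 ^^ sm D (fun i => chi (z.2.2 i)) x)) := by
    intro f hf; obtain ⟨qf, h1, h2⟩ := mem_qs.1 hf; obtain ⟨z1, e1⟩ := h1.lin qf; obtain ⟨z2, e2⟩ := h2.lin qf; refine Finset.mem_image.2 ⟨(z1, z2), Finset.mem_univ _, ?_⟩; funext x
    beta_reduce
    rw [← e1, ← e2]; exact chi_sep p q _ _ hpq (dc1 _ _ hpq _ _) (dc2 _ _ hpq _ _)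
  refine (card_le_card this).trans (Finset.card_image_le.trans (le_of_eq ?_)); simp [sq]
def pn (m : ℕ) : ℕ := 2 * (3 ^ m * 2 ^ 2 ^ m)
theorem sl_le (D : Sn) : (qs D fun f => ∃ p, SL p f D).card ≤ 3 * pn D.card := by
  classical
  have : qs D (fun f => ∃ p, SL p f D) ⊆ (Finset.univ : Finset (Td)).biUnion fun p => qs D fun f => SL p f D := by
    intro f hf; obtain ⟨a, p, b⟩ := mem_qs.1 hf; exact Finset.mem_biUnion.2 ⟨p, Finset.mem_univ _, mem_qs.2 ⟨a, b⟩⟩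
  refine (card_le_card this).trans (Finset.card_biUnion_le.trans (le_of_eq ?_))
  change ∑ p : Td, ps p D = _
  simp [ps_eq, pn]
theorem nv_le (D : Sn) : nv D ≤ nn D + 3 * pn D.card := by
  classical
  refine le_trans ?_ (Nat.add_le_add_left (sl_le D) _); refine le_trans (card_le_card ?_) (card_union_le _ _); intro f hf; have := (mem_qs.1 hf).1; rw [mem_union, mem_qs, mem_qs]
  by_cases h : ∃ p, SL p f D
  · exact Or.inr ⟨this, h⟩
  · exact Or.inl ⟨this, fun p hp => h ⟨p, hp⟩⟩
theorem np_le (p : Td) (D : Sn) : np p D ≤ nn D + 2 * pn D.card := by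
  classical
  have e : ∀ p : Td, p + 1 ≠ p ∧ p + 2 ≠ p ∧ ∀ q, q = p ∨ q = p + 1 ∨ q = p + 2 := by decide
  have : nn D + 2 * pn D.card = nn D + (ps (p + 1) D + ps (p + 2) D) := by rw [ps_eq, ps_eq, ← pn]; ring
  rw [this]; refine le_trans ?_ (Nat.add_le_add_left (card_union_le _ _) _); refine le_trans (card_le_card ?_) (card_union_le _ _); intro f hf; obtain ⟨qf, hp⟩ := mem_qs.1 hf; rw [mem_union, mem_union, mem_qs, mem_qs, mem_qs]
  by_cases h : ∃ p, SL p f D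
  · obtain ⟨q, hq⟩ := h; rcases (e p).2.2 q with rfl | rfl | rfl
    · exact absurd hq hp
    · exact Or.inr (Or.inl ⟨qf, hq⟩)
    · exact Or.inr (Or.inr ⟨qf, hq⟩)
  · exact Or.inl ⟨qf, fun p hp => h ⟨p, hp⟩⟩
theorem U1 (D : Sn) (o : ℕ) (A : Sn) : (UU D o A).card ≤ nv A * nv (insert o (D \ A)) := by
  classical
  rw [nv, nv, ← Finset.card_product]; exact Finset.card_filter_le _ _
theorem U2 (D : Sn) (o : ℕ) {A : Sn} (hA : A.card = 2) : (UU D o A).card ≤ 576 * nn (insert o (D \ A)) + 288 * (qs (insert o (D \ A)) fun f => ∃ p, SL p f (insert o (D \ A))).card := by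
  classical
  set B := insert o (D \ A) with hB
  obtain ⟨v, n, -⟩ := c2 hA
  have : UU D o A ⊆ (qs A (fun _ => True) ×ˢ qs B fun f => NS f B) ∪
      (qs B fun f => ∃ p, SL p f B).biUnion fun K => (qs A fun h => ∀ p, SL p K B → ¬ SL p h A) ×ˢ {K} := by
    rintro ⟨h, K⟩ hz; simp only [UU, mem_filter, mem_product, mem_qs] at hz; rw [← hB] at hz; obtain ⟨⟨⟨qh, -⟩, qK, -⟩, -, hn⟩ := hz; simp only [mem_union, mem_product, mem_qs, Finset.mem_biUnion, mem_singleton]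
    by_cases hK : ∃ p, SL p K B
    · exact Or.inr ⟨K, ⟨qK, hK⟩, ⟨qh, fun p h1 h2 => hn p ⟨h2, h1⟩⟩, rfl⟩
    · exact Or.inl ⟨⟨qh, trivial⟩, qK, fun p hp => hK ⟨p, hp⟩⟩
  refine (card_le_card this).trans ((card_union_le _ _).trans (Nat.add_le_add ?_ ?_))
  · rw [Finset.card_product]; exact Nat.mul_le_mul_right _ v
  · rw [mul_comm]
    refine Finset.card_biUnion_le_card_mul _ _ _ fun K hK => ?_
    obtain ⟨-, p, hp⟩ := mem_qs.1 hK; rw [Finset.card_product, Finset.card_singleton, mul_one]; refine le_trans (card_le_card ?_) (n p); intro f hf; have := mem_qs.1 hf; exact mem_qs.2 ⟨this.1, this.2 p hp⟩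
theorem U3 (D : Sn) (o : ℕ) (A : Sn) {N : ℕ} (hN : ∀ p, np p (insert o (D \ A)) ≤ N) : (UU D o A).card ≤ 3 * (pn A.card * N) := by
  classical
  set B := insert o (D \ A) with hB
  have : UU D o A ⊆ (Finset.univ : Finset (Td)).biUnion fun p => (qs A fun h => SL p h A) ×ˢ qs B fun K => ¬ SL p K B := by
    rintro ⟨h, K⟩ hz; simp only [UU, mem_filter, mem_product, mem_qs] at hz; rw [← hB] at hz; obtain ⟨⟨⟨qh, -⟩, qK, -⟩, ⟨p, hp⟩, hn⟩ := hz; simp only [Finset.mem_biUnion, mem_product, mem_qs]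
    exact ⟨p, Finset.mem_univ _, ⟨qh, hp⟩, qK, fun h => hn p ⟨hp, h⟩⟩
  refine (card_le_card this).trans ?_
  refine Finset.card_biUnion_le_card_mul _ _ _ fun p _ => ?_
  rw [Finset.card_product]; exact Nat.mul_le_mul (ps_eq p A).le (hN p)
theorem rec2 {D : Sn} (h2 : 2 ≤ D.card) (F : ℕ → ℕ) (hF : ∀ A B o, 2 ≤ A.card → A.card < D.card → B = insert o (D \ A) → B.card + A.card = D.card + 1 → (UU D o A).card ≤ F A.card) : nn D * 24 ≤ ∑ k ∈ Finset.range (D.card + 1), D.card.choose k * (if 2 ≤ k ∧ k < D.card then F k else 0) := by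
  obtain ⟨o, ho⟩ := Infinite.exists_notMem_finset D; refine (rec1 ho h2).trans ?_
  have := Finset.sum_powerset_apply_card (x := D) (fun k => if 2 ≤ k ∧ k < D.card then F k else 0)
  simp only [smul_eq_mul] at this; rw [← this, al, Finset.sum_filter]; apply Finset.sum_le_sum; intro A hA
  split_ifs with h
  · refine hF A _ o h.1 h.2 rfl ?_; have hA := Finset.mem_powerset.1 hA
    rw [card_insert_of_notMem (fun h => ho (Finset.mem_sdiff.1 h).1), Finset.card_sdiff_of_subset hA]
    omega
  · exact le_rfl
theorem n3 {D : Sn} (h : D.card = 3) : nn D ≤ 20736 := by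
  have := rec2 (by omega) (fun _ => 288 * 576) (D := D) (by
    intro A B o h1 h2 hB hc
    refine (U2 D o (by omega)).trans ?_
    rw [← hB, (c2 (D := B) (by omega)).2.2]
    have : (qs B fun f => ∃ p, SL p f B).card ≤ nv B := card_le_card fun f hf => mem_qs.2 ⟨(mem_qs.1 hf).1, trivial⟩
    have := (c2 (D := B) (by omega)).1
    omega)
  rw [h] at this; simp [Finset.sum_range_succ, Nat.choose] at this; omega
theorem n4 {D : Sn} (h : D.card = 4) : nn D ≤ 7962624 := by
  have := rec2 (by omega) (fun k => if k = 2 then 576 * 20736 + 288 * (3 * 13824) else 3 * (13824 * 288)) (D := D) (by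
    intro A B o h1 h2 hB hc
    split_ifs with h3
    · refine (U2 D o h3).trans ?_; rw [← hB]
      have e1 := n3 (D := B) (by omega)
      have e2 := sl_le B
      rw [show B.card = 3 by omega, show pn 3 = 13824 by decide] at e2
      omega
    · refine (U3 D o A (by rw [← hB]; exact (c2 (by omega)).2.1)).trans ?_
      rw [show A.card = 3 by omega]; decide)
  rw [h] at this; simp [Finset.sum_range_succ, Nat.choose] at this; omega
theorem n5 {D : Sn} (h : D.card = 5) : nn D ≤ 2 ^ 33 := by
  have := rec2 (by omega) (fun k => if k = 2 then 576 * 7962624 + 288 * (3 * 10616832) else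
      if k = 3 then 3 * (13824 * (20736 + 2 * 13824)) else 3 * (10616832 * 288)) (D := D) (by
    intro A B o h1 h2 hB hc
    split_ifs with h3 h4
    · refine (U2 D o h3).trans ?_; rw [← hB]
      have e1 := n4 (D := B) (by omega)
      have e2 := sl_le B
      rw [show B.card = 4 by omega, show pn 4 = 10616832 by decide] at e2
      omega
    · refine (U3 D o A (N := 20736 + 2 * 13824) (by
        rw [← hB]; intro p; have e1 := np_le p B
        have e2 := n3 (D := B) (by omega)
        rw [show B.card = 3 by omega, show pn 3 = 13824 by decide] at e1
        omega)).trans ?_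
      rw [h4]; decide
    · refine (U3 D o A (by rw [← hB]; exact (c2 (by omega)).2.1)).trans ?_
      rw [show A.card = 4 by omega]; decide)
  rw [h] at this; simp [Finset.sum_range_succ, Nat.choose] at this; omega
theorem pow_bd (m : ℕ) : 3 ^ (m + 1) + 1 ≤ 2 ^ (2 * m + 2) := by
  have : (3 : ℕ) ^ (m + 1) < 4 ^ (m + 1) := Nat.pow_lt_pow_left (by norm_num) (by omega)
  rw [show 2 * m + 2 = 2 * (m + 1) by ring, pow_mul]; exact this
theorem pn3 (n : ℕ) : 3 * pn n = 3 ^ (n + 1) * 2 ^ (2 ^ n + 1) := by unfold pn; rw [pow_succ, pow_succ]; ring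
theorem nv_gen {D : Sn} (h : nn D ≤ 2 ^ (2 ^ D.card + 1)) : nv D ≤ (3 ^ (D.card + 1) + 1) * 2 ^ (2 ^ D.card + 1) := by
  have := nv_le D; rw [pn3] at this; rw [add_mul]; omega
theorem nv_gen2 {D : Sn} (h : nn D ≤ 2 ^ (2 ^ D.card + 1)) : nv D ≤ 2 ^ (2 ^ D.card + 2 * D.card + 3) := by
  refine (nv_gen h).trans ((Nat.mul_le_mul_right _ (pow_bd _)).trans (le_of_eq ?_)); rw [← pow_add]; congr 1; ring
theorem ex_bd (n : ℕ) (hn : 6 ≤ n) : 3 * n + 11 ≤ 2 ^ (n - 1) := by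
  induction n, hn using Nat.le_induction with
  | base => norm_num
  | succ n h ih =>
    obtain ⟨m, rfl⟩ : ∃ m, n = m + 1 := ⟨n - 1, by omega⟩
    simp only [Nat.add_sub_cancel] at ih ⊢; rw [pow_succ]; omega
theorem upper (n : ℕ) : ∀ D : Sn, D.card = n → 2 ≤ n → (5 ≤ n → nn D ≤ 2 ^ (2 ^ n + 1)) ∧ nv D ≤ 2 ^ (2 ^ n + 2 * n + 3) := by
  induction n using Nat.strong_induction_on with
  | _ n ih =>
  intro D hD h2; rcases Nat.lt_or_ge n 5 with h5 | h5
  · refine ⟨fun h => absurd h (by omega), ?_⟩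
    have := nv_le D; rw [hD] at this
    obtain rfl | rfl | rfl : n = 2 ∨ n = 3 ∨ n = 4 := by omega
    · exact (c2 hD).1.trans (by norm_num)
    · have := n3 hD
      rw [show pn 3 = 13824 by decide] at *
      norm_num; omega
    · have := n4 hD
      rw [show pn 4 = 10616832 by decide] at *
      norm_num; omega
  suffices h : nn D ≤ 2 ^ (2 ^ n + 1) from ⟨fun _ => h, by subst hD; exact nv_gen2 h⟩
  obtain rfl | h6 : n = 5 ∨ 6 ≤ n := by omega
  · exact n5 hD
  have := rec2 (by omega) (fun k => 2 ^ (2 ^ (n - 1) + 2 * n + 12)) (D := D) (by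
    intro A B o h1 h2 hB hc; refine (U1 D o A).trans ?_; rw [← hB]
    have e1 := (ih A.card (by omega) A rfl h1).2
    have e2 := (ih B.card (by omega) B rfl (by omega)).2
    refine (Nat.mul_le_mul e1 e2).trans ?_; rw [← pow_add]
    apply Nat.pow_le_pow_right (by norm_num)
    obtain ⟨a, ha⟩ : ∃ a, A.card = a + 2 := ⟨A.card - 2, by omega⟩
    obtain ⟨b, hb⟩ : ∃ b, B.card = b + 2 := ⟨B.card - 2, by omega⟩
    rw [ha, hb, show n - 1 = a + b + 2 by omega]
    have k1 := Nat.one_le_two_pow (n := a); have k2 := Nat.one_le_two_pow (n := b)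
    have : 2 ^ (a + 2) + 2 ^ (b + 2) ≤ 2 ^ (a + b + 2) + 4 := by
      rw [pow_add, pow_add, pow_add, pow_add]; nlinarith
    omega)
  rw [hD] at this
  have s : ∑ k ∈ Finset.range (n + 1), n.choose k * (if 2 ≤ k ∧ k < n then 2 ^ (2 ^ (n - 1) + 2 * n + 12) else 0) ≤
      2 ^ n * 2 ^ (2 ^ (n - 1) + 2 * n + 12) := by
    rw [← Nat.sum_range_choose n, Finset.sum_mul]; apply Finset.sum_le_sum; intro k _; apply Nat.mul_le_mul_left; split_ifs
    · exact le_rfl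
    · exact Nat.zero_le _
  refine (Nat.le_mul_of_pos_right _ (by norm_num)).trans ((this.trans s).trans ?_)
  rw [← pow_add]
  apply Nat.pow_le_pow_right (by norm_num)
  have := ex_bd n h6
  have : 2 ^ n = 2 * 2 ^ (n - 1) := by rw [← pow_succ']; congr 1; omega
  omega
theorem odd_pos {E : Sn} {o : ℕ} (ho : o ∉ E) {k : Pf} (qk : Q E k) (p : Td) (hs : SL p (fun x => k x + x o) (insert o E)) : SL p k E := by
  intro i hi j hj hij x u v
  have hio : o ≠ i := by rintro rfl; exact ho hi
  have hjo : o ≠ j := by rintro rfl; exact ho hj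
  have := hs i (by simp [hi]) j (by simp [hj]) hij (update x o 0) u v
  have hd : Dep E (cc p k) := fun x y h => by unfold cc; rw [qk.dep x y h]
  rw [odd_dep hd x (update x o 0) (fun l hl => by rw [update_of_ne]; rintro rfl; exact ho hl)]
  rw [← this]; simp [odd, cc, update_of_ne hio, update_of_ne hjo]
theorem not0 {E : Sn} {o : ℕ} (ho : o ∉ E) {k : Pf} (qk : Q E k) (hE : E.Nonempty) : ¬ SL 0 (fun x => k x + x o) (insert o E) := by
  intro hs; obtain ⟨i, hi⟩ := hE
  have hio : o ≠ i := by rintro rfl; exact ho hi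
  obtain ⟨a, ha⟩ := qk.ex (fun _ => 0) hi 0
  obtain ⟨b, hb⟩ := qk.ex (fun _ => 0) hi 1
  have := hs i (by simp [hi]) o (by simp) hio.symm (update (fun _ => 0) i a) b 1
  simp [odd, cc, update_of_ne hio, qk.dep.upd ho, ha, hb] at this; revert this; decide
theorem ext_Q {E : Sn} {o : ℕ} (ho : o ∉ E) {k : Pf} (qk : Q E k) : Q (insert o E) (fun x => k x + x o) where
  dep := fun x y h => by
    beta_reduce
    rw [qk.dep x y (fun i hi => h i (by simp [hi])), h o (by simp)]
  inj := fun x i hi u v e => by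
    beta_reduce at e
    rcases Finset.mem_insert.1 hi with rfl | hi
    · simpa [qk.dep.upd ho] using e
    · have hio : o ≠ i := by rintro rfl; exact ho hi
      rw [update_of_ne hio, update_of_ne hio] at e; exact qk.inj x i hi (add_right_cancel e)
theorem nn_ge {E : Sn} {o : ℕ} (ho : o ∉ E) (hE : E.Nonempty) : pn E.card ≤ nn (insert o E) + 8 * 9 ^ E.card := by
  classical
  have h1 : (qs E fun k => SL 0 k E ∧ ¬ SL 1 k E ∧ ¬ SL 2 k E).card ≤ nn (insert o E) := by
    refine Finset.card_le_card_of_injOn (fun k x => k x + x o) ?_ ?_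
    · intro k hk; obtain ⟨qk, -, k1, k2⟩ := mem_qs.1 hk
      refine mem_qs.2 ⟨ext_Q ho qk, fun p hp => ?_⟩
      match p, hp with
      | 0, hp => exact not0 ho qk hE hp
      | 1, hp => exact k1 (odd_pos ho qk 1 hp)
      | 2, hp => exact k2 (odd_pos ho qk 2 hp)
    · intro k hk k' hk' e; have qk : Q E k := (mem_qs.1 hk).1; have qk' : Q E k' := (mem_qs.1 hk').1; funext x; have := congrFun e (update x o 0)
      simpa [qk.dep.upd ho, qk'.dep.upd ho] using this
  have h2 : ps 0 E ≤ (qs E fun k => SL 0 k E ∧ ¬ SL 1 k E ∧ ¬ SL 2 k E).card +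
      ((qs E fun k => SL 0 k E ∧ SL 1 k E).card + (qs E fun k => SL 0 k E ∧ SL 2 k E).card) := by
    refine le_trans ?_ (Nat.add_le_add_left (card_union_le _ _) _); refine le_trans (card_le_card ?_) (card_union_le _ _); intro f hf; obtain ⟨a, b⟩ := mem_qs.1 hf; simp only [mem_union, mem_qs]; tauto
  have h3 := pq_le (p := 0) (q := 1) (by decide) E
  have h4 := pq_le (p := 0) (q := 2) (by decide) E
  have h5 : (2 * 3 ^ E.card) ^ 2 = 4 * 9 ^ E.card := by
    rw [mul_pow, ← pow_mul, mul_comm E.card, pow_mul]; norm_num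
  have h6 : ps 0 E = pn E.card := ps_eq 0 E; omega
theorem nv_ge (D : Sn) : 3 * pn D.card + nn D ≤ nv D + 12 * 9 ^ D.card := by
  classical
  have e : ∀ p, (qs D fun f => SL p f D).card = pn D.card := fun p => ps_eq p D
  have h5 : (2 * 3 ^ D.card) ^ 2 = 4 * 9 ^ D.card := by
    rw [mul_pow, ← pow_mul, mul_comm D.card, pow_mul]; norm_num
  have h01 := pq_le (p := 0) (q := 1) (by decide) D
  have h02 := pq_le (p := 0) (q := 2) (by decide) D
  have h12 := pq_le (p := 1) (q := 2) (by decide) D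
  have i1 := Finset.card_union_add_card_inter (qs D fun f => SL 0 f D) (qs D fun f => SL 1 f D)
  have i2 := Finset.card_union_add_card_inter ((qs D fun f => SL 0 f D) ∪ (qs D fun f => SL 1 f D)) (qs D fun f => SL 2 f D)
  have j1 : ((qs D fun f => SL 0 f D) ∩ (qs D fun f => SL 1 f D)).card ≤ (qs D fun k => SL 0 k D ∧ SL 1 k D).card :=
    card_le_card fun f hf => by simp only [Finset.mem_inter, mem_qs] at hf ⊢; tauto
  have j2 : (((qs D fun f => SL 0 f D) ∪ (qs D fun f => SL 1 f D)) ∩ (qs D fun f => SL 2 f D)).card ≤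
      (qs D fun k => SL 0 k D ∧ SL 2 k D).card + (qs D fun k => SL 1 k D ∧ SL 2 k D).card :=
    le_trans (card_le_card fun f hf => by
      simp only [Finset.mem_inter, mem_union, mem_qs] at hf ⊢; tauto) (card_union_le _ _)
  have k : (((qs D fun f => SL 0 f D) ∪ (qs D fun f => SL 1 f D)) ∪ (qs D fun f => SL 2 f D)).card + nn D ≤ nv D := by
    rw [nn, nv, ← card_union_of_disjoint]
    · apply card_le_card; intro f hf; simp only [mem_union, mem_qs] at hf ⊢; tauto
    · rw [Finset.disjoint_left]; intro f hf hn; have := (mem_qs.1 hn).2; simp only [mem_union, mem_qs] at hf; rcases hf with (h | h) | h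
      · exact this 0 h.2
      · exact this 1 h.2
      · exact this 2 h.2
  rw [e 0, e 1] at i1; rw [e 2] at i2; omega
theorem num_bd (m : ℕ) (hm : 4 ≤ m) : 58 * 3 ^ m ≤ 2 ^ 2 ^ m := by
  induction m, hm using Nat.le_induction with
  | base => norm_num
  | succ m h ih =>
    have : 3 ≤ 3 ^ m := Nat.le_self_pow (by omega) 3
    rw [pow_succ 2 m, pow_mul, pow_succ]
    nlinarith
theorem lower {D : Sn} (h5 : 5 ≤ D.card) : 3 * pn D.card ≤ nv D := by
  obtain ⟨o, hoD⟩ := Finset.card_pos.1 (show 0 < D.card by omega)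
  have hc := Finset.card_erase_of_mem hoD
  have h1 := nn_ge (Finset.notMem_erase o D) (Finset.card_pos.1 (by omega))
  rw [Finset.insert_erase hoD] at h1; have h2 := nv_ge D
  have hn : D.card = (D.erase o).card + 1 := by omega
  have h3 := num_bd (D.erase o).card (by omega)
  have h4 : 12 * 9 ^ D.card + 8 * 9 ^ (D.erase o).card ≤ pn (D.erase o).card := by
    rw [hn]; generalize (D.erase o).card = m at *
    rw [pn, show (9 : ℕ) = 3 * 3 by norm_num, mul_pow, mul_pow, pow_succ]
    have : 0 < 3 ^ m := by positivity
    nlinarith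
  omega
theorem upd_fin {n : ℕ} (x : P) (i : Fin n) (v : Qd) : (fun j : Fin n => update x i v j) = update (fun j : Fin n => x j) i v := by
  funext j
  by_cases h : j = i
  · subst h; simp
  · rw [update_of_ne h, update_of_ne (fun e => h (Fin.ext e))]
theorem transfer (n : ℕ) : Nat.card {f : (Fin n → V4) → V4 // IsNQuasigroup f} = nv (Finset.range n) := by
  have hQ : ∀ f : (Fin n → V4) → V4, IsNQuasigroup f → Q (Finset.range n) (fun x => f fun i => x i) := by
    intro f hf
    refine ⟨fun x y h => ?_, fun x i hi u v e => ?_⟩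
    · beta_reduce; congr 1; funext i; exact h i (by simp)
    · have hi := Finset.mem_range.1 hi
      beta_reduce at e
      have k := fun v => upd_fin x ⟨i, hi⟩ v
      dsimp only at k
      rw [k, k] at e
      exact (hf (fun j => x j) ⟨i, hi⟩ _).unique e rfl
  have : Nat.card {f : (Fin n → V4) → V4 // IsNQuasigroup f} = Nat.card (qs (Finset.range n) fun _ => True) := by
    refine Nat.card_eq_of_bijective (fun f => ⟨fun x => f.1 fun i => x i, mem_qs.2 ⟨hQ f.1 f.2, trivial⟩⟩) ⟨?_, ?_⟩
    · intro f g e; apply Subtype.ext; funext y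
      have := congrFun (congrArg Subtype.val e) (fun i => if h : i < n then y ⟨i, h⟩ else 0)
      simpa using this
    · rintro ⟨g, hg⟩; have qg := (mem_qs.1 hg).1
      have key : ∀ x, g (fun i => if h : i < n then (fun j : Fin n => x j) ⟨i, h⟩ else 0) = g x := by
        intro x; apply qg.dep; intro i hi; simp [Finset.mem_range.1 hi]
      have ku : ∀ (a : Fin n → Qd) (i : Fin n) v, (fun l => if h : l < n then update a i v ⟨l, h⟩ else 0) =
          update (fun l => if h : l < n then a ⟨l, h⟩ else (0 : Qd)) i v := by
        intro a i v; funext l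
        by_cases hl : l = i
        · subst hl; simp
        · rw [update_of_ne hl]
          split_ifs with h
          · rw [update_of_ne]; intro e; exact hl (congrArg Fin.val e)
          · rfl
      refine ⟨⟨fun y => g (fun i => if h : i < n then y ⟨i, h⟩ else 0), ?_⟩, ?_⟩
      · intro a i b
        beta_reduce
        simp only [ku]
        have hi : (i : ℕ) ∈ Finset.range n := by simp
        obtain ⟨v, hv⟩ := qg.ex (fun l => if h : l < n then a ⟨l, h⟩ else 0) hi b
        exact ⟨v, hv, fun w hw => qg.inj _ i hi (hw.trans hv.symm)⟩
      · apply Subtype.ext; funext x; exact key x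
  rw [this, Nat.card_eq_fintype_card, Fintype.card_coe, nv]
end QG

/-- For `n ≥ 5`, the number `v_n` of `n`-quasigroups of order 4 satisfies
`3^(n+1)·2^(2^n+1) ≤ v_n ≤ (3^(n+1)+1)·2^(2^n+1)`. -/
theorem card_quasigroups_bounds (n : ℕ) (hn : 5 ≤ n) :
    3 ^ (n + 1) * 2 ^ (2 ^ n + 1) ≤
        Nat.card {f : (Fin n → V4) → V4 // IsNQuasigroup f} ∧
      Nat.card {f : (Fin n → V4) → V4 // IsNQuasigroup f} ≤
        (3 ^ (n + 1) + 1) * 2 ^ (2 ^ n + 1) := by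
  rw [QG.transfer]
  have hc := Finset.card_range n
  constructor
  · have := QG.lower (D := Finset.range n) (by omega)
    rwa [hc, QG.pn3] at this
  · have := QG.nv_gen (D := Finset.range n) (by rw [hc]; exact (QG.upper n _ hc (by omega)).1 hn)
    rwa [hc] at this
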